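/- Let W ⊊ ℂ be a bounded domain, let γ : [0,∞) → W be an injective continuous curve that tends to the boundary of W, let K ⊆ ∂W be the set of accumulation points of γ(t) as t → ∞, and let (ε_n) be a sequence of positive real numbers with ε_n → 0. Then there exist a holomorphic function g : W → ℂ and an open, connected, simply connected set V with γ([0,∞)) ⊆ V ⊆ W and g(V) ⊆ V, such that for every z ∈ V: the set of accumulation points of the orbit (g^n(z))_{n≥0} equals K, and there exists n₀ ≥ 0 such that dist(g^n(z), ∂W) ≥ ε_n for all n ≥ n₀. -/

import Mathlib

open Set Filter Topology Metric

theorem exists_local_root_of_deriv_eq_zero {f : ℂ → ℂ} {z₀ : ℂ} (hf : AnalyticAt ℂ f z₀)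
    (h0 : f z₀ = 0) (hd : deriv f z₀ = 0) (hne : ¬ ∀ᶠ z in 𝓝 z₀, f z = 0) :
    ∃ (n : ℕ) (q : ℂ → ℂ), 2 ≤ n ∧ AnalyticAt ℂ q z₀ ∧ q z₀ = 0 ∧ deriv q z₀ ≠ 0 ∧
      ∀ᶠ z in 𝓝 z₀, f z = q z ^ n := by
  obtain ⟨n, g, hg, hg0, hfg⟩ := hf.exists_eventuallyEq_pow_smul_nonzero_iff.2 hne
  have hn2 : 2 ≤ n := by
    by_contra hlt
    have : n = 0 ∨ n = 1 := by omega
    rcases this with rfl | rfl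
    · have := hfg.self_of_nhds
      simp [h0] at this
      exact hg0 this.symm
    · have h1 : f =ᶠ[𝓝 z₀] fun z => (z - z₀) * g z := by
        filter_upwards [hfg] with z hz
        simpa using hz
      have h2 : HasDerivAt (fun z => (z - z₀) * g z) (1 * g z₀ + (z₀ - z₀) * deriv g z₀) z₀ :=
        ((hasDerivAt_id z₀).sub_const z₀).mul hg.differentiableAt.hasDerivAt
      have h3 := h1.deriv_eq
      rw [h2.deriv, hd] at h3
      simp at h3
      exact hg0 h3.symm
  have hn0 : (n : ℂ) ≠ 0 := by
    have : n ≠ 0 := by omega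
    exact_mod_cast this
  -- normalise `g` near the value `1` so that the principal branch of the logarithm is available
  let c : ℂ := (g z₀) ^ ((1 : ℂ) / n)
  have hc : c ^ n = g z₀ := by
    simp only [c, ← Complex.cpow_nat_mul]
    rw [mul_one_div_cancel hn0, Complex.cpow_one]
  have hc0 : c ≠ 0 := by
    intro h
    rw [h, zero_pow (by omega)] at hc
    exact hg0 hc.symm
  let r : ℂ → ℂ := fun z => c * Complex.exp (Complex.log (g z / g z₀) / n)
  have hlog : AnalyticAt ℂ (fun z => Complex.log (g z / g z₀)) z₀ := by
    refine (hg.div_const).clog ?_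
    rw [div_self hg0]
    exact Complex.one_mem_slitPlane
  have hr : AnalyticAt ℂ r z₀ := analyticAt_const.mul (hlog.div_const).cexp
  have hrz : r z₀ = c := by simp [r, div_self hg0]
  have hq : AnalyticAt ℂ (fun z => (z - z₀) * r z) z₀ :=
    (analyticAt_id.sub analyticAt_const).mul hr
  refine ⟨n, fun z => (z - z₀) * r z, hn2, hq, by simp, ?_, ?_⟩
  · have h2 : HasDerivAt (fun z => (z - z₀) * r z) (1 * r z₀ + (z₀ - z₀) * deriv r z₀) z₀ :=
        ((hasDerivAt_id z₀).sub_const z₀).mul hr.differentiableAt.hasDerivAt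
    rw [h2.deriv, hrz]
    simpa using hc0
  · have hgne : ∀ᶠ z in 𝓝 z₀, g z ≠ 0 := hg.continuousAt.eventually_ne hg0
    filter_upwards [hfg, hgne] with z hz hgz
    rw [hz, mul_pow]
    simp only [r, mul_pow, hc, ← Complex.exp_nat_mul, smul_eq_mul]
    rw [mul_div_cancel₀ _ hn0, Complex.exp_log (div_ne_zero hgz hg0), mul_div_cancel₀ _ hg0]

theorem deriv_ne_zero_of_injOn {f : ℂ → ℂ} {U : Set ℂ} (hU : IsOpen U)
    (hf : DifferentiableOn ℂ f U) (hinj : InjOn f U) {z₀ : ℂ} (hz : z₀ ∈ U) : deriv f z₀ ≠ 0 := by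
  intro hd
  have hfa : AnalyticAt ℂ f z₀ := hf.analyticAt (hU.mem_nhds hz)
  have hF : AnalyticAt ℂ (fun z => f z - f z₀) z₀ := hfa.sub analyticAt_const
  have hne : ¬ ∀ᶠ z in 𝓝 z₀, f z - f z₀ = 0 := by
    intro h
    have h1 : ∀ᶠ z in 𝓝[≠] z₀, f z - f z₀ = 0 ∧ z ∈ U :=
      (h.and (hU.mem_nhds hz)).filter_mono nhdsWithin_le_nhds
    obtain ⟨z, ⟨hz1, hz2⟩, hz3⟩ := (h1.and self_mem_nhdsWithin).exists
    exact hz3 (hinj hz2 hz (sub_eq_zero.1 hz1))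
  obtain ⟨n, q, hn, hq, hq0, hqd, hfq⟩ := exists_local_root_of_deriv_eq_zero hF (by simp)
    (by rw [deriv_sub_const]; exact hd) hne
  have hqne : ¬ ∀ᶠ z in 𝓝 z₀, q z = q z₀ := by
    intro h
    have : q =ᶠ[𝓝 z₀] fun _ => q z₀ := h
    rw [this.deriv_eq] at hqd
    simp at hqd
  have hmap := hq.eventually_constant_or_nhds_le_map_nhds.resolve_left hqne
  rw [hq0] at hmap
  let ω : ℂ := Complex.exp (2 * Real.pi * Complex.I / n)
  have hω : IsPrimitiveRoot ω n := Complex.isPrimitiveRoot_exp n (by omega)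
  have hgood : {z | z ∈ U ∧ f z - f z₀ = q z ^ n} ∈ 𝓝 z₀ := inter_mem (hU.mem_nhds hz) hfq
  have him : q '' {z | z ∈ U ∧ f z - f z₀ = q z ^ n} ∈ 𝓝 (0 : ℂ) := hmap (image_mem_map hgood)
  have hmul : Tendsto (fun t : ℂ => ω * t) (𝓝 0) (𝓝 0) := by
    have : Continuous fun t : ℂ => ω * t := by fun_prop
    simpa using this.tendsto 0
  have h2 : ∀ᶠ t in 𝓝[≠] (0 : ℂ), t ∈ q '' {z | z ∈ U ∧ f z - f z₀ = q z ^ n} ∧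
      ω * t ∈ q '' {z | z ∈ U ∧ f z - f z₀ = q z ^ n} :=
    (inter_mem him (hmul him) : _ ∈ 𝓝 (0 : ℂ)) |> fun h => nhdsWithin_le_nhds h
  obtain ⟨t, ⟨⟨z1, ⟨hz1, e1⟩, rfl⟩, ⟨z2, ⟨hz2, e2⟩, e3⟩⟩, ht⟩ := (h2.and self_mem_nhdsWithin).exists
  have : z1 = z2 := by
    apply hinj hz1 hz2
    have : f z1 - f z₀ = f z2 - f z₀ := by
      rw [e1, e2, e3, mul_pow, hω.pow_eq_one, one_mul]
    simpa using this
  subst this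
  have h3 : (ω - 1) * q z1 = 0 := by linear_combination -e3
  rcases mul_eq_zero.1 h3 with h | h
  · exact hω.ne_one (by omega) (sub_eq_zero.1 h)
  · exact ht h

/-- The inverse of an injective holomorphic function is holomorphic on the (open) image. -/
theorem differentiableOn_invFunOn_of_injOn {f : ℂ → ℂ} {U : Set ℂ} (hU : IsOpen U)
    (hf : DifferentiableOn ℂ f U) (hinj : InjOn f U) :
    IsOpen (f '' U) ∧ DifferentiableOn ℂ (Function.invFunOn f U) (f '' U) := by
  have hopen : ∀ s ⊆ U, IsOpen s → IsOpen (f '' s) := by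
    intro s hs hso
    rw [isOpen_iff_mem_nhds]
    rintro _ ⟨z, hz, rfl⟩
    have hs' : HasStrictDerivAt f (deriv f z) z :=
      (hf.analyticAt (hU.mem_nhds (hs hz))).hasStrictDerivAt
    rw [← hs'.map_nhds_eq (deriv_ne_zero_of_injOn hU hf hinj (hs hz))]
    exact image_mem_map (hso.mem_nhds hz)
  have hinv : ∀ z ∈ U, Function.invFunOn f U (f z) = z := fun z hz =>
    hinj.leftInvOn_invFunOn hz
  have hiO := hopen U Subset.rfl hU
  refine ⟨hiO, ?_⟩
  rintro _ ⟨z, hz, rfl⟩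
  have hcont : ContinuousAt (Function.invFunOn f U) (f z) := by
    rw [ContinuousAt, hinv z hz]
    intro t ht
    obtain ⟨s, hst, hso, hzs⟩ := _root_.mem_nhds_iff.1 (inter_mem ht (hU.mem_nhds hz))
    refine mem_map.2 <| mem_of_superset ((hopen s (fun x hx => (hst hx).2) hso).mem_nhds ⟨z, hzs, rfl⟩) ?_
    rintro _ ⟨y, hy, rfl⟩
    rw [mem_preimage, hinv y (hst hy).2]
    exact (hst hy).1
  have hd : HasDerivAt f (deriv f z) (Function.invFunOn f U (f z)) := by
    rw [hinv z hz]
    exact (hf.differentiableAt (hU.mem_nhds hz)).hasDerivAt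
  refine (hd.of_local_left_inverse hcont (deriv_ne_zero_of_injOn hU hf hinj hz) ?_).differentiableAt.differentiableWithinAt
  filter_upwards [hiO.mem_nhds ⟨z, hz, rfl⟩] with w hw
  obtain ⟨y, hy, rfl⟩ := hw
  rw [hinv y hy]

theorem exists_log_of_isExactOn {U : Set ℂ} (hUo : IsOpen U) (hUc : IsPreconnected U)
    (hprim : ∀ f : ℂ → ℂ, DifferentiableOn ℂ f U → Complex.IsExactOn f U)
    {f : ℂ → ℂ} (hf : DifferentiableOn ℂ f U) (h0 : ∀ z ∈ U, f z ≠ 0) :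
    ∃ l : ℂ → ℂ, DifferentiableOn ℂ l U ∧ ∀ z ∈ U, Complex.exp (l z) = f z := by
  rcases U.eq_empty_or_nonempty with rfl | ⟨a, ha⟩
  · exact ⟨0, by simp, by simp⟩
  obtain ⟨G, hG⟩ := hprim (fun z => deriv f z / f z) ((hf.deriv hUo).div hf h0)
  have hfd : ∀ z ∈ U, HasDerivAt f (deriv f z) z := fun z hz =>
    (hf.differentiableAt (hUo.mem_nhds hz)).hasDerivAt
  have hk : ∀ z ∈ U, HasDerivAt (fun z => f z * Complex.exp (-G z)) 0 z := by
    intro z hz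
    have h1 := (hfd z hz).mul ((hG z hz).neg.cexp)
    have h2 : deriv f z * Complex.exp (-G z) +
        f z * (Complex.exp (-G z) * -(deriv f z / f z)) = 0 := by
      have := h0 z hz
      field_simp
      ring
    exact h2 ▸ h1
  have hconst : ∀ z ∈ U, f z * Complex.exp (-G z) = f a * Complex.exp (-G a) := by
    intro z hz
    exact hUo.is_const_of_deriv_eq_zero hUc
      (fun z hz => (hk z hz).differentiableAt.differentiableWithinAt)
      (fun z hz => (hk z hz).deriv) hz ha
  set c := f a * Complex.exp (-G a) with hc
  have hc0 : c ≠ 0 := mul_ne_zero (h0 a ha) (Complex.exp_ne_zero _)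
  refine ⟨fun z => G z + Complex.log c,
    fun z hz => ((hG z hz).differentiableAt.add_const _).differentiableWithinAt, fun z hz => ?_⟩
  rw [Complex.exp_add, Complex.exp_log hc0, ← hconst z hz, mul_comm, mul_assoc, ← Complex.exp_add]
  simp

theorem exists_tendstoLocallyUniformlyOn_ultrafilter {U : Set ℂ} (hUo : IsOpen U)
    {F : ℕ → ℂ → ℂ} (hF : ∀ n, DifferentiableOn ℂ (F n) U) {M : ℝ}
    (hM : ∀ n, ∀ z ∈ U, ‖F n z‖ ≤ M) (𝒰 : Ultrafilter ℕ) :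
    ∃ f : ℂ → ℂ, TendstoLocallyUniformlyOn F f 𝒰 U := by
  have hlim : ∀ z : ℂ, ∃ w : ℂ, z ∈ U → Tendsto (fun n => F n z) 𝒰 (𝓝 w) := by
    intro z
    by_cases hz : z ∈ U
    · have hc : IsCompact (closedBall (0 : ℂ) M) := isCompact_closedBall _ _
      have := hc.ultrafilter_le_nhds (𝒰.map (fun n => F n z)) (by
        rw [Ultrafilter.coe_map, le_principal_iff]
        exact mem_map.2 (univ_mem' fun n => by simpa using hM n z hz))
      obtain ⟨w, _, hw⟩ := this
      exact ⟨w, fun _ => hw⟩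
    · exact ⟨0, fun h => absurd h hz⟩
  choose f hf using hlim
  refine ⟨f, ?_⟩
  rw [Metric.tendstoLocallyUniformlyOn_iff]
  intro ε hε x hx
  obtain ⟨r, hr, hrU⟩ := Metric.isOpen_iff.1 hUo x hx
  have hM0 : 0 ≤ M := (norm_nonneg _).trans (hM 0 x hx)
  have hlip : ∀ n, ∀ y ∈ ball x r, dist (F n y) (F n x) ≤ (2 * M) / r * dist y x := by
    intro n y hy
    refine Complex.dist_le_div_mul_dist_of_mapsTo_ball ((hF n).mono hrU) (fun w hw => ?_) hy
    rw [mem_closedBall, dist_eq_norm]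
    linarith [norm_sub_le (F n w) (F n x), hM n w (hrU hw), hM n x hx]
  let δ := min r (ε / (4 * ((2 * M) / r + 1)))
  have hC : 0 < (2 * M) / r + 1 := by positivity
  have hδ : 0 < δ := lt_min hr (by positivity)
  have hsmall : ∀ n, ∀ y ∈ ball x δ, dist (F n y) (F n x) ≤ ε / 4 := by
    intro n y hy
    have h1 : dist y x < r := (mem_ball.1 hy).trans_le (min_le_left _ _)
    have h2 : dist y x < ε / (4 * ((2 * M) / r + 1)) := (mem_ball.1 hy).trans_le (min_le_right _ _)
    refine (hlip n y h1).trans ?_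
    calc (2 * M) / r * dist y x ≤ ((2 * M) / r + 1) * (ε / (4 * ((2 * M) / r + 1))) := by
          gcongr
          linarith
      _ = ε / 4 := by field_simp
  refine ⟨ball x δ, mem_nhdsWithin_of_mem_nhds (ball_mem_nhds _ hδ), ?_⟩
  have hev : ∀ᶠ n in (𝒰 : Filter ℕ), dist (F n x) (f x) < ε / 4 :=
    (Metric.tendsto_nhds.1 (hf x hx)) _ (by positivity)
  filter_upwards [hev] with n hn y hy
  have hyU : y ∈ U := hrU (ball_subset_ball (min_le_left _ _) hy)
  have hfy : dist (f y) (f x) ≤ ε / 4 := by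
    refine le_of_tendsto ((hf y hyU).dist (hf x hx)) (Eventually.of_forall fun m => hsmall m y hy)
  have := hsmall n y hy
  have h4 := dist_triangle4 (f y) (f x) (F n x) (F n y)
  rw [dist_comm (f x), dist_comm (F n x) (F n y)] at h4
  linarith

/-- **Hurwitz's theorem** for injective functions. -/
theorem injOn_of_tendstoLocallyUniformlyOn {U : Set ℂ} (hUo : IsOpen U) (hUc : IsPreconnected U)
    {ι : Type*} {p : Filter ι} [p.NeBot] {F : ι → ℂ → ℂ} {f : ℂ → ℂ}
    (hF : ∀ n, DifferentiableOn ℂ (F n) U) (hinj : ∀ n, InjOn (F n) U)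
    (hlim : TendstoLocallyUniformlyOn F f p U) {a : ℂ} (ha : a ∈ U) (hd : deriv f a ≠ 0) :
    InjOn f U := by
  have hf : DifferentiableOn ℂ f U :=
    hlim.differentiableOn (Eventually.of_forall hF) hUo
  have hfan : AnalyticOnNhd ℂ f U := hf.analyticOnNhd hUo
  have hnc : ∀ z ∈ U, ∀ᶠ w in 𝓝[≠] z, f w ≠ f z := by
    intro z hz
    rcases (hfan z hz).eventually_eq_or_eventually_ne analyticAt_const (g := fun _ => f z)
      with h | h
    · exfalso
      have h1 := hfan.eqOn_of_preconnected_of_eventuallyEq analyticOnNhd_const hUc hz h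
      have h2 : f =ᶠ[𝓝 a] fun _ => f z := by
        filter_upwards [hUo.mem_nhds ha] with w hw using h1 hw
      rw [h2.deriv_eq] at hd
      simp at hd
    · exact h
  -- near every point, values of the limit are attained by the approximants
  have key : ∀ z ∈ U, ∀ t ∈ 𝓝 z, ∀ᶠ n in p, ∃ w ∈ t ∩ U, F n w = f z := by
    intro z hz t ht
    have h1 : ∀ᶠ w in 𝓝 z, w ≠ z → f w ≠ f z := by
      have := hnc z hz
      rwa [eventually_nhdsWithin_iff] at this
    obtain ⟨r, hr, hrs⟩ := Metric.eventually_nhds_iff_ball.1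
      (h1.and ((inter_mem ht (hUo.mem_nhds hz) : ∀ᶠ w in 𝓝 z, w ∈ t ∩ U)))
    let ρ := r / 2
    have hρ : 0 < ρ := by positivity
    have hsub : closedBall z ρ ⊆ ball z r := closedBall_subset_ball (by simp [ρ, hr])
    have hcont : ContinuousOn (fun w => ‖f w - f z‖) (sphere z ρ) :=
      ((hf.continuousOn.mono fun w hw => (hrs w (hsub (sphere_subset_closedBall hw))).2.2).sub
        continuousOn_const).norm
    obtain ⟨w0, hw0, hmin⟩ := (isCompact_sphere z ρ).exists_isMinOn
      (NormedSpace.sphere_nonempty.2 hρ.le) hcont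
    set ε := ‖f w0 - f z‖ with hε
    have hεpos : 0 < ε := by
      rw [hε, norm_pos_iff, sub_ne_zero]
      refine (hrs w0 (hsub (sphere_subset_closedBall hw0))).1 ?_
      rintro rfl
      simp [hρ.ne] at hw0
    have hunif : TendstoUniformlyOn F f p (closedBall z ρ) :=
      (tendstoLocallyUniformlyOn_iff_forall_isCompact hUo).1 hlim _
        (fun w hw => (hrs w (hsub hw)).2.2) (isCompact_closedBall _ _)
    filter_upwards [(Metric.tendstoUniformlyOn_iff.1 hunif) (ε / 8) (by positivity)] with n hn
    have hn' : ∀ w ∈ closedBall z ρ, ‖f w - F n w‖ < ε / 8 := fun w hw => by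
      simpa [dist_eq_norm] using hn w hw
    have hzz := hn' z (mem_closedBall_self hρ.le)
    have hdc : DiffContOnCl ℂ (F n) (ball z ρ) := by
      refine DifferentiableOn.diffContOnCl ?_
      rw [closure_ball _ hρ.ne']
      exact (hF n).mono fun w hw => (hrs w (hsub hw)).2.2
    have hsph : ∀ w ∈ sphere z ρ, ε / 2 ≤ ‖F n w - F n z‖ := by
      intro w hw
      have h2 : ε ≤ ‖f w - f z‖ := hmin hw
      have h3 := hn' w (sphere_subset_closedBall hw)
      have h4 : f w - f z = (f w - F n w) + (F n w - F n z) - (f z - F n z) := by ring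
      have h5 := norm_sub_le ((f w - F n w) + (F n w - F n z)) (f z - F n z)
      have h6 := norm_add_le (f w - F n w) (F n w - F n z)
      rw [← h4] at h5
      linarith
    have hfreq : ∃ᶠ w in 𝓝 z, F n w ≠ F n z := by
      have h2 : ∃ᶠ w in 𝓝[≠] z, F n w ≠ F n z := by
        refine Eventually.frequently ?_
        rw [eventually_nhdsWithin_iff]
        filter_upwards [hUo.mem_nhds hz] with w hw hwz h
        exact hwz (hinj n hw hz h)
      exact h2.filter_mono nhdsWithin_le_nhds
    have := hdc.ball_subset_image_closedBall hρ hsph hfreq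
    obtain ⟨w, hw, hwe⟩ := this (show f z ∈ ball (F n z) (ε / 2 / 2) by
      rw [mem_ball, dist_eq_norm]; linarith)
    exact ⟨w, (hrs w (hsub hw)).2, hwe⟩
  intro z hz y hy hzy
  by_contra hne
  obtain ⟨s, t, hs, ht, hzs, hyt, hst⟩ := t2_separation hne
  obtain ⟨n, ⟨w, hw, hwe⟩, ⟨v, hv, hve⟩⟩ :=
    ((key z hz s (hs.mem_nhds hzs)).and (key y hy t (ht.mem_nhds hyt))).exists
  have : w = v := hinj n hw.2 hv.2 (by rw [hwe, hve, hzy])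
  subst this
  exact disjoint_left.1 hst hw.1 hv.1

theorem one_sub_conj_mul_ne_zero {b w : ℂ} (hb : ‖b‖ < 1) (hw : ‖w‖ < 1) :
    1 - (starRingEnd ℂ) b * w ≠ 0 := by
  intro h
  have : ‖(starRingEnd ℂ) b * w‖ < 1 := by
    rw [norm_mul, RCLike.norm_conj]
    nlinarith [norm_nonneg b, norm_nonneg w]
  rw [← sub_eq_zero.1 h] at this
  simp at this

theorem norm_moebius_lt_one {b w : ℂ} (hb : ‖b‖ < 1) (hw : ‖w‖ < 1) :
    ‖(w - b) / (1 - (starRingEnd ℂ) b * w)‖ < 1 := by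
  have h0 := one_sub_conj_mul_ne_zero hb hw
  rw [norm_div, div_lt_one (norm_pos_iff.2 h0)]
  have h1 : ‖w - b‖ ^ 2 < ‖1 - (starRingEnd ℂ) b * w‖ ^ 2 := by
    have e : ‖1 - (starRingEnd ℂ) b * w‖ ^ 2 - ‖w - b‖ ^ 2 = (1 - ‖b‖ ^ 2) * (1 - ‖w‖ ^ 2) := by
      simp only [Complex.sq_norm, Complex.normSq_apply, Complex.sub_re, Complex.sub_im,
        Complex.mul_re, Complex.mul_im, Complex.one_re, Complex.one_im, Complex.conj_re,
        Complex.conj_im]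
      ring
    have : 0 < (1 - ‖b‖ ^ 2) * (1 - ‖w‖ ^ 2) := by
      apply mul_pos <;> nlinarith [norm_nonneg b, norm_nonneg w]
    linarith
  exact lt_of_pow_lt_pow_left₀ 2 (norm_nonneg _) h1

theorem moebius_injective {b w v : ℂ} (hb : ‖b‖ < 1) (hw : ‖w‖ < 1) (hv : ‖v‖ < 1)
    (h : (w - b) / (1 - (starRingEnd ℂ) b * w) = (v - b) / (1 - (starRingEnd ℂ) b * v)) :
    w = v := by
  rw [div_eq_div_iff (one_sub_conj_mul_ne_zero hb hw) (one_sub_conj_mul_ne_zero hb hv)] at h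
  have h1 : (w - v) * (1 - (starRingEnd ℂ) b * b) = 0 := by linear_combination h
  rcases mul_eq_zero.1 h1 with h | h
  · exact sub_eq_zero.1 h
  · exact absurd h (one_sub_conj_mul_ne_zero hb hb)

theorem hasDerivAt_moebius {b w : ℂ} (hb : ‖b‖ < 1) (hw : ‖w‖ < 1) :
    HasDerivAt (fun w : ℂ => (w - b) / (1 - (starRingEnd ℂ) b * w))
      ((1 - (starRingEnd ℂ) b * b) / (1 - (starRingEnd ℂ) b * w) ^ 2) w := by
  have h1 : HasDerivAt (fun w : ℂ => w - b) 1 w := (hasDerivAt_id w).sub_const b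
  have h2 : HasDerivAt (fun w : ℂ => 1 - (starRingEnd ℂ) b * w) (-((starRingEnd ℂ) b)) w := by
    simpa using ((hasDerivAt_id w).const_mul ((starRingEnd ℂ) b)).const_sub 1
  have h3 := h1.div h2 (one_sub_conj_mul_ne_zero hb hw)
  have h4 : 1 * (1 - (starRingEnd ℂ) b * w) - (w - b) * -((starRingEnd ℂ) b) =
      1 - (starRingEnd ℂ) b * b := by ring
  exact h4 ▸ h3

/-- Koebe's square root trick: an injective map into the disc which is not onto can be improved. -/
theorem exists_larger_deriv {U : Set ℂ} (hUo : IsOpen U) (hUc : IsPreconnected U)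
    (hprim : ∀ f : ℂ → ℂ, DifferentiableOn ℂ f U → Complex.IsExactOn f U)
    {f : ℂ → ℂ} (hf : DifferentiableOn ℂ f U) (hinj : InjOn f U) (hm : ∀ z ∈ U, ‖f z‖ < 1)
    {a : ℂ} (ha : a ∈ U) (hfa : f a = 0) {b : ℂ} (hb : ‖b‖ < 1) (hbf : ∀ z ∈ U, f z ≠ b) :
    ∃ F : ℂ → ℂ, DifferentiableOn ℂ F U ∧ InjOn F U ∧ (∀ z ∈ U, ‖F z‖ < 1) ∧ F a = 0 ∧
      ‖deriv f a‖ < ‖deriv F a‖ := by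
  let g : ℂ → ℂ := fun z => (f z - b) / (1 - (starRingEnd ℂ) b * f z)
  have hgd : ∀ z ∈ U, HasDerivAt g
      ((1 - (starRingEnd ℂ) b * b) / (1 - (starRingEnd ℂ) b * f z) ^ 2 * deriv f z) z := fun z hz =>
    HasDerivAt.comp z (hasDerivAt_moebius hb (hm z hz))
      (hf.differentiableAt (hUo.mem_nhds hz)).hasDerivAt
  have hg0 : ∀ z ∈ U, g z ≠ 0 := fun z hz =>
    div_ne_zero (sub_ne_zero.2 (hbf z hz)) (one_sub_conj_mul_ne_zero hb (hm z hz))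
  have hg1 : ∀ z ∈ U, ‖g z‖ < 1 := fun z hz => norm_moebius_lt_one hb (hm z hz)
  obtain ⟨l, hl, hle⟩ := exists_log_of_isExactOn hUo hUc hprim
    (fun z hz => (hgd z hz).differentiableAt.differentiableWithinAt) hg0
  let s : ℂ → ℂ := fun z => Complex.exp (l z / 2)
  have hs2 : ∀ z ∈ U, s z ^ 2 = g z := by
    intro z hz
    rw [← hle z hz, ← Complex.exp_nat_mul]
    congr 1
    push_cast
    ring
  have hs1 : ∀ z ∈ U, ‖s z‖ < 1 := by
    intro z hz
    have := hg1 z hz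
    rw [← hs2 z hz, norm_pow] at this
    exact (pow_lt_one_iff_of_nonneg (norm_nonneg _) two_ne_zero).1 this
  have hsd : ∀ z ∈ U, HasDerivAt s (deriv s z) z := fun z hz =>
    (((hl.differentiableAt (hUo.mem_nhds hz)).div_const 2).cexp).hasDerivAt
  have hder : 2 * s a * deriv s a = (1 - (starRingEnd ℂ) b * b) * deriv f a := by
    have h1 : HasDerivAt (fun z => s z ^ 2) (2 * s a * deriv s a) a := by
      have h := (hsd a ha).mul (hsd a ha)
      have e : (fun z => s z ^ 2) = s * s := by funext z; simp [sq]
      rw [e, show 2 * s a * deriv s a = deriv s a * s a + s a * deriv s a by ring]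
      exact h
    have h2 : g =ᶠ[𝓝 a] fun z => s z ^ 2 := by
      filter_upwards [hUo.mem_nhds ha] with z hz using (hs2 z hz).symm
    have h3 := (h1.congr_of_eventuallyEq h2).unique (hgd a ha)
    rw [h3, hfa]
    simp
  set c := s a with hc
  have hc1 : ‖c‖ < 1 := hs1 a ha
  have hcb : c ^ 2 = -b := by rw [hc, hs2 a ha]; simp [g, hfa]
  have hc0 : c ≠ 0 := Complex.exp_ne_zero _
  have hFd : ∀ z ∈ U, HasDerivAt (fun z => (s z - c) / (1 - (starRingEnd ℂ) c * s z))
      ((1 - (starRingEnd ℂ) c * c) / (1 - (starRingEnd ℂ) c * s z) ^ 2 * deriv s z) z :=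
    fun z hz => HasDerivAt.comp z (hasDerivAt_moebius hc1 (hs1 z hz)) (hsd z hz)
  refine ⟨fun z => (s z - c) / (1 - (starRingEnd ℂ) c * s z),
    fun z hz => (hFd z hz).differentiableAt.differentiableWithinAt, ?_,
    fun z hz => norm_moebius_lt_one hc1 (hs1 z hz), by simp [hc], ?_⟩
  · intro z hz w hw hzw
    have h1 := moebius_injective hc1 (hs1 z hz) (hs1 w hw) hzw
    have h2 : g z = g w := by rw [← hs2 z hz, ← hs2 w hw, h1]
    exact hinj hz hw (moebius_injective hb (hm z hz) (hm w hw) h2)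
  · rw [(hFd a ha).deriv, ← hc]
    have hfa0 : deriv f a ≠ 0 := deriv_ne_zero_of_injOn hUo hf hinj ha
    have hcc : (starRingEnd ℂ) c * c = ((‖c‖ ^ 2 : ℝ) : ℂ) := by
      rw [Complex.conj_mul']; push_cast; rfl
    have hbb : (starRingEnd ℂ) b * b = ((‖c‖ ^ 4 : ℝ) : ℂ) := by
      rw [Complex.conj_mul']
      have : ‖b‖ = ‖c‖ ^ 2 := by rw [← norm_pow, hcb, norm_neg]
      rw [this]; push_cast; ring
    have hn : 0 < ‖c‖ := norm_pos_iff.2 hc0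
    have h1c : (1 : ℝ) - ‖c‖ ^ 2 > 0 := by nlinarith
    have e1 : deriv s a = (1 - ((‖c‖ ^ 4 : ℝ) : ℂ)) * deriv f a / (2 * c) := by
      rw [eq_div_iff (by simpa using hc0), ← hbb, ← hder]; ring
    rw [e1, hcc]
    have e2 : (1 - ((‖c‖ ^ 2 : ℝ) : ℂ)) / (1 - ((‖c‖ ^ 2 : ℝ) : ℂ)) ^ 2 *
        ((1 - ((‖c‖ ^ 4 : ℝ) : ℂ)) * deriv f a / (2 * c)) =
        ((1 + ‖c‖ ^ 2 : ℝ) : ℂ) * deriv f a / (2 * c) := by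
      have : (1 - ((‖c‖ ^ 2 : ℝ) : ℂ)) ≠ 0 := by
        rw [← Complex.ofReal_one, ← Complex.ofReal_sub]
        exact_mod_cast h1c.ne'
      field_simp
      push_cast
      ring
    rw [e2, norm_div, norm_mul, norm_mul, Complex.norm_real, Complex.norm_ofNat,
      Real.norm_of_nonneg (by positivity), lt_div_iff₀ (by positivity)]
    have := norm_pos_iff.2 hfa0
    nlinarith [sq_nonneg (1 - ‖c‖), mul_pos this (by nlinarith : 0 < (1 - ‖c‖) ^ 2)]

/-- **Riemann mapping theorem** for bounded domains on which holomorphic functions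
have primitives. -/
theorem exists_bijOn_ball {U : Set ℂ} (hUo : IsOpen U) (hUc : IsPreconnected U)
    (hUb : Bornology.IsBounded U)
    (hprim : ∀ f : ℂ → ℂ, DifferentiableOn ℂ f U → Complex.IsExactOn f U)
    {a : ℂ} (ha : a ∈ U) :
    ∃ F : ℂ → ℂ, DifferentiableOn ℂ F U ∧ BijOn F U (ball 0 1) := by
  let 𝓕 : Set (ℂ → ℂ) := {f | DifferentiableOn ℂ f U ∧ InjOn f U ∧ (∀ z ∈ U, ‖f z‖ < 1) ∧ f a = 0}
  obtain ⟨R, hR, hUR⟩ := hUb.subset_ball_lt 0 a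
  have hmem0 : (fun z => (z - a) / R) ∈ 𝓕 := by
    have hR' : (R : ℂ) ≠ 0 := by exact_mod_cast hR.ne'
    refine ⟨by fun_prop, fun z _ w _ h => ?_, fun z hz => ?_, by simp⟩
    · simpa [div_left_inj' hR'] using h
    · have := hUR hz
      rw [mem_ball, dist_eq_norm] at this
      rw [norm_div, Complex.norm_real, Real.norm_of_nonneg hR.le, div_lt_one hR]
      exact this
  obtain ⟨r, hr, hrU⟩ := Metric.isOpen_iff.1 hUo a ha
  let S : Set ℝ := (fun f : ℂ → ℂ => ‖deriv f a‖) '' 𝓕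
  have hSb : BddAbove S := by
    refine ⟨1 / r, ?_⟩
    rintro _ ⟨f, hf, rfl⟩
    refine Complex.norm_deriv_le_div_of_mapsTo_ball (hf.1.mono hrU) (fun z hz => ?_) hr
    rw [hf.2.2.2, mem_closedBall_zero_iff]
    exact (hf.2.2.1 z (hrU hz)).le
  have hSn : S.Nonempty := ⟨_, _, hmem0, rfl⟩
  obtain ⟨u, -, hu, huS⟩ := exists_seq_tendsto_sSup hSn hSb
  choose f hf hfu using huS
  let 𝒰 : Ultrafilter ℕ := Ultrafilter.of atTop
  have hU' : (𝒰 : Filter ℕ) ≤ atTop := Ultrafilter.of_le atTop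
  obtain ⟨F, hF⟩ := exists_tendstoLocallyUniformlyOn_ultrafilter hUo (F := f) (fun n => (hf n).1)
    (M := 1) (fun n z hz => ((hf n).2.2.1 z hz).le) 𝒰
  have hFd : DifferentiableOn ℂ F U :=
    hF.differentiableOn (Eventually.of_forall fun n => (hf n).1) hUo
  have hderiv : ‖deriv F a‖ = sSup S := by
    have h1 := ((hF.deriv (Eventually.of_forall fun n => (hf n).1) hUo).tendsto_at ha).norm
    have h2 : Tendsto (fun n => ‖deriv (f n) a‖) 𝒰 (𝓝 (sSup S)) := by
      simpa only [hfu] using hu.mono_left hU'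
    exact tendsto_nhds_unique h1 h2
  have hpos : 0 < sSup S := by
    refine lt_of_lt_of_le ?_ (le_csSup hSb ⟨_, hmem0, rfl⟩)
    exact norm_pos_iff.2 (deriv_ne_zero_of_injOn hUo hmem0.1 hmem0.2.1 ha)
  have hd0 : deriv F a ≠ 0 := by rw [← norm_pos_iff, hderiv]; exact hpos
  have hFinj : InjOn F U :=
    injOn_of_tendstoLocallyUniformlyOn hUo hUc (fun n => (hf n).1) (fun n => (hf n).2.1) hF ha hd0
  have hFa : F a = 0 := by
    have h1 := hF.tendsto_at ha
    simp only [fun n => (hf n).2.2.2] at h1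
    exact (tendsto_nhds_unique h1 tendsto_const_nhds)
  have hFle : ∀ z ∈ U, ‖F z‖ ≤ 1 := fun z hz =>
    le_of_tendsto (hF.tendsto_at hz).norm (Eventually.of_forall fun n => ((hf n).2.2.1 z hz).le)
  have hFlt : ∀ z ∈ U, ‖F z‖ < 1 := by
    intro z hz
    have ho : IsOpen (F '' U) := (differentiableOn_invFunOn_of_injOn hUo hFd hFinj).1
    have hsub : F '' U ⊆ interior (closedBall (0 : ℂ) 1) := by
      refine interior_maximal ?_ ho
      rintro _ ⟨w, hw, rfl⟩
      simpa using hFle w hw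
    rw [interior_closedBall _ one_ne_zero] at hsub
    simpa using hsub ⟨z, hz, rfl⟩
  refine ⟨F, hFd, fun z hz => by simpa using hFlt z hz, hFinj, ?_⟩
  intro b hb
  by_contra hnb
  obtain ⟨G, hG1, hG2, hG3, hG4, hG5⟩ := exists_larger_deriv hUo hUc hprim hFd hFinj hFlt ha hFa
    (b := b) (by simpa using hb) (fun z hz h => hnb ⟨z, hz, h⟩)
  rw [hderiv] at hG5
  exact absurd (le_csSup hSb ⟨G, ⟨hG1, hG2, hG3, hG4⟩, rfl⟩) (not_le.2 hG5)

/-- A weak form of Bloch's theorem. -/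
theorem norm_deriv_mul_le_of_not_ball_subset {f : ℂ → ℂ} {c : ℂ} {R : ℝ}
    (hf : DifferentiableOn ℂ f (ball c R))
    (h : ∀ w, ¬ ball w 7 ⊆ f '' ball c R) {r : ℝ} (hr : 0 < r) (hrR : r < R) :
    ‖deriv f c‖ * r ≤ 336 := by
  have hd : DifferentiableOn ℂ (deriv f) (ball c R) := hf.deriv isOpen_ball
  have hsub : closedBall c r ⊆ ball c R := closedBall_subset_ball hrR
  obtain ⟨z, hz, hmax⟩ := (isCompact_closedBall c r).exists_isMaxOn
    (f := fun z => ‖deriv f z‖ * (r - dist z c)) ⟨c, by simp [hr.le]⟩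
    (((hd.continuousOn.mono hsub).norm).mul (by fun_prop))
  set M := ‖deriv f z‖ * (r - dist z c) with hM
  have hMc : ‖deriv f c‖ * r ≤ M := by
    have := hmax (show c ∈ closedBall c r by simp [hr.le])
    simpa using this
  refine hMc.trans ?_
  by_contra! hM1
  have hM0 : 0 < M := by linarith
  have hzr : 0 < r - dist z c := by
    rcases lt_or_eq_of_le (sub_nonneg.2 (mem_closedBall.1 hz)) with h | h
    · exact h
    · rw [hM, ← h, mul_zero] at hM0; exact absurd hM0 (lt_irrefl _)
  obtain ⟨t, ht, htz⟩ : ∃ t : ℝ, 0 < t ∧ r - dist z c = 2 * t := ⟨(r - dist z c) / 2, by linarith, by ring⟩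
  have hsubt : ball z t ⊆ ball c r := by
    intro w hw
    have := dist_triangle w z c
    rw [mem_ball] at hw ⊢
    linarith
  have hsubR : ball z t ⊆ ball c R := hsubt.trans (ball_subset_ball hrR.le)
  have hMz : ‖deriv f z‖ = M / (2 * t) := by rw [hM, htz]; field_simp
  have hbd : ∀ w ∈ ball z t, ‖deriv f w‖ ≤ M / t := by
    intro w hw
    have h1 := hmax (ball_subset_closedBall (hsubt hw))
    have h2 := dist_triangle w z c
    rw [mem_ball] at hw
    have h3 : t ≤ r - dist w c := by linarith
    rw [le_div_iff₀ ht]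
    exact (mul_le_mul_of_nonneg_left h3 (norm_nonneg _)).trans h1
  have hmaps : MapsTo (deriv f) (ball z t) (closedBall (deriv f z) (3 * M / (2 * t))) := by
    intro w hw
    rw [mem_closedBall, dist_eq_norm]
    refine (norm_sub_le _ _).trans ?_
    rw [hMz]
    calc _ ≤ M / t + M / (2 * t) := by gcongr; exact hbd w hw
      _ = _ := by field_simp; ring
  have hsch : ∀ w ∈ ball z t, ‖deriv f w - deriv f z‖ ≤ 3 * M / (2 * t) / t * dist w z := by
    intro w hw
    rw [← dist_eq_norm]
    exact Complex.dist_le_div_mul_dist_of_mapsTo_ball (hd.mono hsubR) hmaps hw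
  have hts : closedBall z (t / 6) ⊆ ball z t := closedBall_subset_ball (by linarith)
  have hfd : ∀ w ∈ closedBall z (t / 6), HasDerivWithinAt (fun w => f w - deriv f z * w)
      (deriv f w - deriv f z) (closedBall z (t / 6)) w := by
    intro w hw
    have h1 := (hf.differentiableAt (isOpen_ball.mem_nhds (hsubR (hts hw)))).hasDerivAt
    have h2 := (h1.sub ((hasDerivAt_id w).const_mul (deriv f z))).hasDerivWithinAt
      (s := closedBall z (t / 6))
    rw [mul_one] at h2
    exact h2
  have hsphere : ∀ w ∈ sphere z (t / 6), M / 24 ≤ ‖f w - f z‖ := by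
    intro w hw
    have hwz : dist w z = t / 6 := hw
    have h1 := (convex_closedBall z (t / 6)).norm_image_sub_le_of_norm_hasDerivWithin_le
      (C := M / (4 * t)) hfd (fun v hv => by
        refine (hsch v (hts hv)).trans ?_
        calc 3 * M / (2 * t) / t * dist v z ≤ 3 * M / (2 * t) / t * (t / 6) := by
              gcongr; exact hv
          _ = M / (4 * t) := by field_simp; norm_num)
      (mem_closedBall_self (by linarith)) (sphere_subset_closedBall hw)
    rw [← dist_eq_norm w z, hwz] at h1
    have h2 : ‖deriv f z * (w - z)‖ = M / 12 := by
      rw [norm_mul, hMz, ← dist_eq_norm, hwz]; field_simp; norm_num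
    have h3 : deriv f z * (w - z) = (f w - f z) -
      ((f w - deriv f z * w) - (f z - deriv f z * z)) := by ring
    have h4 := norm_sub_le (f w - f z) ((f w - deriv f z * w) - (f z - deriv f z * z))
    rw [← h3, h2] at h4
    have h5 : M / (4 * t) * (t / 6) = M / 24 := by field_simp; norm_num
    linarith
  have hfreq : ∃ᶠ w in 𝓝 z, f w ≠ f z := by
    intro hev
    have h1 : f =ᶠ[𝓝 z] fun _ => f z := by
      filter_upwards [hev] with w hw using not_not.1 hw
    have h2 := h1.deriv_eq
    rw [deriv_const] at h2
    rw [h2, norm_zero] at hMz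
    have : 0 < M / (2 * t) := by positivity
    linarith
  have hdc : DiffContOnCl ℂ f (ball z (t / 6)) :=
    (hf.mono ((closure_ball_subset_closedBall.trans hts).trans hsubR)).diffContOnCl
  have himg := hdc.ball_subset_image_closedBall (by linarith) hsphere hfreq
  exact h (f z) ((ball_subset_ball (by linarith)).trans
    (himg.trans (image_mono (hts.trans hsubR))))

theorem norm_deriv_le_of_re_pos {L : ℂ → ℂ} (hL : DifferentiableOn ℂ L {z | 0 < z.re})
    (h : ∀ w, ¬ ball w 7 ⊆ L '' {z | 0 < z.re}) {z : ℂ} (hz : 0 < z.re) :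
    ‖deriv L z‖ ≤ 336 / z.re := by
  have hsub : ball z z.re ⊆ {z : ℂ | 0 < z.re} := by
    intro w hw
    have h1 := Complex.abs_re_le_norm (w - z)
    rw [mem_ball, dist_eq_norm] at hw
    rw [Complex.sub_re] at h1
    have := (abs_le.1 (h1.trans hw.le)).1
    have h2 := (abs_lt.1 (h1.trans_lt hw)).1
    show 0 < w.re
    linarith
  rw [le_div_iff₀ hz]
  refine le_of_forall_lt_imp_le_of_dense fun a ha => ?_
  by_contra! h1
  have hn : 0 < ‖deriv L z‖ := by
    by_contra! h0
    have : ‖deriv L z‖ = 0 := le_antisymm h0 (norm_nonneg _)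
    rw [this] at ha; simp at ha
    linarith
  have := norm_deriv_mul_le_of_not_ball_subset (hL.mono hsub)
    (fun w hw => h w (hw.trans (image_mono hsub))) (r := max (z.re / 2) (a / ‖deriv L z‖))
    (lt_max_of_lt_left (by linarith))
    (max_lt (by linarith) (by rw [div_lt_iff₀ hn]; linarith))
  have h3 : a ≤ ‖deriv L z‖ * max (z.re / 2) (a / ‖deriv L z‖) := by
    calc a = ‖deriv L z‖ * (a / ‖deriv L z‖) := by field_simp
      _ ≤ _ := by gcongr; exact le_max_right _ _
  linarith

theorem norm_sub_horizontal_le {L : ℂ → ℂ} (hL : DifferentiableOn ℂ L {z | 0 < z.re}) {C : ℝ}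
    (h : ∀ z : ℂ, 0 < z.re → ‖deriv L z‖ ≤ C / z.re) {z : ℂ} (hz : 0 < z.re) {R : ℝ}
    (hR : z.re ≤ R) :
    ‖L ⟨R, z.im⟩ - L z‖ ≤ C * Real.log (R / z.re) := by
  have hR0 : 0 < R := hz.trans_le hR
  let p : ℝ → ℂ := fun t => (Real.exp t : ℂ) + z.im * Complex.I
  have hp : ∀ t, HasDerivAt p (Real.exp t : ℂ) t := fun t =>
    ((Real.hasDerivAt_exp t).ofReal_comp).add_const _
  have hpre : ∀ t, (p t).re = Real.exp t := fun t => by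
    simp only [p, Complex.add_re, Complex.ofReal_re, Complex.mul_re, Complex.I_re, Complex.I_im,
      Complex.ofReal_im]; ring
  have hpim : ∀ t, (p t).im = z.im := fun t => by
    simp only [p, Complex.add_im, Complex.ofReal_im, Complex.mul_im, Complex.I_re, Complex.I_im,
      Complex.ofReal_re]; ring
  have hop : IsOpen {z : ℂ | 0 < z.re} := isOpen_lt continuous_const Complex.continuous_re
  have hd : ∀ t, HasDerivAt (fun t => L (p t)) (deriv L (p t) * (Real.exp t : ℂ)) t := fun t =>
    (hL.differentiableAt (hop.mem_nhds (show 0 < (p t).re by rw [hpre]; positivity))).hasDerivAt.comp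
      t (hp t)
  have key := (convex_univ (𝕜 := ℝ) (E := ℝ)).norm_image_sub_le_of_norm_hasDerivWithin_le (C := C)
    (fun t _ => (hd t).hasDerivWithinAt) (fun t _ => by
      have := h (p t) (by rw [hpre]; positivity)
      rw [hpre] at this
      rw [norm_mul, Complex.norm_real, Real.norm_of_nonneg (Real.exp_pos t).le]
      rwa [le_div_iff₀ (Real.exp_pos t)] at this)
    (mem_univ (Real.log z.re)) (mem_univ (Real.log R))
  have e1 : p (Real.log R) = ⟨R, z.im⟩ := Complex.ext (by rw [hpre, Real.exp_log hR0]) (hpim _)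
  have e2 : p (Real.log z.re) = z := Complex.ext (by rw [hpre, Real.exp_log hz]) (hpim _)
  rw [e1, e2] at key
  refine key.trans (le_of_eq ?_)
  rw [Real.norm_of_nonneg (sub_nonneg.2 (Real.log_le_log hz hR)), Real.log_div hR0.ne' hz.ne']

/-- Growth of a function with hyperbolically bounded derivative on the right half-plane. -/
theorem norm_sub_le_log_of_re_pos {L : ℂ → ℂ} (hL : DifferentiableOn ℂ L {z | 0 < z.re})
    (h : ∀ w, ¬ ball w 7 ⊆ L '' {z | 0 < z.re}) {x R : ℝ} (hx : 0 < x)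
    {z w : ℂ} (hz : x ≤ z.re) (hw : x ≤ w.re) (hzR : ‖z‖ ≤ R) (hwR : ‖w‖ ≤ R) :
    ‖L z - L w‖ ≤ 672 * (Real.log (R / x) + 1) := by
  have hder : ∀ z : ℂ, 0 < z.re → ‖deriv L z‖ ≤ 336 / z.re := fun z hz =>
    norm_deriv_le_of_re_pos hL h hz
  have hre : ∀ v : ℂ, ‖v‖ ≤ R → v.re ≤ R := fun v hv => (Complex.re_le_norm v).trans hv
  have hR : 0 < R := by linarith [hre z hzR]
  have hhor : ∀ v : ℂ, x ≤ v.re → ‖v‖ ≤ R →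
      ‖L ⟨R, v.im⟩ - L v‖ ≤ 336 * Real.log (R / x) := by
    intro v hv hvR
    refine (norm_sub_horizontal_le hL hder (hx.trans_le hv) (hre v hvR)).trans ?_
    gcongr
    exact div_pos hR (hx.trans_le hv)
  have hop : IsOpen {z : ℂ | 0 < z.re} := isOpen_lt continuous_const Complex.continuous_re
  have hver : ‖L ⟨R, z.im⟩ - L ⟨R, w.im⟩‖ ≤ 672 := by
    have key := ((convex_halfSpace_re_ge R)).norm_image_sub_le_of_norm_hasDerivWithin_le
      (f := L) (f' := deriv L) (C := 336 / R) (fun v hv =>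
        (hL.differentiableAt (hop.mem_nhds (show 0 < v.re from hR.trans_le hv))).hasDerivAt.hasDerivWithinAt)
      (fun v hv => (hder v (hR.trans_le hv)).trans (by gcongr; exact hv))
      (x := ⟨R, w.im⟩) (y := ⟨R, z.im⟩) (show R ≤ R from le_rfl) (show R ≤ R from le_rfl)
    refine key.trans ?_
    have e : (⟨R, z.im⟩ : ℂ) - ⟨R, w.im⟩ = ((z.im - w.im : ℝ) : ℂ) * Complex.I := by
      apply Complex.ext <;> simp
    rw [e, norm_mul, Complex.norm_I, mul_one, Complex.norm_real, Real.norm_eq_abs]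
    have h1 := (Complex.abs_im_le_norm z).trans hzR
    have h2 := (Complex.abs_im_le_norm w).trans hwR
    have h3 : |z.im - w.im| ≤ 2 * R := (abs_sub _ _).trans (by linarith)
    calc 336 / R * |z.im - w.im| ≤ 336 / R * (2 * R) := by gcongr
      _ = 672 := by field_simp; norm_num
  have h1 := hhor z hz hzR
  have h2 := hhor w hw hwR
  have e : L z - L w = -(L ⟨R, z.im⟩ - L z) + (L ⟨R, z.im⟩ - L ⟨R, w.im⟩) + (L ⟨R, w.im⟩ - L w) := by
    ring
  rw [e]
  refine (norm_add₃_le).trans ?_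
  rw [norm_neg]
  linarith

open MeasureTheory in
/-- Twice the Wirtinger derivative of `F` with respect to the conjugate variable. -/
noncomputable def dbar (F : ℂ → ℂ) (z : ℂ) : ℂ :=
  fderiv ℝ F z 1 + Complex.I * fderiv ℝ F z Complex.I

theorem continuous_dbar {F : ℂ → ℂ} (hF : ContDiff ℝ 1 F) : Continuous (dbar F) := by
  have := hF.continuous_fderiv one_ne_zero
  unfold dbar
  fun_prop

theorem dbar_eq_zero_of_differentiableAt {F : ℂ → ℂ} {z : ℂ} (h : DifferentiableAt ℂ F z) :
    dbar F z = 0 := by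
  have h1 : fderiv ℝ F z = (fderiv ℂ F z).restrictScalars ℝ := h.fderiv_restrictScalars ℝ
  have h2 : fderiv ℂ F z Complex.I = Complex.I * fderiv ℂ F z 1 := by
    rw [← smul_eq_mul, ← map_smul]; simp
  unfold dbar
  rw [h1]
  simp only [ContinuousLinearMap.coe_restrictScalars']
  rw [h2, ← mul_assoc, Complex.I_mul_I]
  ring

theorem dbar_mul {F G : ℂ → ℂ} {z : ℂ} (hF : DifferentiableAt ℝ F z)
    (hG : DifferentiableAt ℝ G z) : dbar (fun z => F z * G z) z = F z * dbar G z + dbar F z * G z := by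
  unfold dbar
  rw [fderiv_fun_mul hF hG]
  simp
  ring

open MeasureTheory in
theorem integral_dbar_div_self {F : ℂ → ℂ} (hF : ContDiff ℝ 1 F) (hc : HasCompactSupport F) :
    ∫ z, dbar F z / z = -(2 * Real.pi * F 0) := by
  have hcd : Continuous (fderiv ℝ F) := hF.continuous_fderiv one_ne_zero
  let e : ℝ → ℂ := fun θ => Complex.exp (θ * Complex.I)
  have he : ∀ θ, HasDerivAt e (e θ * Complex.I) θ := by
    intro θ
    have := ((hasDerivAt_id θ).ofReal_comp.mul_const Complex.I).cexp
    simpa using this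
  have hec : Continuous e := by fun_prop
  have hen : ∀ θ, ‖e θ‖ = 1 := fun θ => Complex.norm_exp_ofReal_mul_I θ
  let A : ℝ × ℝ → ℂ := fun p => fderiv ℝ F (p.1 * e p.2) (e p.2)
  let B : ℝ × ℝ → ℂ := fun p => fderiv ℝ F (p.1 * e p.2) (e p.2 * Complex.I)
  have hA : Continuous A := by fun_prop
  have hB : Continuous B := by fun_prop
  obtain ⟨R, hR0, hR⟩ : ∃ R : ℝ, 0 < R ∧ ∀ z, R ≤ ‖z‖ → F =ᶠ[𝓝 z] 0 := by
    obtain ⟨R, hR⟩ := hc.isCompact.isBounded.subset_closedBall 0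
    refine ⟨max R 0 + 1, by positivity, fun z hz => ?_⟩
    rw [← notMem_tsupport_iff_eventuallyEq]
    intro h
    have := mem_closedBall_zero_iff.1 (hR h)
    have := le_max_left R 0
    linarith
  have hR' : ∀ z, R ≤ ‖z‖ → fderiv ℝ F z = 0 := fun z hz => by
    rw [(hR z hz).fderiv_eq]; simp
  have hnorm : ∀ r θ : ℝ, 0 < r → ‖(r : ℂ) * e θ‖ = r := fun r θ hr => by
    rw [norm_mul, hen, mul_one, Complex.norm_real, Real.norm_of_nonneg hr.le]
  have hint : ∀ f : ℝ × ℝ → ℂ, Continuous f → (∀ r θ, R ≤ r → f (r, θ) = 0) →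
      IntegrableOn f (Ioi 0 ×ˢ Ioo (-Real.pi) Real.pi) := by
    intro f hf h0
    have h1 : IntegrableOn f (Icc 0 R ×ˢ Icc (-Real.pi) Real.pi) :=
      hf.continuousOn.integrableOn_compact (isCompact_Icc.prod isCompact_Icc)
    refine h1.of_forall_sdiff_eq_zero (measurableSet_Ioi.prod measurableSet_Ioo) ?_
    rintro ⟨r, θ⟩ ⟨⟨h2, h3⟩, h4⟩
    refine h0 r θ ?_
    by_contra! h5
    exact h4 ⟨⟨le_of_lt h2, h5.le⟩, Ioo_subset_Icc_self h3⟩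
  have hA0 : ∀ r θ, R ≤ r → A (r, θ) = 0 := fun r θ hr => by
    simp only [A]
    rw [hR' _ (by rw [hnorm r θ (hR0.trans_le hr)]; exact hr)]; simp
  have hB0 : ∀ r θ, R ≤ r → B (r, θ) = 0 := fun r θ hr => by
    simp only [B]
    rw [hR' _ (by rw [hnorm r θ (hR0.trans_le hr)]; exact hr)]; simp
  have hAi := hint A hA hA0
  have hBi := hint B hB hB0
  have hBint : ∫ p in Ioi 0 ×ˢ Ioo (-Real.pi) Real.pi, B p = 0 := by
    rw [Measure.volume_eq_prod, setIntegral_prod _ (by rwa [← Measure.volume_eq_prod])]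
    refine setIntegral_eq_zero_of_forall_eq_zero fun r hr => ?_
    have hr' : (0 : ℝ) < r := hr
    rw [← integral_Ioc_eq_integral_Ioo,
      ← intervalIntegral.integral_of_le (by linarith [Real.pi_pos])]
    have hd : ∀ θ ∈ uIcc (-Real.pi) Real.pi, HasDerivAt (fun θ => F (r * e θ) / r) (B (r, θ)) θ := by
      intro θ _
      have h1 : HasDerivAt (fun θ => (r : ℂ) * e θ) (r * (e θ * Complex.I)) θ := (he θ).const_mul _
      have h2 := ((hF.differentiable one_ne_zero ((r : ℂ) * e θ)).hasFDerivAt.comp_hasDerivAt θ h1).div_const (r : ℂ)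
      have h3 : (r : ℂ) * (e θ * Complex.I) = r • (e θ * Complex.I) := by simp
      have : (r : ℂ) ≠ 0 := by exact_mod_cast hr'.ne'
      have h4 : fderiv ℝ F (r * e θ) (r * (e θ * Complex.I)) / r = B (r, θ) := by
        rw [h3, map_smul]
        simp only [B, Complex.real_smul]
        field_simp
      exact h4 ▸ h2
    rw [intervalIntegral.integral_eq_sub_of_hasDerivAt hd
      ((hB.comp (by fun_prop : Continuous fun θ : ℝ => (r, θ))).intervalIntegrable _ _)]
    have : e Real.pi = e (-Real.pi) := by
      simp only [e]; push_cast; rw [neg_mul, Complex.exp_neg, Complex.exp_pi_mul_I]; norm_num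
    rw [this, sub_self]
  have hAint : ∫ p in Ioi 0 ×ˢ Ioo (-Real.pi) Real.pi, A p = -(2 * Real.pi * F 0) := by
    rw [Measure.volume_eq_prod, ← setIntegral_prod_swap, setIntegral_prod _ (by
      rw [Measure.volume_eq_prod] at hAi
      exact hAi.swap)]
    have h1 : ∀ θ : ℝ, ∫ r in Ioi (0:ℝ), A (r, θ) = -F 0 := by
      intro θ
      have hd : ∀ r ∈ Ici (0:ℝ), HasDerivAt (fun r : ℝ => F (r * e θ)) (A (r, θ)) r := by
        intro r _
        have h1 : HasDerivAt (fun r : ℝ => (r : ℂ) * e θ) (e θ) r := by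
          simpa using (hasDerivAt_id r).ofReal_comp.mul_const (e θ)
        exact (hF.differentiable one_ne_zero ((r : ℂ) * e θ)).hasFDerivAt.comp_hasDerivAt r h1
      have hi : IntegrableOn (fun r => A (r, θ)) (Ioi 0) := by
        have h2 : IntegrableOn (fun r => A (r, θ)) (Icc 0 R) :=
          (hA.comp (by fun_prop : Continuous fun r : ℝ => (r, θ))).continuousOn.integrableOn_compact
            isCompact_Icc
        refine h2.of_forall_sdiff_eq_zero measurableSet_Ioi fun r hr => hA0 r θ ?_
        by_contra! h5
        exact hr.2 ⟨le_of_lt hr.1, h5.le⟩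
      have ht : Tendsto (fun r : ℝ => F (r * e θ)) atTop (𝓝 0) := by
        refine tendsto_const_nhds.congr' ?_
        filter_upwards [eventually_ge_atTop R] with r hr
        exact ((hR _ (by rw [hnorm r θ (hR0.trans_le hr)]; exact hr)).eq_of_nhds).symm
      rw [integral_Ioi_of_hasDerivAt_of_tendsto' hd hi ht]
      simp
    simp only [Prod.swap]
    rw [setIntegral_congr_fun measurableSet_Ioo (fun θ _ => h1 θ)]
    simp [Measure.real, Real.volume_Ioo]
    left
    rw [ENNReal.toReal_ofReal (by linarith [Real.pi_pos])]
    push_cast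
    ring
  rw [← Complex.integral_comp_polarCoord_symm]
  have htar : polarCoord.target = Ioi (0:ℝ) ×ˢ Ioo (-Real.pi) Real.pi := rfl
  rw [htar]
  have hcongr : ∀ p ∈ Ioi (0:ℝ) ×ˢ Ioo (-Real.pi) Real.pi,
      p.1 • (dbar F (Complex.polarCoord.symm p) / Complex.polarCoord.symm p) =
        A p + Complex.I * B p := by
    rintro ⟨r, θ⟩ ⟨hr, -⟩
    have hr' : (r : ℂ) ≠ 0 := by exact_mod_cast (ne_of_gt hr)
    have h1 : Complex.polarCoord.symm (r, θ) = r * e θ := by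
      rw [Complex.polarCoord_symm_apply]
      simp only [e]
      rw [Complex.exp_mul_I]; push_cast; rfl
    have hcs : e θ = Complex.cos θ + Complex.sin θ * Complex.I := Complex.exp_mul_I _
    have h2 : e θ = Real.cos θ • (1 : ℂ) + Real.sin θ • Complex.I := by
      rw [hcs]; simp
    have h3 : e θ * Complex.I = (-Real.sin θ) • (1 : ℂ) + Real.cos θ • Complex.I := by
      rw [hcs]; simp [add_mul, mul_assoc]; ring
    have he0 : e θ ≠ 0 := Complex.exp_ne_zero _
    have hei : (e θ)⁻¹ = Complex.cos θ - Complex.sin θ * Complex.I := by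
      simp only [e]
      rw [← Complex.exp_neg, ← neg_mul, Complex.exp_mul_I]; simp [sub_eq_add_neg]
    rw [h1]
    simp only [A, B, dbar]
    generalize fderiv ℝ F (r * e θ) = D
    conv_rhs => rw [h3, h2]
    simp only [map_add, map_smul]
    simp only [Complex.real_smul]
    rw [div_eq_mul_inv, mul_inv, hei]
    have : (r:ℂ) * ((D 1 + Complex.I * D Complex.I) * ((r:ℂ)⁻¹ * (Complex.cos θ - Complex.sin θ * Complex.I)))
      = (D 1 + Complex.I * D Complex.I) * (Complex.cos θ - Complex.sin θ * Complex.I) := by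
      field_simp
    rw [this]
    push_cast
    linear_combination (-Complex.sin θ * D Complex.I) * Complex.I_mul_I
  rw [setIntegral_congr_fun (measurableSet_Ioi.prod measurableSet_Ioo) hcongr,
    integral_add hAi (hBi.const_mul _), integral_const_mul, hBint, hAint]
  simp

open MeasureTheory in
/-- The Cauchy-Pompeiu formula for compactly supported functions. -/
theorem integral_dbar_div_sub {F : ℂ → ℂ} (hF : ContDiff ℝ 1 F) (hc : HasCompactSupport F) (w : ℂ) :
    ∫ z, dbar F z / (z - w) = -(2 * Real.pi * F w) := by
  have h := integral_dbar_div_self (F := fun z => F (z + w)) (hF.comp (by fun_prop))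
    (hc.comp_homeomorph (Homeomorph.addRight w))
  simp only [zero_add] at h
  rw [← h, ← integral_add_right_eq_self _ w]
  congr 1
  ext z
  rw [add_sub_cancel_right]
  simp only [dbar, fderiv_comp_add_right]

open BoundedContinuousFunction

/-- The function `z ↦ 1 / (z - a)` as a bounded continuous function on a closed set `Y ∌ a`. -/
noncomputable def poleFn {Y : Set ℂ} (hY : IsClosed Y) {a : ℂ} (ha : a ∉ Y) : Y →ᵇ ℂ :=
  BoundedContinuousFunction.ofNormedAddCommGroup (fun z : Y => ((z : ℂ) - a)⁻¹)
    (by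
      refine Continuous.inv₀ (by fun_prop) fun z hz => ha ?_
      rw [← sub_eq_zero.1 hz]; exact z.2)
    (infDist a Y)⁻¹ (fun z => by
      rw [norm_inv]
      have h1 : 0 < infDist a Y := (hY.notMem_iff_infDist_pos ⟨z, z.2⟩).1 ha
      have h2 : infDist a Y ≤ ‖(z : ℂ) - a‖ := by
        rw [← dist_eq_norm, dist_comm]; exact infDist_le_dist_of_mem z.2
      gcongr)

@[simp] theorem poleFn_apply {Y : Set ℂ} (hY : IsClosed Y) {a : ℂ} (ha : a ∉ Y) (z : Y) :
    poleFn hY ha z = ((z : ℂ) - a)⁻¹ := rfl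

theorem norm_poleFn_le {Y : Set ℂ} (hY : IsClosed Y) {a : ℂ} (ha : a ∉ Y) {δ : ℝ} (hδ : 0 < δ)
    (h : ∀ z ∈ Y, δ ≤ dist z a) : ‖poleFn hY ha‖ ≤ δ⁻¹ := by
  refine (BoundedContinuousFunction.norm_le (by positivity)).2 fun z => ?_
  rw [poleFn_apply, norm_inv, ← dist_eq_norm]
  have := h z z.2
  gcongr

theorem poleFn_mem_of_dist_lt {Y : Set ℂ} (hY : IsClosed Y) {a b : ℂ} (ha : a ∉ Y) (hb : b ∉ Y)
    {δ : ℝ} (hδ : 0 < δ) (h : ∀ z ∈ Y, δ ≤ dist z b) (hab : dist a b < δ) :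
    poleFn hY ha ∈ (Algebra.adjoin ℂ {poleFn hY hb}).topologicalClosure := by
  set A := (Algebra.adjoin ℂ {poleFn hY hb}).topologicalClosure with hA
  have hbA : poleFn hY hb ∈ A :=
    Subalgebra.le_topologicalClosure _ (Algebra.self_mem_adjoin_singleton ℂ _)
  set x := (a - b) • poleFn hY hb with hx
  have hx1 : ‖x‖ < 1 := by
    rw [hx, norm_smul, ← dist_eq_norm]
    calc dist a b * ‖poleFn hY hb‖ ≤ dist a b * δ⁻¹ := by gcongr; exact norm_poleFn_le hY hb hδ h
      _ < δ * δ⁻¹ := by gcongr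
      _ = 1 := mul_inv_cancel₀ hδ.ne'
  have hxA : x ∈ A := A.smul_mem hbA _
  have hsA : ∑' n, x ^ n ∈ A := by
    have hs := (summable_geometric_of_norm_lt_one hx1).hasSum
    exact (Subalgebra.isClosed_topologicalClosure _).mem_of_tendsto hs
      (Eventually.of_forall fun s => A.sum_mem fun i _ => A.pow_mem hxA i)
  have key : poleFn hY ha = poleFn hY hb * ∑' n, x ^ n := by
    have h1 : poleFn hY ha * (1 - x) = poleFn hY hb := by
      ext z
      have h2 : (z : ℂ) - a ≠ 0 := fun h => ha (by rw [← sub_eq_zero.1 h]; exact z.2)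
      have h3 : (z : ℂ) - b ≠ 0 := fun h => hb (by rw [← sub_eq_zero.1 h]; exact z.2)
      simp [hx]
      field_simp
      ring
    rw [← h1, mul_assoc, mul_neg_geom_series x hx1, mul_one]
  rw [key]
  exact A.mul_mem hbA hsA

theorem poleFn_mem_of_isPreconnected {Y C : Set ℂ} (hY : IsClosed Y) (hC : IsPreconnected C)
    (hd : Disjoint C Y) {a b : ℂ} (ha : a ∈ C) (hb : b ∈ C) :
    poleFn hY (disjoint_left.1 hd ha) ∈
      (Algebra.adjoin ℂ {poleFn hY (disjoint_left.1 hd hb)}).topologicalClosure := by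
  let P : ℂ → ℂ → Prop := fun a b => ∀ (ha : a ∉ Y) (hb : b ∉ Y), poleFn hY ha ∈
      (Algebra.adjoin ℂ {poleFn hY hb}).topologicalClosure
  have hmem : ∀ a ∈ C, a ∉ Y := fun a ha => disjoint_left.1 hd ha
  have htrans : ∀ x y z : ℂ, x ∈ C → y ∈ C → z ∈ C → P x y → P y z → P x z := by
    intro x y z hx hy hz hxy hyz h1 h2
    have h3 := hxy h1 (hmem y hy)
    have h4 := hyz (hmem y hy) h2
    exact (Subalgebra.topologicalClosure_minimal (Algebra.adjoin_le (by
      rintro _ rfl; exact h4))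
      (Subalgebra.isClosed_topologicalClosure _)) h3
  have key := hC.induction₂' P (fun x hx => ?_) htrans ha hb
  · exact key _ _
  · have h1 : ∃ δ : ℝ, 0 < δ ∧ ∀ z ∈ Y, 2 * δ ≤ dist z x := by
      obtain ⟨δ, hδ, h⟩ := Metric.isOpen_iff.1 hY.isOpen_compl x (hmem x hx)
      refine ⟨δ / 2, by positivity, fun z hz => ?_⟩
      by_contra! h2
      exact h (mem_ball.2 (by linarith)) hz
    obtain ⟨δ, hδ, h⟩ := h1
    filter_upwards [mem_nhdsWithin_of_mem_nhds (ball_mem_nhds x hδ)] with y hy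
    rw [mem_ball] at hy
    constructor <;> intro h1 h2
    · refine poleFn_mem_of_dist_lt hY h1 h2 hδ (fun z hz => ?_) (by rwa [dist_comm])
      have := h z hz
      have h3 := dist_triangle z y x
      linarith
    · exact poleFn_mem_of_dist_lt hY h1 h2 hδ (fun z hz => by linarith [h z hz]) hy

theorem exists_polynomial_of_isPreconnected {Y C : Set ℂ} (hY : IsClosed Y) (hC : IsPreconnected C)
    (hd : Disjoint C Y) {a b : ℂ} (ha : a ∈ C) (hb : b ∈ C) (p : Polynomial ℂ) {ε : ℝ}
    (hε : 0 < ε) :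
    ∃ q : Polynomial ℂ, ∀ z ∈ Y, ‖q.eval ((z - b)⁻¹) - p.eval ((z - a)⁻¹)‖ < ε := by
  have hb' := disjoint_left.1 hd hb
  have h1 : Polynomial.aeval (poleFn hY (disjoint_left.1 hd ha)) p ∈
      (Algebra.adjoin ℂ {poleFn hY hb'}).topologicalClosure :=
    Algebra.adjoin_le (S := Subalgebra.topologicalClosure _) (by
      rintro _ rfl; exact poleFn_mem_of_isPreconnected hY hC hd ha hb)
      (Polynomial.aeval_mem_adjoin_singleton ℂ _)
  have hev : ∀ {c : ℂ} (hc : c ∉ Y) (p : Polynomial ℂ) (z : Y),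
      Polynomial.aeval (poleFn hY hc) p z = p.eval (((z : ℂ) - c)⁻¹) := by
    intro c hc p z
    induction p using Polynomial.induction_on' with
    | add p q hp hq => simp [hp, hq]
    | monomial n c => simp [Polynomial.aeval_monomial]
  obtain ⟨g, hg, hgε⟩ := Metric.mem_closure_iff.1 h1 ε hε
  rw [SetLike.mem_coe, Algebra.adjoin_singleton_eq_range_aeval] at hg
  obtain ⟨q, rfl⟩ := hg
  refine ⟨q, fun z hz => ?_⟩
  have h2 := BoundedContinuousFunction.dist_coe_le_dist (f := Polynomial.aeval (poleFn hY hb') q)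
    (g := Polynomial.aeval (poleFn hY (disjoint_left.1 hd ha)) p) (⟨z, hz⟩ : Y)
  have h3 := hev hb' q ⟨z, hz⟩
  have h4 := hev (disjoint_left.1 hd ha) p ⟨z, hz⟩
  simp only at h3 h4
  rw [← h3, ← h4, ← dist_eq_norm]
  exact h2.trans_lt (by rw [dist_comm]; exact hgε)

/-- The point `a` can be moved, off the closure of `Y`, away from all the sets `X k`. -/
def Escapes (X : ℕ → Set ℂ) (Y : Set ℂ) (a : ℂ) : Prop :=
  ∃ (b : ℕ → ℂ) (C : ℕ → Set ℂ), b 0 = a ∧ (∀ i, IsPreconnected (C i) ∧ b i ∈ C i ∧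
    b (i + 1) ∈ C i ∧ Disjoint (C i) (closure Y)) ∧ ∀ k, ∀ᶠ i in atTop, Disjoint (C i) (X k)

theorem exists_differentiableOn_approx_inv_sub {W : Set ℂ} {X : ℕ → Set ℂ}
    (hXc : ∀ n, IsCompact (X n))
    (hXW : ∀ z ∈ W, ∃ n, z ∈ interior (X n)) {Y : Set ℂ} {a : ℂ} (ha : Escapes X Y a) {ε : ℝ}
    (hε : 0 < ε) :
    ∃ c : ℂ → ℂ, DifferentiableOn ℂ c W ∧ ContinuousOn c (closure Y) ∧
      ∀ z ∈ closure Y, ‖c z - (z - a)⁻¹‖ ≤ ε := by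
  classical
  obtain ⟨b, C, hb0, hC, hCX⟩ := ha
  let S : ℕ → Set ℂ := fun i => closure Y ∪ ⋃ k ∈ {k | k ∈ Finset.range (i + 1) ∧ Disjoint (C i) (X k)}, X k
  have hSc : ∀ i, IsClosed (S i) := fun i => by
    refine isClosed_closure.union (Set.Finite.isClosed_biUnion ?_ fun k _ => (hXc k).isClosed)
    exact (Finset.finite_toSet (Finset.range (i+1))).subset fun k hk => hk.1
  have hSd : ∀ i, Disjoint (C i) (S i) := fun i => by
    refine (hC i).2.2.2.union_right ?_
    simp only [disjoint_iUnion_right]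
    exact fun k hk => hk.2
  have step : ∀ i (p : Polynomial ℂ), ∃ q : Polynomial ℂ, ∀ z ∈ S i,
      ‖q.eval ((z - b (i + 1))⁻¹) - p.eval ((z - b i)⁻¹)‖ < ε / 2 / 2 ^ i := fun i p =>
    exists_polynomial_of_isPreconnected (hSc i) (hC i).1 (hSd i) (hC i).2.1 (hC i).2.2.1 p
      (by positivity)
  choose q hq using step
  let p : ℕ → Polynomial ℂ := fun i => Nat.rec Polynomial.X (fun i p => q i p) i
  have hp : ∀ i, p (i + 1) = q i (p i) := fun i => rfl
  let r : ℕ → ℂ → ℂ := fun i z => (p i).eval ((z - b i)⁻¹)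
  have hr : ∀ i, ∀ z ∈ S i, dist (r i z) (r (i + 1) z) ≤ ε / 2 / 2 ^ i := fun i z hz => by
    rw [dist_comm, dist_eq_norm]
    simp only [r, hp]
    exact (hq i (p i) z hz).le
  have hev : ∀ k, ∃ N, ∀ i, N ≤ i → X k ⊆ S i ∧ Disjoint (C i) (X k) := by
    intro k
    obtain ⟨N, hN⟩ := eventually_atTop.1 (hCX k)
    refine ⟨max N k, fun i hi => ⟨?_, hN i (le_trans (le_max_left _ _) hi)⟩⟩
    refine subset_union_of_subset_right (subset_biUnion_of_mem (u := X) ?_) _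
    exact ⟨Finset.mem_range.2 (by have := le_max_right N k; omega), hN i (le_trans (le_max_left _ _) hi)⟩
  let c : ℂ → ℂ := fun z => limUnder atTop fun i => r i z
  have hlim : ∀ N, ∀ z, (∀ i, N ≤ i → z ∈ S i) → Tendsto (fun i => r i z) atTop (𝓝 (c z)) ∧
      ∀ i, dist (r (i + N) z) (c z) ≤ ε / 2 ^ N / 2 ^ i := by
    intro N z hz
    have h1 : ∀ i, dist (r (i + N) z) (r (i + 1 + N) z) ≤ ε / 2 ^ N / 2 / 2 ^ i := fun i => by
      rw [show i + 1 + N = (i + N) + 1 by ring]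
      refine (hr (i + N) z (hz _ (by omega))).trans (le_of_eq ?_)
      rw [pow_add]; field_simp
    have h2 : CauchySeq (fun i => r (i + N) z) := cauchySeq_of_le_geometric_two h1
    have h3 : Tendsto (fun i => r i z) atTop (𝓝 (c z)) := by
      obtain ⟨l, hl⟩ := cauchySeq_tendsto_of_complete h2
      have h4 := (tendsto_add_atTop_iff_nat (f := fun i => r i z) N).1 hl
      rw [show c z = l from h4.limUnder_eq]
      exact h4
    exact ⟨h3, dist_le_of_le_geometric_two_of_tendsto h1 ((tendsto_add_atTop_iff_nat N).2 h3)⟩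
  have hunif : ∀ N (A : Set ℂ), (∀ i, N ≤ i → A ⊆ S i) →
      TendstoUniformlyOn (fun i => r (i + N)) c atTop A := by
    intro N A hA
    rw [Metric.tendstoUniformlyOn_iff]
    intro η hη
    have h1 : Tendsto (fun i : ℕ => ε / 2 ^ N / 2 ^ i) atTop (𝓝 0) :=
      tendsto_const_nhds.div_atTop (tendsto_pow_atTop_atTop_of_one_lt one_lt_two)
    filter_upwards [h1.eventually_lt_const hη] with i hi w hw
    rw [dist_comm]
    exact ((hlim N w fun i hi => hA i hi hw).2 i).trans_lt hi
  refine ⟨c, fun z hz => ?_, ?_, fun z hz => ?_⟩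
  · obtain ⟨k, hk⟩ := hXW z hz
    obtain ⟨N, hN⟩ := hev k
    have hu := hunif N (interior (X k)) fun i hi => interior_subset.trans (hN i hi).1
    have hd := hu.tendstoLocallyUniformlyOn.differentiableOn (Eventually.of_forall fun i w hw => by
      have h1 : w - b (i + N) ≠ 0 := fun h => by
        have h2 := sub_eq_zero.1 h
        exact disjoint_left.1 (hN (i + N) (by omega)).2 (hC (i + N)).2.1
          (h2 ▸ interior_subset hw)
      exact ((p (i + N)).differentiableAt.comp w
        ((differentiableAt_id.sub_const _).inv h1)).differentiableWithinAt) isOpen_interior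
    exact (hd.differentiableAt (isOpen_interior.mem_nhds hk)).differentiableWithinAt
  · refine (hunif 0 (closure Y) fun i _ => subset_union_left).continuousOn
      (Frequently.of_forall fun i => ?_)
    refine (p (i + 0)).continuous.comp_continuousOn
      (ContinuousOn.inv₀ (by fun_prop) fun w hw h => ?_)
    exact disjoint_left.1 (hC (i + 0)).2.2.2 (hC (i + 0)).2.1 (sub_eq_zero.1 h ▸ hw)
  · have h1 := (hlim 0 z fun i _ => Or.inl hz).2 0
    rw [dist_comm, dist_eq_norm] at h1
    simpa [r, p, hb0] using h1

open BoundedContinuousFunction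

theorem Submodule.integral_mem_of_isClosed {α B : Type*} [MeasurableSpace α]
    {μ : MeasureTheory.Measure α} [NormedAddCommGroup B] [NormedSpace ℂ B] [CompleteSpace B]
    (M : Submodule ℂ B) (hM : IsClosed (M : Set B)) {F : α → B} (hF : MeasureTheory.Integrable F μ)
    (h : ∀ a, F a ∈ M) : ∫ a, F a ∂μ ∈ M := by
  have := hM
  have h1 := M.mkQL.integral_comp_comm hF
  have h2 : ∀ a, M.mkQL (F a) = 0 := fun a => (Submodule.Quotient.mk_eq_zero M).2 (h a)
  simp only [h2, MeasureTheory.integral_zero] at h1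
  exact (Submodule.Quotient.mk_eq_zero M).1 h1.symm

open Classical in
theorem exists_differentiableOn_approx_cauchy {W Y : Set ℂ} {X : ℕ → Set ℂ}
    (hXc : ∀ n, IsCompact (X n)) (hXW : ∀ z ∈ W, ∃ n, z ∈ interior (X n))
    {ω : ℂ → ℂ} (hω : Continuous ω) (hωc : HasCompactSupport ω)
    (hd : Disjoint (tsupport ω) (closure Y)) (hesc : ∀ a, ω a ≠ 0 → Escapes X Y a) {ε : ℝ}
    (hε : 0 < ε) :
    ∃ c : ℂ → ℂ, DifferentiableOn ℂ c W ∧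
      ∀ z ∈ closure Y, ‖c z - ∫ a, ω a / (a - z)‖ ≤ ε := by
  have hY : IsClosed (closure Y) := isClosed_closure
  let P : ℂ → (closure Y →ᵇ ℂ) := fun a => if h : a ∉ closure Y then poleFn hY h else 0
  have hP : ∀ a (h : a ∉ closure Y), P a = poleFn hY h := fun a h => dif_pos h
  have hPc : ContinuousOn P (closure Y)ᶜ := by
    intro b hb
    obtain ⟨δ, hδ, hball⟩ := Metric.isOpen_iff.1 hY.isOpen_compl b hb
    have hdist : ∀ a ∈ ball b (δ / 2), ∀ z ∈ closure Y, δ / 2 ≤ dist z a := by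
      intro a ha z hz
      by_contra! h2
      rw [mem_ball] at ha
      have := dist_triangle z a b
      exact hball (mem_ball.2 (by linarith)) hz
    have hlip : ∀ a ∈ ball b (δ / 2), dist (P a) (P b) ≤ dist a b * ((δ / 2)⁻¹ * (δ / 2)⁻¹) := by
      intro a ha
      have ha' : a ∉ closure Y := fun h => by
        have := hdist a ha a h
        rw [dist_self] at this; linarith
      rw [hP a ha', hP b hb]
      have e : poleFn hY ha' - poleFn hY hb = (a - b) • (poleFn hY ha' * poleFn hY hb) := by
        ext z
        have h2 : (z : ℂ) - a ≠ 0 := fun h => ha' (by rw [← sub_eq_zero.1 h]; exact z.2)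
        have h3 : (z : ℂ) - b ≠ 0 := fun h => hb (by rw [← sub_eq_zero.1 h]; exact z.2)
        simp
        field_simp
        ring
      rw [dist_eq_norm, e, norm_smul, ← dist_eq_norm]
      have h1 := norm_poleFn_le hY ha' (by positivity : 0 < δ / 2) (hdist a ha)
      have h2 := norm_poleFn_le hY hb (by positivity : 0 < δ / 2)
        (hdist b (mem_ball_self (by positivity)))
      refine mul_le_mul_of_nonneg_left ((norm_mul_le _ _).trans ?_) dist_nonneg
      gcongr
    have ht : Tendsto (fun a => dist a b * ((δ / 2)⁻¹ * (δ / 2)⁻¹)) (𝓝 b) (𝓝 0) := by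
      have : Continuous fun a => dist a b * ((δ / 2)⁻¹ * (δ / 2)⁻¹) := by fun_prop
      simpa using this.tendsto b
    refine ContinuousAt.continuousWithinAt (tendsto_iff_dist_tendsto_zero.2 ?_)
    refine squeeze_zero' (Eventually.of_forall fun _ => dist_nonneg) ?_ ht
    filter_upwards [ball_mem_nhds b (by positivity : 0 < δ / 2)] with a ha using hlip a ha
  let F : ℂ → (closure Y →ᵇ ℂ) := fun a => (-ω a) • P a
  have hFc : Continuous F := by
    rw [continuous_iff_continuousAt]
    intro a
    by_cases ha : a ∈ closure Y
    · have h1 : F =ᶠ[𝓝 a] fun _ => 0 := by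
        have h2 : ω =ᶠ[𝓝 a] 0 := notMem_tsupport_iff_eventuallyEq.1 (disjoint_right.1 hd ha)
        filter_upwards [h2] with z hz
        simp [F, hz]
      exact continuousAt_const.congr h1.symm
    · exact (hω.neg.continuousAt).smul (hPc.continuousAt (hY.isOpen_compl.mem_nhds ha))
  have hFs : HasCompactSupport F := hωc.mono' (fun a ha => subset_tsupport _ fun h => ha (by simp [F, h]))
  have hFi : MeasureTheory.Integrable F := hFc.integrable_of_hasCompactSupport hFs
  let M0 : Submodule ℂ (closure Y →ᵇ ℂ) :=
    { carrier := {f | ∃ c : ℂ → ℂ, DifferentiableOn ℂ c W ∧ ∀ z : closure Y, f z = c z}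
      add_mem' := by
        rintro f g ⟨c, hc, hf⟩ ⟨d, hd, hg⟩
        exact ⟨fun z => c z + d z, hc.add hd, fun z => by simp [hf, hg]⟩
      zero_mem' := ⟨0, differentiableOn_const 0, fun z => by simp⟩
      smul_mem' := by
        rintro k f ⟨c, hc, hf⟩
        exact ⟨fun z => k * c z, hc.const_mul k, fun z => by simp [hf]⟩ }
  let M : Submodule ℂ (closure Y →ᵇ ℂ) := M0.topologicalClosure
  have hFM : ∀ a, F a ∈ M := by
    intro a
    by_cases h0 : ω a = 0
    · simp [F, h0, M.zero_mem]
    refine M.smul_mem _ ?_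
    have ha : a ∉ closure Y := by
      obtain ⟨b, C, hb, hC, -⟩ := hesc a h0
      exact fun h => disjoint_left.1 (hC 0).2.2.2 (hC 0).2.1 (hb ▸ h)
    rw [hP a ha]
    refine Metric.mem_closure_iff.2 fun η hη => ?_
    obtain ⟨c, hc, hcc, hca⟩ := exists_differentiableOn_approx_inv_sub hXc hXW (hesc a h0)
      (half_pos hη)
    let f : closure Y →ᵇ ℂ := BoundedContinuousFunction.ofNormedAddCommGroup
      (fun z : closure Y => c z) (continuousOn_iff_continuous_domRestrict.1 hcc)
      (η / 2 + ‖poleFn hY ha‖) (fun z => by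
        have h1 := (poleFn hY ha).norm_coe_le_norm z
        have h2 := hca z z.2
        rw [poleFn_apply] at h1
        have h3 := norm_add_le (c z - ((z : ℂ) - a)⁻¹) (((z : ℂ) - a)⁻¹)
        rw [sub_add_cancel] at h3
        linarith)
    refine ⟨f, ⟨c, hc, fun z => rfl⟩, ?_⟩
    refine lt_of_le_of_lt ((BoundedContinuousFunction.dist_le (half_pos hη).le).2 fun z => ?_)
      (half_lt_self hη)
    rw [dist_comm, dist_eq_norm]
    exact hca z z.2
  have hmem := M.integral_mem_of_isClosed (Submodule.isClosed_topologicalClosure _) hFi hFM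
  obtain ⟨f, ⟨c, hc, hfc⟩, hfd⟩ := Metric.mem_closure_iff.1 hmem ε hε
  refine ⟨c, hc, fun z hz => ?_⟩
  have h1 := (BoundedContinuousFunction.evalCLM ℂ (⟨z, hz⟩ : closure Y)).integral_comp_comm hFi
  have h2 : ∀ a, (BoundedContinuousFunction.evalCLM ℂ (⟨z, hz⟩ : closure Y)) (F a) =
      ω a / (a - z) := by
    intro a
    simp only [BoundedContinuousFunction.evalCLM_apply, F]
    by_cases h0 : ω a = 0
    · simp [h0]
    have ha : a ∉ closure Y := fun h => disjoint_left.1 hd (subset_tsupport _ h0) h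
    rw [hP a ha]
    simp only [BoundedContinuousFunction.coe_smul, poleFn_apply, smul_eq_mul]
    rw [← neg_sub a z, inv_neg, div_eq_mul_inv]; ring
  simp only [h2] at h1
  rw [h1, ← hfc ⟨z, hz⟩, ← dist_eq_norm, dist_comm]
  exact (BoundedContinuousFunction.dist_coe_le_dist _).trans hfd.le

theorem differentiableOn_cauchy {U : Set ℂ} {ω : ℂ → ℂ} (hω : Continuous ω)
    (hωc : HasCompactSupport ω) (hU : IsOpen U) (hd : Disjoint (tsupport ω) U) :
    DifferentiableOn ℂ (fun z => ∫ a, ω a / (a - z)) U := by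
  intro z hz
  obtain ⟨δ, hδ, hball⟩ := Metric.isOpen_iff.1 hU z hz
  have hdist : ∀ a, ω a ≠ 0 → ∀ w ∈ ball z (δ / 2), δ / 2 ≤ ‖a - w‖ := by
    intro a ha w hw
    by_contra! h2
    rw [mem_ball] at hw
    have := dist_triangle a w z
    rw [← dist_eq_norm] at h2
    exact disjoint_left.1 hd (subset_tsupport _ ha) (hball (mem_ball.2 (by linarith)))
  have hm : Measurable ω := hω.measurable
  have hi : MeasureTheory.Integrable (fun a => ‖ω a‖ * (δ / 2)⁻¹) :=
    ((hω.integrable_of_hasCompactSupport hωc).norm).mul_const _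
  refine (hasDerivAt_integral_of_dominated_loc_of_deriv_le (𝕜 := ℂ)
    (μ := MeasureTheory.volume) (s := ball z (δ / 2))
    (F := fun z a => ω a / (a - z)) (F' := fun z a => ω a / (a - z) ^ 2)
    (bound := fun a => ‖ω a‖ * ((δ / 2) ^ 2)⁻¹) (x₀ := z)
    (ball_mem_nhds z (by positivity)) ?_ ?_ ?_ ?_ ?_ ?_).2.differentiableAt.differentiableWithinAt
  · exact Eventually.of_forall fun w => Measurable.aestronglyMeasurable (by fun_prop)
  · refine hi.mono' (Measurable.aestronglyMeasurable (by fun_prop)) (Eventually.of_forall fun a => ?_)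
    by_cases h0 : ω a = 0
    · simp [h0]
    rw [norm_div, div_eq_mul_inv]
    have := hdist a h0 z (mem_ball_self (by positivity))
    gcongr
  · exact Measurable.aestronglyMeasurable (by fun_prop)
  · refine Eventually.of_forall fun a w hw => ?_
    by_cases h0 : ω a = 0
    · simp [h0]
    rw [norm_div, div_eq_mul_inv, norm_pow]
    have := hdist a h0 w hw
    gcongr
  · exact ((hω.integrable_of_hasCompactSupport hωc).norm).mul_const _
  · refine Eventually.of_forall fun a w hw => ?_
    by_cases h0 : ω a = 0
    · simpa [h0] using hasDerivAt_const w (0 : ℂ)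
    have h1 : a - w ≠ 0 := by
      intro h
      have := hdist a h0 w hw
      rw [h, norm_zero] at this; linarith
    have h2 := (((hasDerivAt_id w).const_sub a).inv h1).const_mul (ω a)
    have h3 : ω a * (- -1 / (a - w) ^ 2) = ω a / (a - w) ^ 2 := by ring
    exact h3 ▸ h2

theorem exists_contDiffOn_cutoff {W E O : Set ℂ} (hW : IsOpen W) (hE : W ∩ closure E ⊆ E)
    (hEO : E ⊆ O) (hO : IsOpen O) (hOW : O ⊆ W) :
    ∃ χ : ℂ → ℝ, ContDiffOn ℝ 1 χ W ∧ (∀ z ∈ E, χ =ᶠ[𝓝 z] fun _ => 1) ∧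
      ∀ z ∈ W \ O, χ =ᶠ[𝓝 z] fun _ => 0 := by
  obtain ⟨f1, h1s, h1c, h1r⟩ := hO.exists_contDiff_support_eq (n := 1)
  obtain ⟨f2, h2s, h2c, h2r⟩ := (isClosed_closure (s := E)).isOpen_compl.exists_contDiff_support_eq
    (n := 1)
  have hf1 : ∀ z, 0 ≤ f1 z := fun z => (h1r (mem_range_self z)).1
  have hf2 : ∀ z, 0 ≤ f2 z := fun z => (h2r (mem_range_self z)).1
  have hpos : ∀ z ∈ W, 0 < f1 z + f2 z := by
    intro z hz
    by_cases h : z ∈ closure E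
    · have : z ∈ Function.support f1 := h1s ▸ hEO (hE ⟨hz, h⟩)
      have := lt_of_le_of_ne (hf1 z) (Ne.symm this)
      linarith [hf2 z]
    · have : z ∈ Function.support f2 := h2s ▸ h
      have := lt_of_le_of_ne (hf2 z) (Ne.symm this)
      linarith [hf1 z]
  let χ0 : ℂ → ℝ := fun z => f1 z / (f1 z + f2 z)
  have hχ0 : ContDiffOn ℝ 1 χ0 W :=
    (h1c.of_le (by simp)).contDiffOn.div ((h1c.add h2c).of_le (by simp)).contDiffOn fun z hz => (hpos z hz).ne'
  have hcont : ∀ z ∈ W, ContinuousAt χ0 z := fun z hz => hχ0.continuousOn.continuousAt (hW.mem_nhds hz)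
  refine ⟨fun z => Real.smoothTransition (3 * χ0 z - 1), ?_, fun z hz => ?_, fun z hz => ?_⟩
  · exact Real.smoothTransition.contDiff.comp_contDiffOn ((contDiffOn_const.mul hχ0).sub contDiffOn_const)
  · have hzW := hOW (hEO hz)
    have h2 : f2 z = 0 := by
      by_contra h
      have : z ∈ (closure E)ᶜ := h2s ▸ h
      exact this (subset_closure hz)
    have h3 : χ0 z = 1 := by
      have := hpos z hzW
      simp only [χ0, h2, add_zero] at this ⊢
      exact div_self this.ne'
    filter_upwards [(hcont z hzW).eventually (lt_mem_nhds (show (2 / 3 : ℝ) < χ0 z by rw [h3]; norm_num))]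
      with w hw
    exact Real.smoothTransition.one_of_one_le (by linarith)
  · have h2 : f1 z = 0 := by
      by_contra h
      have : z ∈ O := h1s ▸ h
      exact hz.2 this
    have h3 : χ0 z = 0 := by simp [χ0, h2]
    filter_upwards [(hcont z hz.1).eventually (gt_mem_nhds (show χ0 z < (1 / 3 : ℝ) by rw [h3]; norm_num))]
      with w hw
    exact Real.smoothTransition.zero_of_nonpos (by linarith)

theorem exists_contDiff_cutoff {A B : Set ℂ} (hA : IsCompact A)
    (hAB : A ⊆ interior B) :
    ∃ κ : ℂ → ℂ, ContDiff ℝ 1 κ ∧ (∀ z ∈ A, κ =ᶠ[𝓝 z] fun _ => 1) ∧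
      ∀ z ∉ interior B, κ =ᶠ[𝓝 z] fun _ => 0 := by
  obtain ⟨χ, h1, h2, h3⟩ := exists_contDiffOn_cutoff (W := univ) (E := A) (O := interior B)
    isOpen_univ (by simp [hA.isClosed.closure_eq]) hAB isOpen_interior (subset_univ _)
  refine ⟨fun z => (χ z : ℂ), Complex.ofRealCLM.contDiff.comp (contDiffOn_univ.1 h1),
    fun z hz => ?_, fun z hz => ?_⟩
  · filter_upwards [h2 z hz] with w hw; simp [hw]
  · filter_upwards [h3 z ⟨mem_univ _, hz⟩] with w hw; simp [hw]

theorem Filter.EventuallyEq.dbar_eq {F G : ℂ → ℂ} {z : ℂ} (h : F =ᶠ[𝓝 z] G) :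
    dbar F z = dbar G z := by
  unfold dbar; rw [h.fderiv_eq]

theorem dbar_const (c z : ℂ) : dbar (fun _ => c) z = 0 :=
  dbar_eq_zero_of_differentiableAt (differentiableAt_const c)

theorem continuousAt_dbar {F : ℂ → ℂ} {z : ℂ} (hF : ContDiffAt ℝ 1 F z) :
    ContinuousAt (dbar F) z := by
  have h := hF.continuousAt_fderiv one_ne_zero
  unfold dbar
  exact (h.clm_apply continuousAt_const).add (continuousAt_const.mul (h.clm_apply continuousAt_const))

theorem integrable_div_sub {φ : ℂ → ℂ} (hφ : Continuous φ) (hc : HasCompactSupport φ) (w : ℂ) :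
    MeasureTheory.Integrable fun a => φ a / (a - w) := by
  have h1 : MeasureTheory.LocallyIntegrable (fun a : ℂ => a⁻¹) := by
    refine MeasureTheory.locallyIntegrable_of_norm_le_rpow (C := 1) (α := 1) (by simp) (by simp)
      (Eventually.of_forall fun x => ?_) (by fun_prop)
    rw [norm_inv, one_mul, Real.rpow_neg_one]
  have h2 := (h1.integrable_smul_left_of_hasCompactSupport (g := fun a => φ (a + w)) (by fun_prop)
    (hc.comp_homeomorph (Homeomorph.addRight w))).comp_sub_right w
  simpa [div_eq_mul_inv] using h2

/-- Uniform approximation, on a relatively closed subset of an open set, by functions holomorphic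
on the whole open set, in the spirit of Arakelyan's theorem. -/
theorem exists_differentiableOn_approx {W E O : Set ℂ} (hW : IsOpen W) {X : ℕ → Set ℂ}
    (hX0 : X 0 = ∅) (hXc : ∀ n, IsCompact (X n)) (hXs : ∀ n, X n ⊆ interior (X (n + 1)))
    (hXW : ∀ n, X n ⊆ W) (hXu : ∀ z ∈ W, ∃ n, z ∈ X n)
    (hE : W ∩ closure E ⊆ E) (hEO : E ⊆ O) (hO : IsOpen O) (hOW : O ⊆ W) {f : ℂ → ℂ}
    (hf : DifferentiableOn ℂ f O)
    (hesc : ∀ n, ∀ a ∈ O \ E, a ∉ X n → Escapes X (E ∪ X (n - 1)) a) {ε : ℝ} (hε : 0 < ε) :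
    ∃ g : ℂ → ℂ, DifferentiableOn ℂ g W ∧ ∀ z ∈ E, ‖g z - f z‖ ≤ ε := by
  have hmono : Monotone X := monotone_nat_of_le_succ fun n => (hXs n).trans interior_subset
  have hXi : ∀ z ∈ W, ∃ n, z ∈ interior (X n) := fun z hz => by
    obtain ⟨n, hn⟩ := hXu z hz
    exact ⟨n + 1, hXs n hn⟩
  obtain ⟨χ, hχ, hχ1, hχ0⟩ := exists_contDiffOn_cutoff hW hE hEO hO hOW
  let G : ℂ → ℂ := fun z => f z * χ z
  have hGE : ∀ z ∈ E, G =ᶠ[𝓝 z] f := fun z hz => by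
    filter_upwards [hχ1 z hz] with w hw; simp [G, hw]
  have hGO : ∀ z ∈ W \ O, G =ᶠ[𝓝 z] fun _ => 0 := fun z hz => by
    filter_upwards [hχ0 z hz] with w hw; simp [G, hw]
  have hGc : ∀ z ∈ W, ContDiffAt ℝ 1 G z := by
    intro z hz
    by_cases hzO : z ∈ O
    · have h1 : ContDiffAt ℂ 1 f z := (hf.contDiffOn hO).contDiffAt (hO.mem_nhds hzO)
      have h2 : ContDiffAt ℝ 1 f z := h1.restrict_scalars ℝ
      exact h2.mul (Complex.ofRealCLM.contDiff.contDiffAt.comp z (hχ.contDiffAt (hW.mem_nhds hz)))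
    · exact contDiffAt_const.congr_of_eventuallyEq (hGO z ⟨hz, hzO⟩)
  have hdE : ∀ z ∈ E, dbar G =ᶠ[𝓝 z] fun _ => 0 := by
    intro z hz
    filter_upwards [(hGE z hz).eventuallyEq_nhds, hO.mem_nhds (hEO hz)] with w hw hwO
    rw [hw.dbar_eq, dbar_eq_zero_of_differentiableAt (hf.differentiableAt (hO.mem_nhds hwO))]
  have hdO : ∀ z ∈ W \ O, dbar G z = 0 := fun z hz => by
    rw [(hGO z hz).dbar_eq, dbar_const]
  choose κ hκ hκ1 hκ0 using fun n => exists_contDiff_cutoff (hXc n) (hXs n)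
  have hκW : ∀ n, ∀ z ∉ W, κ n =ᶠ[𝓝 z] fun _ => 0 := fun n z hz =>
    hκ0 n z fun h => hz (hXW _ (interior_subset h))
  have hκs : ∀ n, tsupport (κ n) ⊆ interior (X (n + 1)) := fun n z hz => by
    by_contra h
    exact notMem_tsupport_iff_eventuallyEq.2 (hκ0 n z h) hz
  have hκcs : ∀ n, HasCompactSupport (κ n) := fun n =>
    (hXc (n + 1)).of_isClosed_subset (isClosed_tsupport _) ((hκs n).trans interior_subset)
  -- the partition
  let k : ℕ → ℂ → ℂ := fun n z => κ n z - if n = 0 then 0 else κ (n - 1) z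
  have hksum : ∀ N z, ∑ n ∈ Finset.range (N + 1), k n z = κ N z := by
    intro N z
    induction N with
    | zero => simp [k]
    | succ N ih => rw [Finset.sum_range_succ, ih]; simp [k]
  have hkc : ∀ n, Continuous (k n) := fun n => by
    by_cases h : n = 0
    · simp only [k, h, if_true, sub_zero]; exact (hκ 0).continuous
    · simp only [k, h, if_false]; exact (hκ n).continuous.sub (hκ (n - 1)).continuous
  have hkX : ∀ n, ∀ z ∉ interior (X (n + 1)), k n =ᶠ[𝓝 z] fun _ => 0 := by
    intro n z hz
    have h1 := hκ0 n z hz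
    by_cases h : n = 0
    · filter_upwards [h1] with w hw; simp [k, h] at hw ⊢; exact hw
    · have h2 := hκ0 (n - 1) z fun h' => hz (interior_mono (hmono (by omega)) h')
      filter_upwards [h1, h2] with w hw hw2; simp [k, h, hw, hw2]
  have hkX' : ∀ n, ∀ z ∈ X (n - 1), k n =ᶠ[𝓝 z] fun _ => 0 := by
    intro n z hz
    by_cases h : n = 0
    · subst h; simp [hX0] at hz
    · filter_upwards [hκ1 n z (hmono (by omega) hz), hκ1 (n - 1) z hz] with w hw hw2
      simp [k, h, hw, hw2]
  let ω : ℕ → ℂ → ℂ := fun n z => dbar G z * k n z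
  have hωc : ∀ n, Continuous (ω n) := by
    intro n
    rw [continuous_iff_continuousAt]
    intro z
    by_cases hz : z ∈ W
    · exact (continuousAt_dbar (hGc z hz)).mul (hkc n).continuousAt
    · have h1 : ω n =ᶠ[𝓝 z] fun _ => 0 := by
        filter_upwards [hkX n z fun h => hz (hXW _ (interior_subset h))] with w hw
        simp [ω, hw]
      exact continuousAt_const.congr h1.symm
  have hωX : ∀ n, tsupport (ω n) ⊆ interior (X (n + 1)) := fun n z hz => by
    by_contra h
    refine notMem_tsupport_iff_eventuallyEq.2 ?_ hz
    filter_upwards [hkX n z h] with w hw; simp [ω, hw]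
  have hωcs : ∀ n, HasCompactSupport (ω n) := fun n =>
    (hXc (n + 1)).of_isClosed_subset (isClosed_tsupport _) ((hωX n).trans interior_subset)
  have hωX' : ∀ n, Disjoint (tsupport (ω n)) (X (n - 1)) := fun n => by
    rw [disjoint_left]
    intro z hz h
    refine notMem_tsupport_iff_eventuallyEq.2 ?_ hz
    filter_upwards [hkX' n z h] with w hw; simp [ω, hw]
  have hωE : ∀ n, Disjoint (tsupport (ω n)) E := fun n => by
    rw [disjoint_left]
    intro z hz h
    refine notMem_tsupport_iff_eventuallyEq.2 ?_ hz
    filter_upwards [hdE z h] with w hw; simp [ω, hw]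
  have happ : ∀ n, ∃ c : ℂ → ℂ, DifferentiableOn ℂ c W ∧
      ∀ z ∈ closure (E ∪ X (n - 1 - 1)), ‖c z - ∫ a, ω n a / (a - z)‖ ≤ ε / 2 ^ n := by
    intro n
    refine exists_differentiableOn_approx_cauchy hXc hXi (hωc n) (hωcs n) ?_ ?_ (by positivity)
    · rw [closure_union, (hXc _).isClosed.closure_eq, disjoint_left]
      rintro z hz (h | h)
      · exact disjoint_left.1 (hωE n) hz (hE ⟨hXW _ (interior_subset (hωX n hz)), h⟩)
      · exact disjoint_left.1 (hωX' n) hz (hmono (by omega) h)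
    · intro a ha
      have hat := subset_tsupport _ ha
      have haW := hXW _ (interior_subset (hωX n hat))
      refine hesc (n - 1) a ⟨?_, disjoint_left.1 (hωE n) hat⟩ (disjoint_left.1 (hωX' n) hat)
      by_contra h
      exact ha (by simp [ω, hdO a ⟨haW, h⟩])
  choose c hcd hca using happ
  let T : ℕ → ℂ → ℂ := fun n z => ∫ a, ω n a / (a - z)
  have hT : ∀ n, ∀ z ∈ E ∪ X (n - 1 - 1), ‖T n z - c n z‖ ≤ ε / 2 ^ n := fun n z hz => by
    rw [norm_sub_rev]; exact hca n z (subset_closure hz)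
  let g : ℂ → ℂ := fun z => G z + (2 * Real.pi : ℂ)⁻¹ * ∑' n, (T n z - c n z)
  have hgeo : HasSum (fun n : ℕ => ε / 2 ^ n) (ε * 2) := by
    simpa [div_eq_mul_inv] using (hasSum_geometric_two).mul_left ε
  refine ⟨g, fun z hz => ?_, fun z hz => ?_⟩
  · obtain ⟨M, hM⟩ := hXi z hz
    let N := M + 2
    let H : ℂ → ℂ := fun w => ∫ a, (G a * dbar (κ N) a) / (a - w)
    have hFc : ContDiff ℝ 1 (fun z => G z * κ N z) := by
      rw [contDiff_iff_contDiffAt]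
      intro w
      by_cases hw : w ∈ W
      · exact (hGc w hw).mul (hκ N).contDiffAt
      · refine contDiffAt_const (c := (0 : ℂ)).congr_of_eventuallyEq ?_
        filter_upwards [hκW N w hw] with v hv; simp [hv]
    have hFs : HasCompactSupport (fun z => G z * κ N z) := (hκcs N).mul_left
    have hdbar : ∀ a, dbar (fun z => G z * κ N z) a =
        G a * dbar (κ N) a + ∑ n ∈ Finset.range (N + 1), ω n a := by
      intro a
      have hs : ∑ n ∈ Finset.range (N + 1), ω n a = dbar G a * κ N a := by
        simp only [ω]; rw [← Finset.mul_sum, hksum]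
      rw [hs]
      by_cases ha : a ∈ W
      · exact dbar_mul ((hGc a ha).differentiableAt one_ne_zero)
          ((hκ N).contDiffAt.differentiableAt one_ne_zero)
      · have h1 := hκW N a ha
        have h2 : (fun z => G z * κ N z) =ᶠ[𝓝 a] fun _ => 0 := by
          filter_upwards [h1] with v hv; simp [hv]
        rw [h2.dbar_eq, h1.dbar_eq, dbar_const, h1.eq_of_nhds]; simp
    have hGκc : Continuous (fun a => G a * dbar (κ N) a) := by
      rw [continuous_iff_continuousAt]
      intro w
      by_cases hw : w ∈ W
      · exact (hGc w hw).continuousAt.mul (continuous_dbar (hκ N)).continuousAt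
      · refine (continuousAt_const (y := (0 : ℂ))).congr ?_
        filter_upwards [(hκW N w hw).eventuallyEq_nhds] with v hv
        rw [hv.dbar_eq, dbar_const, mul_zero]
    have hGκs : HasCompactSupport (fun a => G a * dbar (κ N) a) := by
      refine (hκcs N).mono' fun a ha => ?_
      by_contra h
      have h1 := notMem_tsupport_iff_eventuallyEq.1 h
      have h2 : κ N =ᶠ[𝓝 a] fun _ => 0 := h1
      exact ha (by simp [h2.dbar_eq, dbar_const])
    have hH : DifferentiableOn ℂ H (interior (X M)) := by
      refine differentiableOn_cauchy hGκc hGκs isOpen_interior ?_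
      rw [disjoint_left]
      intro w hw hwM
      refine notMem_tsupport_iff_eventuallyEq.2 ?_ hw
      filter_upwards [(hκ1 N w (hmono (by omega) (interior_subset hwM))).eventuallyEq_nhds] with v hv
      rw [hv.dbar_eq, dbar_const, mul_zero]; rfl
    have hpomp : ∀ w ∈ X M, -(2 * Real.pi * G w) = H w + ∑ n ∈ Finset.range (N + 1), T n w := by
      intro w hw
      have h1 := integral_dbar_div_sub hFc hFs w
      rw [(hκ1 N w (hmono (by omega) hw)).eq_of_nhds, mul_one] at h1
      rw [← h1]
      have hint : ∀ (φ : ℂ → ℂ), Continuous φ → HasCompactSupport φ →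
          MeasureTheory.Integrable fun a => φ a / (a - w) := fun φ h h' => integrable_div_sub h h' w
      simp only [hdbar, add_div, Finset.sum_div]
      rw [MeasureTheory.integral_add (hint _ hGκc hGκs)
        (MeasureTheory.integrable_finsetSum _ fun n _ => hint _ (hωc n) (hωcs n)),
        MeasureTheory.integral_finsetSum _ fun n _ => hint _ (hωc n) (hωcs n)]
    have hbd : ∀ n, ∀ w ∈ interior (X M), ‖T (n + (N + 1)) w - c (n + (N + 1)) w‖ ≤ ε / 2 ^ (n + (N + 1)) :=
      fun n w hw => hT _ w (Or.inr (hmono (by omega) (interior_subset hw)))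
    have hsumm : Summable fun n : ℕ => ε / 2 ^ (n + (N + 1)) :=
      (summable_nat_add_iff (f := fun n : ℕ => ε / 2 ^ n) (N + 1)).2 hgeo.summable
    have htail : DifferentiableOn ℂ (fun w => ∑' n, (T (n + (N + 1)) w - c (n + (N + 1)) w))
        (interior (X M)) := by
      refine Complex.differentiableOn_tsum_of_summable_norm hsumm (fun n => ?_) isOpen_interior hbd
      refine DifferentiableOn.sub ?_ ((hcd _).mono (interior_subset.trans (hXW M)))
      refine differentiableOn_cauchy (hωc _) (hωcs _) isOpen_interior ?_
      exact (hωX' _).mono_right (interior_subset.trans (hmono (by omega)))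
    have hgeq : ∀ w ∈ interior (X M), g w = (2 * Real.pi : ℂ)⁻¹ * (-H w -
        ∑ n ∈ Finset.range (N + 1), c n w + ∑' n, (T (n + (N + 1)) w - c (n + (N + 1)) w)) := by
      intro w hw
      have hs : Summable fun n => T n w - c n w := by
        rw [← summable_nat_add_iff (N + 1)]
        exact Summable.of_norm_bounded hsumm fun n => hbd n w hw
      have h1 := hpomp w (interior_subset hw)
      simp only [g]
      rw [← hs.sum_add_tsum_nat_add (N + 1), Finset.sum_sub_distrib]
      have hpi : (2 * Real.pi : ℂ) ≠ 0 := by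
        simp [Real.pi_ne_zero]
      field_simp
      linear_combination -h1
    have hd : DifferentiableOn ℂ g (interior (X M)) := by
      refine DifferentiableOn.congr ?_ hgeq
      refine DifferentiableOn.const_mul ((hH.neg.sub ?_).add htail) _
      exact DifferentiableOn.fun_sum fun n _ => (hcd n).mono (interior_subset.trans (hXW M))
    exact (hd.differentiableAt (isOpen_interior.mem_nhds hM)).differentiableWithinAt
  · have h1 : ‖∑' n, (T n z - c n z)‖ ≤ ε * 2 :=
      tsum_of_norm_bounded hgeo fun n => hT n z (Or.inl hz)
    have h2 : g z - f z = (2 * Real.pi : ℂ)⁻¹ * ∑' n, (T n z - c n z) := by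
      simp only [g, (hGE z hz).eq_of_nhds]; ring
    rw [h2, norm_mul, norm_inv]
    have h3 : ‖(2 * Real.pi : ℂ)‖ = 2 * Real.pi := by
      simp [abs_of_pos Real.pi_pos]
    rw [h3]
    have h4 := Real.pi_gt_three
    calc (2 * Real.pi)⁻¹ * ‖∑' n, (T n z - c n z)‖ ≤ (2 * Real.pi)⁻¹ * (ε * 2) := by gcongr
      _ = ε / Real.pi := by field_simp
      _ ≤ ε := div_le_self hε.le (by linarith)

open Pointwise in
theorem IsPreconnected.thickening {E : Type*} [SeminormedAddCommGroup E] [NormedSpace ℝ E] {s : Set E}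
    (hs : IsPreconnected s) (δ : ℝ) : IsPreconnected (thickening δ s) := by
  have h := (hs.prod (convex_ball (0 : E) δ).isPreconnected).image (fun p => p.1 + p.2)
    (by fun_prop)
  rwa [show (fun p : E × E => p.1 + p.2) '' s ×ˢ ball 0 δ = s + ball (0 : E) δ from image_prod _, add_ball,
    zero_vadd] at h

theorem exists_differentiable_approx_of_isPreconnected_compl {U : Set ℂ} (hU : IsOpen U)
    (hb : Bornology.IsBounded U) (hZ : IsPreconnected Uᶜ) {f : ℂ → ℂ} (hf : DifferentiableOn ℂ f U)
    {δ : ℝ} (hδ : 0 < δ) {ε : ℝ} (hε : 0 < ε) :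
    ∃ g : ℂ → ℂ, Differentiable ℂ g ∧ ∀ z, δ ≤ infDist z Uᶜ → ‖g z - f z‖ ≤ ε := by
  obtain ⟨R, hR0, hR⟩ : ∃ R : ℝ, 0 < R ∧ U ⊆ ball 0 R := by
    obtain ⟨R, hR⟩ := hb.subset_ball 0
    exact ⟨max R 1, by positivity, hR.trans (ball_subset_ball (le_max_left _ _))⟩
  have hmem : ∀ t : ℝ, R ≤ t → (t : ℂ) ∈ Uᶜ := fun t ht h => by
    have := mem_ball_zero_iff.1 (hR h)
    rw [Complex.norm_real, Real.norm_of_nonneg (hR0.le.trans ht)] at this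
    linarith
  have hne : (Uᶜ).Nonempty := ⟨_, hmem R le_rfl⟩
  have hEc : IsClosed {z | δ ≤ infDist z Uᶜ} :=
    isClosed_le continuous_const (continuous_infDist_pt _)
  have hEU : {z | δ ≤ infDist z Uᶜ} ⊆ U := fun z hz => by
    by_contra h
    have h0 : infDist z Uᶜ = 0 := infDist_zero_of_mem h
    have hz' : δ ≤ infDist z Uᶜ := hz
    linarith
  let X : ℕ → Set ℂ := fun n => if n = 0 then ∅ else closedBall 0 (n * R)
  have hX : ∀ n, n ≠ 0 → X n = closedBall 0 (n * R) := fun n hn => if_neg hn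
  have hX0 : X 0 = ∅ := if_pos rfl
  have hXsub : ∀ n, X n ⊆ closedBall 0 (n * R) := fun n => by
    rcases eq_or_ne n 0 with rfl | h
    · rw [hX0]; exact empty_subset _
    · rw [hX n h]
  obtain ⟨g, hg, hgE⟩ := exists_differentiableOn_approx (W := univ) (E := {z | δ ≤ infDist z Uᶜ})
    (O := U) isOpen_univ (X := X) hX0 (fun n => by
      rcases eq_or_ne n 0 with rfl | h
      · rw [hX0]; exact isCompact_empty
      · rw [hX n h]; exact isCompact_closedBall _ _) (fun n => by
      rw [hX (n + 1) (by omega), interior_closedBall _ (by positivity)]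
      refine (hXsub n).trans (closedBall_subset_ball ?_)
      push_cast; nlinarith) (fun n => subset_univ _) (fun z _ => by
      obtain ⟨n, hn⟩ := exists_nat_ge (‖z‖ / R)
      refine ⟨n + 1, ?_⟩
      rw [hX (n + 1) (by omega), mem_closedBall_zero_iff]
      rw [div_le_iff₀ hR0] at hn
      push_cast; nlinarith) (by rw [hEc.closure_eq]; exact inter_subset_right) hEU hU
      (subset_univ _) hf (by
      rintro n a ⟨haU, haE⟩ han
      have hn : n = 0 := by
        by_contra hn
        rw [hX n hn, mem_closedBall_zero_iff] at han
        have h1 := mem_ball_zero_iff.1 (hR haU)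
        have : (1 : ℝ) ≤ n := by exact_mod_cast Nat.one_le_iff_ne_zero.2 hn
        nlinarith
      subst hn
      have hcl : closure ({z | δ ≤ infDist z Uᶜ} ∪ X (0 - 1)) = {z | δ ≤ infDist z Uᶜ} := by
        rw [show (0 - 1) = 0 from rfl, hX0, union_empty, hEc.closure_eq]
      refine ⟨fun i => if i = 0 then a else ((i * R : ℝ) : ℂ), fun i =>
        if i = 0 then thickening δ Uᶜ else (fun t : ℝ => (t : ℂ)) '' Icc (i * R) ((i + 1 : ℕ) * R),
        rfl, fun i => ?_, fun k => ?_⟩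
      · rw [hcl]
        rcases eq_or_ne i 0 with rfl | hi
        · simp only [if_true, if_false, Nat.zero_add, one_ne_zero]
          refine ⟨hZ.thickening δ, ?_, ?_, ?_⟩
          · rw [mem_thickening_iff_infDist_lt hne]
            simpa using haE
          · refine self_subset_thickening hδ _ (hmem _ ?_)
            simp
          · rw [disjoint_left]
            intro z hz hz'
            rw [mem_thickening_iff_infDist_lt hne] at hz
            exact absurd hz (not_lt.2 hz')
        · simp only [if_neg hi, if_neg (Nat.succ_ne_zero i)]
          have h1 : (1 : ℝ) ≤ i := by exact_mod_cast Nat.one_le_iff_ne_zero.2 hi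
          refine ⟨isPreconnected_Icc.image _ (by fun_prop), ⟨_, ⟨le_rfl, ?_⟩, rfl⟩,
            ⟨_, ⟨?_, le_rfl⟩, rfl⟩, ?_⟩
          · push_cast; nlinarith
          · push_cast; nlinarith
          · rw [disjoint_left]
            rintro _ ⟨t, ht, rfl⟩ hz'
            exact hmem t (by have := ht.1; nlinarith) (hEU hz')
      · filter_upwards [eventually_gt_atTop k] with i hi
        rw [if_neg (by omega), disjoint_left]
        rintro _ ⟨t, ht, rfl⟩ hz
        have h1 := mem_closedBall_zero_iff.1 (hXsub k hz)
        have h2 : (k : ℝ) + 1 ≤ i := by exact_mod_cast hi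
        rw [Complex.norm_real] at h1
        have h3 := (le_abs_self t).trans h1
        have := ht.1
        nlinarith) hε
  exact ⟨g, differentiableOn_univ.1 hg, hgE⟩

/-- Runge's theorem yields primitives on bounded domains with connected complement. -/
theorem isExactOn_of_isPreconnected_compl {U : Set ℂ} (hU : IsOpen U) (hUc : IsPreconnected U)
    (hb : Bornology.IsBounded U) (hZ : IsPreconnected Uᶜ) {f : ℂ → ℂ} (hf : DifferentiableOn ℂ f U) :
    Complex.IsExactOn f U := by
  rcases U.eq_empty_or_nonempty with rfl | ⟨z₀, hz₀⟩
  · exact ⟨0, by simp⟩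
  have hne : (Uᶜ).Nonempty := by
    by_contra h
    rw [not_nonempty_iff_eq_empty, compl_empty_iff] at h
    rw [h] at hb
    exact NormedSpace.unbounded_univ ℝ ℂ hb
  choose p hpd hp using fun n : ℕ => exists_differentiable_approx_of_isPreconnected_compl hU hb hZ hf
    (Nat.one_div_pos_of_nat (n := n) (α := ℝ)) (Nat.one_div_pos_of_nat (n := n) (α := ℝ))
  choose P0 hP0 using fun n => (hpd n).isExactOn_univ
  let P : ℕ → ℂ → ℂ := fun n z => P0 n z - P0 n z₀
  have hP : ∀ n z, HasDerivAt (P n) (p n z) z := fun n z =>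
    (hP0 n z (mem_univ _)).sub_const _
  have key : ∀ c ∈ U, ∃ r > 0, ball c r ⊆ U ∧ ∃ Q : ℂ → ℂ, (∀ z ∈ ball c r, HasDerivAt Q (f z) z) ∧
      ∀ z ∈ ball c r, Tendsto (fun n => P n z - Q z - (P n c - Q c)) atTop (𝓝 0) := by
    intro c hc
    obtain ⟨r, hr, hrU⟩ := Metric.isOpen_iff.1 hU c hc
    have hsub : ball c (r / 2) ⊆ ball c r := ball_subset_ball (by linarith)
    obtain ⟨Q, hQ⟩ := (hf.mono (hsub.trans hrU)).isExactOn_ball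
    refine ⟨r / 2, by positivity, hsub.trans hrU, Q, hQ, fun z hz => ?_⟩
    have hd : ∀ w ∈ ball c (r / 2), r / 2 ≤ infDist w Uᶜ := fun w hw => by
      refine (le_infDist hne).2 fun y hy => ?_
      by_contra! h
      refine hy (hrU ?_)
      rw [mem_ball] at hw ⊢
      have := dist_triangle y w c
      rw [dist_comm y w] at this
      linarith
    obtain ⟨N, hN⟩ := exists_nat_gt (2 / r)
    have hbd : ∀ᶠ n : ℕ in atTop, ‖P n z - Q z - (P n c - Q c)‖ ≤ 1 / ((n : ℝ) + 1) * ‖z - c‖ := by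
      filter_upwards [eventually_ge_atTop N] with n hn
      refine Convex.norm_image_sub_le_of_norm_hasDerivWithin_le (f := fun z => P n z - Q z)
        (f' := fun z => p n z - f z) (s := ball c (r / 2))
        (fun x hx => ((hP n x).sub (hQ x hx)).hasDerivWithinAt) (fun x hx => hp n x ?_)
        (convex_ball _ _) (mem_ball_self (by positivity)) hz
      refine le_trans ?_ (hd x hx)
      rw [div_le_iff₀ (by positivity)]
      have : (N : ℝ) ≤ n := by exact_mod_cast hn
      rw [div_lt_iff₀ hr] at hN
      nlinarith
    refine squeeze_zero_norm' hbd ?_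
    simpa using tendsto_one_div_add_atTop_nhds_zero_nat.mul_const ‖z - c‖
  have hconv : ∀ z ∈ U, ∃ L, Tendsto (fun n => P n z) atTop (𝓝 L) := by
    intro z hz
    refine hUc.induction₂' (fun x y => (∃ L, Tendsto (fun n => P n x) atTop (𝓝 L)) →
      ∃ L, Tendsto (fun n => P n y) atTop (𝓝 L)) (fun c hc => ?_) (fun x y z _ _ _ h h' => h' ∘ h)
      hz₀ hz ⟨0, by simp [P]⟩
    obtain ⟨r, hr, hrU, Q, hQ, hlim⟩ := key c hc
    filter_upwards [mem_nhdsWithin_of_mem_nhds (ball_mem_nhds c hr)] with y hy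
    constructor
    · rintro ⟨L, hL⟩
      refine ⟨_, ((hlim y hy).add (hL.add_const (Q y - Q c))).congr fun n => ?_⟩
      ring
    · rintro ⟨L, hL⟩
      refine ⟨_, (hL.sub ((hlim y hy).add_const (Q y - Q c))).congr fun n => ?_⟩
      ring
  choose! F hF using hconv
  refine ⟨F, fun c hc => ?_⟩
  obtain ⟨r, hr, hrU, Q, hQ, hlim⟩ := key c hc
  have he : F =ᶠ[𝓝 c] fun z => Q z + (F c - Q c) := by
    filter_upwards [ball_mem_nhds c hr] with z hz
    have h1 := ((hF z (hrU hz)).sub_const (Q z)).sub ((hF c hc).sub_const (Q c))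
    have h2 := tendsto_nhds_unique h1 (hlim z hz)
    linear_combination h2
  exact ((hQ c (mem_ball_self hr)).add_const _).congr_of_eventuallyEq he

theorem IsCompact.exists_isClosed_separation {X : Type*} [TopologicalSpace X] [T2Space X] {Q S : Set X}
    (hQ : IsCompact Q) (hS : IsClosed S) {a : X} (ha : a ∈ Q)
    (h : ∀ C ⊆ Q, IsPreconnected C → a ∈ C → Disjoint C S) :
    ∃ D ⊆ Q, IsClosed D ∧ IsClosed (Q \ D) ∧ a ∈ D ∧ Disjoint D S := by
  have : CompactSpace Q := isCompact_iff_compactSpace.1 hQ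
  let a' : Q := ⟨a, ha⟩
  have h1 : ∀ x ∈ ⋂ s : { s : Set Q // IsClopen s ∧ a' ∈ s }, s.1,
      (Subtype.val ⁻¹' Sᶜ : Set Q) ∈ 𝓝 x := by
    intro x hx
    rw [← connectedComponent_eq_iInter_isClopen a'] at hx
    refine (hS.isOpen_compl.preimage continuous_subtype_val).mem_nhds fun hxS => ?_
    exact disjoint_left.1 (h (Subtype.val '' connectedComponent a')
      (by rintro _ ⟨y, _, rfl⟩; exact y.2)
      (isPreconnected_connectedComponent.image _ continuous_subtype_val.continuousOn)
      ⟨a', mem_connectedComponent, rfl⟩) ⟨x, hx, rfl⟩ hxS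
  have : Nonempty { s : Set Q // IsClopen s ∧ a' ∈ s } := ⟨⟨univ, isClopen_univ, mem_univ _⟩⟩
  obtain ⟨⟨s, hs, has⟩, hsS⟩ := exists_subset_nhds_of_isCompact'
    (V := fun s : { s : Set Q // IsClopen s ∧ a' ∈ s } => s.1)
    (fun s t => ⟨⟨s.1 ∩ t.1, s.2.1.inter t.2.1, s.2.2, t.2.2⟩, inter_subset_left, inter_subset_right⟩)
    (fun s => s.2.1.isClosed.isCompact) (fun s => s.2.1.isClosed) h1
  have hcl : ∀ t : Set Q, IsClosed t → IsClosed (Subtype.val '' t) := fun t ht =>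
    (ht.isCompact.image continuous_subtype_val).isClosed
  refine ⟨Subtype.val '' s, by rintro _ ⟨y, _, rfl⟩; exact y.2, hcl _ hs.isClosed, ?_, ⟨a', has, rfl⟩, ?_⟩
  · have : Q \ Subtype.val '' s = Subtype.val '' sᶜ := by
      ext x
      constructor
      · rintro ⟨hxQ, hx⟩
        exact ⟨⟨x, hxQ⟩, fun h => hx ⟨_, h, rfl⟩, rfl⟩
      · rintro ⟨y, hy, rfl⟩
        exact ⟨y.2, fun ⟨z, hz, hzy⟩ => hy (Subtype.val_injective hzy ▸ hz)⟩
    rw [this]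
    exact hcl _ hs.compl.isClosed
  · rw [disjoint_left]
    rintro _ ⟨y, hy, rfl⟩
    exact hsS hy

theorem exists_continuous_log {X : Type*} [TopologicalSpace X] [LocallyPathConnectedSpace X]
    [ContractibleSpace X] {g : X → ℂ} (hg : Continuous g) (h : ∀ x, g x ≠ 0) :
    ∃ l : X → ℂ, Continuous l ∧ ∀ x, Complex.exp (l x) = g x := by
  have hc : ContractibleSpace (univ : Set X) := (Homeomorph.Set.univ X).contractibleSpace
  have hs : SimplyConnectedSpace (univ : Set X) := inferInstance
  obtain ⟨f, hf, hfg⟩ := Complex.exists_continuousOn_eqOn_exp_comp (U := (univ : Set X))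
    hs isOpen_univ hg.continuousOn (by rintro ⟨x, _, hx⟩; exact h x hx)
  exact ⟨f, continuousOn_univ.1 hf, fun x => hfg (mem_univ x)⟩

theorem not_continuous_log_on_circle {R : ℝ} (hR : 0 < R) {a : ℂ} (ha : ‖a‖ < R) {L : ℂ → ℂ}
    (hL : Continuous L) (h : ∀ z, ‖z‖ = R → Complex.exp (L z) = z - a) : False := by
  let z : ℝ → ℂ := fun θ => R * Complex.exp (θ * Complex.I)
  have hzn : ∀ θ, ‖z θ‖ = R := fun θ => by
    simp [z, Complex.norm_exp_ofReal_mul_I, abs_of_pos hR]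
  have hz0 : ∀ θ, z θ ≠ 0 := fun θ h => by have := hzn θ; rw [h, norm_zero] at this; linarith
  have hzc : Continuous z := by fun_prop
  have hre : ∀ θ, 0 < (1 - a / z θ).re := fun θ => by
    have h1 : ‖a / z θ‖ < 1 := by rw [norm_div, hzn, div_lt_one hR]; exact ha
    have h2 := (Complex.re_le_norm (a / z θ)).trans_lt h1
    simp; simpa using h2
  let k : ℝ → ℂ := fun θ => L (z θ) - Complex.log (1 - a / z θ) - θ * Complex.I
  have hkc : Continuous k := by
    refine ((hL.comp hzc).sub (Continuous.clog (by fun_prop (disch := exact hz0 _)) fun θ =>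
      Or.inl (hre θ))).sub (by fun_prop)
  have hk : ∀ θ, Complex.exp (k θ) = R := fun θ => by
    have h1 : (1 - a / z θ) ≠ 0 := fun h => by have := hre θ; rw [h] at this; simp at this
    have h2 : z θ - a = z θ * (1 - a / z θ) := by field_simp [hz0 θ]
    simp only [k]
    rw [Complex.exp_sub, Complex.exp_sub, h _ (hzn θ), Complex.exp_log h1, h2,
      mul_div_assoc, div_self h1, mul_one]
    exact mul_div_cancel_right₀ _ (Complex.exp_ne_zero _)
  have hz2 : z (2 * Real.pi) = z 0 := by simp [z, Complex.exp_two_pi_mul_I]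
  have hk2 : (k (2 * Real.pi)).im = (k 0).im - 2 * Real.pi := by
    simp only [k, hz2]; simp
  have hki : Continuous fun θ => (k θ).im := Complex.continuous_im.comp hkc
  obtain ⟨θ, -, hθ⟩ : (k 0).im - Real.pi ∈ (fun θ => (k θ).im) '' Icc 0 (2 * Real.pi) := by
    refine intermediate_value_Icc' (by positivity) hki.continuousOn ⟨?_, ?_⟩
    · rw [hk2]; linarith [Real.pi_pos]
    · linarith [Real.pi_pos]
  obtain ⟨n, hn⟩ := Complex.exp_eq_exp_iff_exists_int.1 ((hk θ).trans (hk 0).symm)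
  have h3 := congrArg Complex.im hn
  simp at h3 hθ
  have h4 : (n : ℝ) * 2 = -1 := by
    have : ((n : ℝ) * 2) * Real.pi = (-1) * Real.pi := by linarith
    exact mul_right_cancel₀ Real.pi_ne_zero this
  have h5 : n * 2 = -1 := by exact_mod_cast h4
  omega

/-- A point of the complement of a bounded open set `N` around which `N` does not wind lies in the
unbounded component of the complement. -/
theorem mem_connectedComponentIn_compl_of_log {N : Set ℂ} (hN : IsOpen N) {R : ℝ} (hR : 0 < R)
    (hNR : N ⊆ ball 0 R) {a : ℂ} (ha : a ∉ N) {l : ℂ → ℂ} (hl : ContinuousOn l N)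
    (hle : ∀ z ∈ N, Complex.exp (l z) = z - a) : a ∈ connectedComponentIn Nᶜ (R : ℂ) := by
  have hbig : ∀ z : ℂ, R ≤ ‖z‖ → z ∈ connectedComponentIn Nᶜ (R : ℂ) := by
    have hpre : IsPreconnected (Complex.exp '' {z | Real.log R ≤ z.re}) :=
      (convex_halfSpace_re_ge _).isPreconnected.image _ Complex.continuous_exp.continuousOn
    have himg : Complex.exp '' {z | Real.log R ≤ z.re} = {z | R ≤ ‖z‖} := by
      ext z
      constructor
      · rintro ⟨w, hw, rfl⟩
        simp only [mem_ofPred_eq] at hw ⊢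
        rw [Complex.norm_exp, ← Real.log_le_iff_le_exp hR]
        exact hw
      · intro hz
        have hz' : R ≤ ‖z‖ := hz
        have hz0 : z ≠ 0 := norm_pos_iff.1 (hR.trans_le hz')
        refine ⟨Complex.log z, ?_, Complex.exp_log hz0⟩
        simp only [mem_ofPred_eq, Complex.log_re]
        exact Real.log_le_log hR hz'
    rw [himg] at hpre
    refine fun z hz => hpre.subset_connectedComponentIn (F := Nᶜ) ?_ (fun w hw hwN => ?_) hz
    · simp [abs_of_pos hR]
    · have := mem_ball_zero_iff.1 (hNR hwN)
      have hw' : R ≤ ‖w‖ := hw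
      linarith
  by_contra hcon
  have haR : ‖a‖ < R := by
    by_contra! h
    exact hcon (hbig a h)
  obtain ⟨D, hDQ, hDc, hQD, haD, hDS⟩ := IsCompact.exists_isClosed_separation (S := {z : ℂ | R ≤ ‖z‖})
    ((isCompact_closedBall (0 : ℂ) R).inter_left hN.isClosed_compl)
    (isClosed_le continuous_const continuous_norm) (a := a) ⟨ha, mem_closedBall_zero_iff.2 haR.le⟩ (by
      intro C hC hCp haC
      rw [disjoint_left]
      intro z hz hzR
      have h1 := hbig z hzR
      rw [connectedComponentIn_eq h1] at hcon
      exact hcon (hCp.subset_connectedComponentIn hz (hC.trans inter_subset_left) haC))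
  have hD'c : IsClosed (Nᶜ \ D) := by
    have : Nᶜ \ D = ((Nᶜ ∩ closedBall 0 R) \ D) ∪ {z : ℂ | R ≤ ‖z‖} := by
      ext z
      constructor
      · rintro ⟨h1, h2⟩
        rcases le_total ‖z‖ R with h | h
        · exact Or.inl ⟨⟨h1, mem_closedBall_zero_iff.2 h⟩, h2⟩
        · exact Or.inr h
      · rintro (⟨⟨h1, -⟩, h2⟩ | h)
        · exact ⟨h1, h2⟩
        · refine ⟨fun hzN => ?_, fun hzD => disjoint_left.1 hDS hzD h⟩
          have := mem_ball_zero_iff.1 (hNR hzN)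
          have h' : R ≤ ‖z‖ := h
          linarith
    rw [this]
    exact hQD.union (isClosed_le continuous_const continuous_norm)
  obtain ⟨u, hu0, hu1, -⟩ := exists_continuous_zero_one_of_isClosed hDc hD'c disjoint_sdiff_right
  let v : ℂ → ℝ := fun z => max 0 (min 1 (3 * u z - 1))
  have hv : Continuous v := by have := u.continuous; fun_prop
  classical
  let F : ℂ → ℂ := fun z => if z ∈ N then Complex.exp (v z * l z) else if z ∈ D then 1 else z - a
  have hF0 : ∀ z, F z ≠ 0 := by
    intro z
    simp only [F]
    split_ifs with h1 h2
    · exact Complex.exp_ne_zero _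
    · exact one_ne_zero
    · exact fun h => h2 (sub_eq_zero.1 h ▸ haD)
  have hFc : Continuous F := by
    rw [continuous_iff_continuousAt]
    intro z
    by_cases hzN : z ∈ N
    · have h1 : ContinuousAt (fun z => Complex.exp (v z * l z)) z :=
        ((Complex.continuous_ofReal.comp hv).continuousAt.mul (hl.continuousAt (hN.mem_nhds hzN))).cexp
      refine h1.congr ?_
      filter_upwards [hN.mem_nhds hzN] with w hw
      exact (if_pos hw).symm
    by_cases hzD : z ∈ D
    · have h1 : F =ᶠ[𝓝 z] fun _ => 1 := by
        have : ∀ᶠ w in 𝓝 z, u w < 1 / 3 :=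
          u.continuous.continuousAt.eventually_lt continuousAt_const (by rw [hu0 hzD]; norm_num)
        filter_upwards [this] with w hw
        have hvw : v w = 0 := by
          simp only [v]
          exact max_eq_left ((min_le_right _ _).trans (by linarith))
        simp only [F]
        split_ifs with h1 h2
        · simp [hvw]
        · rfl
        · have := hu1 ⟨h1, h2⟩
          simp at this
          linarith
      exact continuousAt_const.congr h1.symm
    · have h1 : F =ᶠ[𝓝 z] fun w => w - a := by
        have h1 : u z = 1 := hu1 ⟨hzN, hzD⟩
        have : ∀ᶠ w in 𝓝 z, 2 / 3 < u w :=
          continuousAt_const.eventually_lt u.continuous.continuousAt (by rw [h1]; norm_num)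
        filter_upwards [this] with w hw
        have hvw : v w = 1 := by
          simp only [v]
          rw [min_eq_left (by linarith)]
          norm_num
        simp only [F]
        split_ifs with h1 h2
        · simp [hvw, hle w h1]
        · have := hu0 h2
          simp at this
          linarith
        · rfl
      exact ContinuousAt.congr (by fun_prop) h1.symm
  obtain ⟨L, hL, hLF⟩ := exists_continuous_log hFc hF0
  refine not_continuous_log_on_circle hR haR hL fun z hz => ?_
  rw [hLF]
  simp only [F]
  rw [if_neg fun h => ?_, if_neg fun h => ?_]
  · exact disjoint_left.1 hDS h hz.ge
  · have := mem_ball_zero_iff.1 (hNR h)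
    linarith

theorem exists_continuousOn_parameter {W : Set ℂ} (hW : IsOpen W) {γ : ℝ → ℂ} (hγ : Continuous γ)
    (hγW : ∀ t, 0 ≤ t → γ t ∈ W) (hinj : InjOn γ (Ici 0))
    (hproper : ∀ C, IsCompact C → C ⊆ W → ∃ T : ℝ, ∀ t, T ≤ t → γ t ∉ C) :
    ∃ τ : ℂ → ℝ, ContinuousOn τ W ∧ (∀ z, 0 ≤ τ z) ∧ ∀ u, 0 ≤ u → τ (γ u) = u := by
  let e : Ici (0 : ℝ) → W := fun u => ⟨γ u, hγW u u.2⟩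
  have hec : Continuous e := by fun_prop
  have hei : Function.Injective e := fun u v h => Subtype.ext (hinj u.2 v.2 (congrArg Subtype.val h))
  have hloc : LocallyCompactSpace W := hW.locallyCompactSpace
  have hep : IsProperMap e := by
    refine isProperMap_iff_isCompact_preimage.2 ⟨hec, fun C hC => ?_⟩
    obtain ⟨T, hT⟩ := hproper (Subtype.val '' C) (hC.image continuous_subtype_val)
      (by rintro _ ⟨y, _, rfl⟩; exact y.2)
    have h1 : IsCompact (Subtype.val ⁻¹' Icc 0 T : Set (Ici (0 : ℝ))) :=
      (isClosed_Ici.isClosedEmbedding_subtypeVal).isCompact_preimage isCompact_Icc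
    refine h1.of_isClosed_subset (hC.isClosed.preimage hec) fun u hu => ⟨u.2, ?_⟩
    by_contra! h
    exact hT u h.le ⟨_, hu, rfl⟩
  have hce : IsClosedEmbedding e :=
    IsClosedEmbedding.of_continuous_injective_isClosedMap hec hei hep.isClosedMap
  obtain ⟨g, hg⟩ := ContinuousMap.exists_extension hce ⟨fun u : Ici (0 : ℝ) => (u : ℝ), by fun_prop⟩
  classical
  refine ⟨fun z => if h : z ∈ W then max 0 (g ⟨z, h⟩) else 0, ?_, fun z => ?_, fun u hu => ?_⟩
  · rw [continuousOn_iff_continuous_domRestrict]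
    have : (W.domRestrict fun z => if h : z ∈ W then max 0 (g ⟨z, h⟩) else 0) = fun z => max 0 (g z) := by
      ext z; simp
    rw [this]
    fun_prop
  · dsimp only
    split_ifs
    · exact le_max_left _ _
    · exact le_rfl
  · have h1 := DFunLike.congr_fun hg (⟨u, hu⟩ : Ici (0 : ℝ))
    simp only [ContinuousMap.comp_apply, ContinuousMap.coe_mk, e] at h1
    simp only [hγW u hu, dif_pos, h1]
    exact max_eq_right hu

/-- A thin simply connected neighbourhood of a properly embedded ray. -/
theorem exists_tube {W : Set ℂ} (hW : IsOpen W) (hWb : Bornology.IsBounded W) {γ : ℝ → ℂ}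
    (hγ : Continuous γ) (hγW : ∀ t, 0 ≤ t → γ t ∈ W) (hinj : InjOn γ (Ici 0))
    (hproper : ∀ C, IsCompact C → C ⊆ W → ∃ T : ℝ, ∀ t, T ≤ t → γ t ∉ C)
    {r : ℝ → ℝ} (hrc : Continuous r) (hr0 : ∀ u, 0 < r u)
    (hr : ∀ u v, 0 ≤ u → 0 ≤ v → 1 ≤ |u - v| → r u + r v ≤ dist (γ u) (γ v)) :
    ∃ (U : Set ℂ) (τ : ℂ → ℝ), IsOpen U ∧ U ⊆ W ∧ IsPreconnected U ∧ IsPreconnected Uᶜ ∧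
      ContinuousOn τ U ∧ (∀ z, 0 ≤ τ z) ∧ (∀ u, 0 ≤ u → γ u ∈ U ∧ τ (γ u) = u) ∧
      (∀ z ∈ U, dist z (γ (τ z)) < r (τ z)) ∧
      ∀ z ∈ U, ∃ S ⊆ U, IsPreconnected S ∧ z ∈ S ∧ (∀ s ∈ S, τ s < τ z + 3) ∧
        ∃ u, 0 ≤ u ∧ u < τ z + 2 ∧ γ u ∈ S := by
  obtain ⟨τ, hτc, hτ0, hτγ⟩ := exists_continuousOn_parameter hW hγ hγW hinj hproper
  have hWne : ∃ p, p ∉ W := by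
    by_contra! h
    rw [eq_univ_of_forall h] at hWb
    exact NormedSpace.unbounded_univ ℝ ℂ hWb
  obtain ⟨p, hp⟩ := hWne
  have hopen : ∀ s : ℝ → ℝ, Continuous s → IsOpen {z | z ∈ W ∧ dist z (γ (τ z)) < s (τ z)} := by
    intro s hs
    have h1 : ContinuousOn (fun z => s (τ z) - dist z (γ (τ z))) W :=
      (hs.comp_continuousOn hτc).sub
        (continuous_dist.comp_continuousOn (continuousOn_id.prodMk (hγ.comp_continuousOn hτc)))
    convert h1.isOpen_inter_preimage hW isOpen_Ioi (t := Ioi 0) using 1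
    ext z; simp
  have hshrink : ∀ N : Set ℂ, IsOpen N → N ⊆ W → (∀ u, 0 ≤ u → γ u ∈ N) → ∃ s : ℝ → ℝ, Continuous s ∧
      (∀ u, 0 ≤ u → 0 < s u) ∧ (∀ u, s u ≤ r u) ∧ ∀ u, ∀ a ∉ N, s u ≤ dist (γ u) a := by
    intro N hN hNW hγN
    have hne : (Nᶜ).Nonempty := ⟨p, fun h => hp (hNW h)⟩
    refine ⟨fun u => min (infDist (γ u) Nᶜ) (r u), ?_, fun u hu => ?_, fun u => min_le_right _ _,
      fun u a ha => (min_le_left _ _).trans (infDist_le_dist_of_mem ha)⟩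
    · exact ((continuous_infDist_pt _).comp hγ).min hrc
    · refine lt_min ?_ (hr0 u)
      exact (hN.isClosed_compl.notMem_iff_infDist_pos hne).1 (not_not.2 (hγN u hu))
  have hN1γ : ∀ s : ℝ → ℝ, (∀ u, 0 ≤ u → 0 < s u) → ∀ u, 0 ≤ u →
      γ u ∈ {z | z ∈ W ∧ dist z (γ (τ z)) < s (τ z)} := fun s hs u hu =>
    ⟨hγW u hu, by rw [hτγ u hu, dist_self]; exact hs u hu⟩
  set N1 : Set ℂ := {z | z ∈ W ∧ dist z (γ (τ z)) < r (τ z)} with hN1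
  obtain ⟨s, hsc, hs0, hsr, hsN⟩ := hshrink N1 (hopen r hrc) (fun z hz => hz.1)
    (hN1γ r fun u _ => hr0 u)
  set N2 : Set ℂ := {z | z ∈ W ∧ dist z (γ (τ z)) < s (τ z)} with hN2
  obtain ⟨s', hsc', hs0', hsr', hsN'⟩ := hshrink N2 (hopen s hsc) (fun z hz => hz.1) (hN1γ s hs0)
  let N0 : Set ℂ := ⋃ u ∈ Ici (0 : ℝ), ball (γ u) (s' u)
  have hN0o : IsOpen N0 := isOpen_biUnion fun _ _ => isOpen_ball
  have hN0N2 : N0 ⊆ N2 := by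
    intro z hz
    obtain ⟨u, hu, hzu⟩ := mem_iUnion₂.1 hz
    by_contra h
    have h1 := hsN' u z h
    rw [mem_ball, dist_comm] at hzu
    linarith
  obtain ⟨R, hR0, hR⟩ : ∃ R : ℝ, 0 < R ∧ N0 ⊆ ball 0 R := by
    obtain ⟨R, hR⟩ := hWb.subset_ball 0
    exact ⟨max R 1, by positivity, fun z hz =>
      ball_subset_ball (le_max_left _ _) (hR (hN0N2 hz).1)⟩
  let Z := connectedComponentIn N0ᶜ (R : ℂ)
  have hRN0 : (R : ℂ) ∈ N0ᶜ := fun h => by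
    have := mem_ball_zero_iff.1 (hR h)
    simp [abs_of_pos hR0] at this
  have hZpre : IsPreconnected Z := isPreconnected_connectedComponentIn
  have hZsub : Z ⊆ N0ᶜ := connectedComponentIn_subset _ _
  have hRZ : (R : ℂ) ∈ Z := mem_connectedComponentIn hRN0
  have hZc : IsClosed Z := by
    refine closure_subset_iff_isClosed.1 ?_
    exact hZpre.closure.subset_connectedComponentIn (subset_closure hRZ)
      (closure_minimal hZsub hN0o.isClosed_compl)
  have hN0U : N0 ⊆ Zᶜ := fun z hz hzZ => hZsub hzZ hz
  have hUN1 : Zᶜ ⊆ N1 := by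
    intro a haZ
    by_contra haN1
    refine haZ ?_
    have hγa : ∀ u, 0 ≤ u → γ u - a ≠ 0 := fun u hu h =>
      haN1 (sub_eq_zero.1 h ▸ hN1γ r (fun u _ => hr0 u) u hu)
    obtain ⟨l, hlc, hl⟩ := exists_continuous_log (g := fun u : ℝ => γ (max u 0) - a) (by fun_prop)
      fun u => hγa _ (le_max_right _ _)
    have hN0W : N0 ⊆ W := fun z hz => (hN0N2 hz).1
    have haN0 : a ∉ N0 := fun h => haN1 ⟨hN0W h, (hN0N2 h).2.trans_le (hsr _)⟩
    refine mem_connectedComponentIn_compl_of_log hN0o hR0 hR haN0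
      (l := fun z => l (τ z) + Complex.log ((z - a) / (γ (τ z) - a))) ?_ fun z hz => ?_
    · refine (hlc.comp_continuousOn (hτc.mono hN0W)).add (ContinuousOn.clog ?_ fun z hz => Or.inl ?_)
      · exact (continuousOn_id.sub continuousOn_const).div
          ((hγ.comp_continuousOn (hτc.mono hN0W)).sub continuousOn_const) fun z _ => hγa _ (hτ0 z)
      · have h1 : ‖(z - γ (τ z)) / (γ (τ z) - a)‖ < 1 := by
          rw [norm_div, div_lt_one (norm_pos_iff.2 (hγa _ (hτ0 z))), ← dist_eq_norm, ← dist_eq_norm]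
          exact (hN0N2 hz).2.trans_le (hsN _ _ haN1)
        have h2 : (z - a) / (γ (τ z) - a) = 1 + (z - γ (τ z)) / (γ (τ z) - a) := by
          rw [eq_comm, ← div_self (hγa _ (hτ0 z)), ← add_div]; congr 1; ring
        rw [h2, Complex.add_re, Complex.one_re]
        have := (abs_lt.1 ((Complex.abs_re_le_norm _).trans_lt h1)).1
        linarith
    · have h1 : z - a ≠ 0 := sub_ne_zero.2 fun h => haN0 (h ▸ hz)
      rw [Complex.exp_add, hl, Complex.exp_log (div_ne_zero h1 (hγa _ (hτ0 z))), max_eq_left (hτ0 z)]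
      exact mul_div_cancel₀ _ (hγa _ (hτ0 z))
  have hclose : ∀ z ∈ Zᶜ, ∀ u, 0 ≤ u → dist z (γ u) < r u → |τ z - u| < 1 := by
    intro z hz u hu hzu
    by_contra! h
    have h1 := hr _ _ (hτ0 z) hu h
    have h2 := (hUN1 hz).2
    have h3 := dist_triangle_left (γ (τ z)) (γ u) z
    linarith
  have hγU : ∀ u, 0 ≤ u → γ u ∈ Zᶜ := fun u hu =>
    hN0U (mem_iUnion₂.2 ⟨u, hu, mem_ball_self (hs0' u hu)⟩)
  have hball : ∀ u, 0 ≤ u → ball (γ u) (s' u) ⊆ N0 := fun u hu z hz => mem_iUnion₂.2 ⟨u, hu, hz⟩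
  have hLP : ∀ z ∈ Zᶜ, ∃ S ⊆ Zᶜ, IsPreconnected S ∧ z ∈ S ∧ (∀ s ∈ S, τ s < τ z + 3) ∧
        ∃ u, 0 ≤ u ∧ u < τ z + 2 ∧ γ u ∈ S := by
    intro z hz
    have hzr := (hUN1 hz).2
    let c : ℝ → ℂ := fun t => z + t * (γ (τ z) - z)
    have hcc : Continuous c := by fun_prop
    have hcd : ∀ t ∈ Icc (0 : ℝ) 1, dist (c t) (γ (τ z)) < r (τ z) := by
      intro t ht
      have : c t - γ (τ z) = ((1 - t : ℝ) : ℂ) * (z - γ (τ z)) := by simp only [c]; push_cast; ring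
      rw [dist_eq_norm, this, norm_mul, Complex.norm_real, Real.norm_of_nonneg (by linarith [ht.2]),
        ← dist_eq_norm]
      have := dist_nonneg (x := z) (y := γ (τ z))
      nlinarith [ht.1]
    obtain ⟨t1, ht1, hcU, hc1⟩ : ∃ t1 ∈ Icc (0 : ℝ) 1, (∀ t ∈ Icc 0 t1, c t ∈ Zᶜ) ∧ c t1 ∈ N0 := by
      let A : Set ℝ := Icc 0 1 ∩ c ⁻¹' N0
      have h1A : (1 : ℝ) ∈ A := ⟨⟨zero_le_one, le_rfl⟩, hball _ (hτ0 z) (by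
        have : c 1 = γ (τ z) := by simp [c]
        rw [this]; exact mem_ball_self (hs0' _ (hτ0 z)))⟩
      have hAb : BddBelow A := ⟨0, fun t ht => ht.1.1⟩
      have ht0 : 0 ≤ sInf A := le_csInf ⟨1, h1A⟩ fun t ht => ht.1.1
      have ht0' : sInf A ≤ 1 := csInf_le hAb h1A
      have hlt : ∀ t ∈ Icc 0 1, t < sInf A → c t ∈ N0ᶜ := fun t ht h1 h2 =>
        not_lt.2 (csInf_le hAb ⟨ht, h2⟩) h1
      by_cases hmem : c (sInf A) ∈ N0
      · by_cases h0 : sInf A = 0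
        · refine ⟨0, ⟨le_rfl, zero_le_one⟩, fun t ht => ?_, by rwa [h0] at hmem⟩
          rw [le_antisymm ht.2 ht.1]
          rw [h0] at hmem
          exact hN0U hmem
        · exfalso
          have hpos : 0 < sInf A := lt_of_le_of_ne ht0 (Ne.symm h0)
          obtain ⟨δ, hδ, hsub⟩ := Metric.isOpen_iff.1 (hN0o.preimage hcc) _ hmem
          refine hlt (max 0 (sInf A - δ / 2)) ⟨le_max_left _ _, max_le zero_le_one (by linarith)⟩
            (max_lt hpos (by linarith)) (hsub ?_)
          rw [mem_ball, Real.dist_eq, abs_lt]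
          rcases max_cases 0 (sInf A - δ / 2) with ⟨h, h'⟩ | ⟨h, h'⟩ <;> rw [h] <;>
            constructor <;> linarith
      · have hpre : IsPreconnected (c '' Icc 0 (sInf A)) := isPreconnected_Icc.image _ hcc.continuousOn
        have hcN : c '' Icc 0 (sInf A) ⊆ N0ᶜ := by
          rintro _ ⟨t, ht, rfl⟩
          rcases ht.2.lt_or_eq with h | h
          · exact hlt t ⟨ht.1, by linarith [ht.2]⟩ h
          · rw [h]; exact hmem
        have hcz : z ∈ c '' Icc 0 (sInf A) := ⟨0, ⟨le_rfl, ht0⟩, by simp [c]⟩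
        have hcU : ∀ t ∈ Icc 0 (sInf A), c t ∈ Zᶜ := by
          intro t ht htZ
          have h1 : z ∈ connectedComponentIn N0ᶜ (c t) :=
            hpre.subset_connectedComponentIn ⟨t, ht, rfl⟩ hcN hcz
          rw [← connectedComponentIn_eq htZ] at h1
          exact hz h1
        obtain ⟨δ, hδ, hsub⟩ := Metric.isOpen_iff.1 (hZc.isOpen_compl.preimage hcc) _
          (hcU (sInf A) ⟨ht0, le_rfl⟩)
        obtain ⟨t1, ht1A, ht1⟩ := exists_lt_of_csInf_lt ⟨1, h1A⟩ (lt_add_of_pos_right (sInf A) hδ)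
        refine ⟨t1, ht1A.1, fun t ht => ?_, ht1A.2⟩
        rcases le_total t (sInf A) with h | h
        · exact hcU t ⟨ht.1, h⟩
        · refine hsub ?_
          rw [mem_ball, Real.dist_eq, abs_lt]
          constructor <;> linarith [ht.2]
    obtain ⟨u, hu, hcu⟩ := mem_iUnion₂.1 hc1
    have hτc : ∀ t ∈ Icc 0 t1, |τ (c t) - τ z| < 1 := fun t ht =>
      hclose _ (hcU t ht) _ (hτ0 z) (hcd t ⟨ht.1, ht.2.trans ht1.2⟩)
    have hτb : ∀ w ∈ ball (γ u) (s' u), |τ w - u| < 1 := fun w hw =>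
      hclose _ (hN0U (hball u hu hw)) _ hu ((mem_ball.1 hw).trans_le (hsr' u))
    have h1 := abs_lt.1 (hτb _ hcu)
    have h2 := abs_lt.1 (hτc t1 ⟨ht1.1, le_rfl⟩)
    refine ⟨c '' Icc 0 t1 ∪ ball (γ u) (s' u), ?_, ?_, Or.inl ⟨0, ⟨le_rfl, ht1.1⟩, by simp [c]⟩, ?_,
      u, hu, by linarith, Or.inr (mem_ball_self (hs0' u hu))⟩
    · rintro w (⟨t, ht, rfl⟩ | hw)
      · exact hcU t ht
      · exact hN0U (hball u hu hw)
    · exact (isPreconnected_Icc.image _ hcc.continuousOn).union (c t1) ⟨t1, ⟨ht1.1, le_rfl⟩, rfl⟩ hcu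
        (convex_ball _ _).isPreconnected
    · rintro w (⟨t, ht, rfl⟩ | hw)
      · have := abs_lt.1 (hτc t ht); linarith
      · have := abs_lt.1 (hτb w hw); linarith
  refine ⟨Zᶜ, τ, hZc.isOpen_compl, fun z hz => (hUN1 hz).1, ?_, by rwa [compl_compl],
    hτc.mono fun z hz => (hUN1 hz).1, hτ0, fun u hu => ⟨hγU u hu, hτγ u hu⟩,
    fun z hz => (hUN1 hz).2, hLP⟩
  refine isPreconnected_of_forall (γ 0) fun z hz => ?_
  obtain ⟨S, hSU, hSp, hzS, -, u, hu, -, huS⟩ := hLP z hz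
  refine ⟨S ∪ γ '' Ici 0, union_subset hSU ?_, Or.inr ⟨0, self_mem_Ici, rfl⟩, Or.inl hzS,
    hSp.union (γ u) huS ⟨u, hu, rfl⟩ (isPreconnected_Ici.image _ hγ.continuousOn)⟩
  rintro _ ⟨v, hv, rfl⟩
  exact hγU v hv

open MeasureTheory in
/-- The length of the part of the curve `θ ↦ Φ (x + i θ)` parametrised by `D`. -/
noncomputable def fiberLength (D : Set ℂ) (Φ : ℂ → ℂ) (x : ℝ) : ENNReal :=
  ∫⁻ θ : ℝ, D.indicator (fun s => ‖deriv Φ s‖ₑ) (x + θ * Complex.I)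

open MeasureTheory in
/-- The energy of the part of the curve `θ ↦ Φ (x + i θ)` parametrised by `D`. -/
noncomputable def fiberEnergy (D : Set ℂ) (Φ : ℂ → ℂ) (x : ℝ) : ENNReal :=
  ∫⁻ θ : ℝ, D.indicator (fun s => ‖deriv Φ s‖ₑ ^ 2) (x + θ * Complex.I)

open MeasureTheory in
theorem measurable_fiberEnergy {D : Set ℂ} (hD : IsOpen D) (Φ : ℂ → ℂ) :
    Measurable (fiberEnergy D Φ) := by
  have h1 : Measurable (D.indicator (fun s => ‖deriv Φ s‖ₑ ^ 2)) :=
    ((measurable_deriv Φ).enorm.pow_const 2).indicator hD.measurableSet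
  exact Measurable.lintegral_prod_right' (f := fun p : ℝ × ℝ =>
    D.indicator (fun s => ‖deriv Φ s‖ₑ ^ 2) (p.1 + p.2 * Complex.I)) (h1.comp (by fun_prop))

open MeasureTheory in
theorem lintegral_fiberEnergy {D : Set ℂ} (hD : IsOpen D) {Φ : ℂ → ℂ} (hΦ : DifferentiableOn ℂ Φ D)
    (hinj : InjOn Φ D) : ∫⁻ x, fiberEnergy D Φ x = volume (Φ '' D) := by
  have h1 : Measurable (D.indicator (fun s => ‖deriv Φ s‖ₑ ^ 2)) :=
    ((measurable_deriv Φ).enorm.pow_const 2).indicator hD.measurableSet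
  have h2 := lintegral_image_eq_lintegral_abs_det_fderiv_mul volume hD.measurableSet (fun x hx =>
    ((hΦ.differentiableAt (hD.mem_nhds hx)).hasDerivAt.hasFDerivAt.restrictScalars
      ℝ).hasFDerivWithinAt) hinj fun _ => 1
  simp only [lintegral_one, Measure.restrict_apply_univ, mul_one] at h2
  have h3 : ∀ s, ENNReal.ofReal |((ContinuousLinearMap.toSpanSingleton ℂ (deriv Φ s)).restrictScalars
      ℝ).det| = ‖deriv Φ s‖ₑ ^ 2 := by
    intro s
    rw [← ofReal_norm, ← ENNReal.ofReal_pow (norm_nonneg _)]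
    congr 1
    simp [ContinuousLinearMap.det, LinearMap.det_restrictScalars, Algebra.norm_complex_eq,
      Complex.normSq_eq_norm_sq]
  rw [h2, ← lintegral_indicator hD.measurableSet]
  simp only [h3]
  have e := Complex.volume_preserving_equiv_real_prod.symm.lintegral_comp_emb
    Complex.measurableEquivRealProd.symm.measurableEmbedding
    (D.indicator (fun s => ‖deriv Φ s‖ₑ ^ 2))
  have e2 : ∀ p : ℝ × ℝ, Complex.measurableEquivRealProd.symm p = p.1 + p.2 * Complex.I := fun p => by
    apply Complex.ext <;> simp
  simp only [e2] at e
  rw [← e, Measure.volume_eq_prod, lintegral_prod]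
  · rfl
  · exact (h1.comp (by fun_prop)).aemeasurable

open MeasureTheory in
theorem fiberLength_le {D : Set ℂ} (hD : IsOpen D) (Φ : ℂ → ℂ) (x : ℝ) {δ : ℝ} (hδ : 0 < δ) :
    fiberLength D Φ x ≤ ENNReal.ofReal δ * volume {θ : ℝ | (x + θ * Complex.I : ℂ) ∈ D} +
      (ENNReal.ofReal δ)⁻¹ * fiberEnergy D Φ x := by
  have hδ' : ENNReal.ofReal δ ≠ 0 := by simpa using hδ
  have hm : MeasurableSet {θ : ℝ | (x + θ * Complex.I : ℂ) ∈ D} :=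
    (hD.preimage (by fun_prop)).measurableSet
  have h1 : Measurable (D.indicator (fun s => ‖deriv Φ s‖ₑ ^ 2)) :=
    ((measurable_deriv Φ).enorm.pow_const 2).indicator hD.measurableSet
  have h2 : Measurable fun θ : ℝ => D.indicator (fun s => ‖deriv Φ s‖ₑ ^ 2) (x + θ * Complex.I) :=
    h1.comp (by fun_prop)
  unfold fiberLength fiberEnergy
  rw [← lintegral_const_mul _ h2, ← lintegral_indicator_const hm,
    ← lintegral_add_left (measurable_const.indicator hm)]
  refine lintegral_mono fun θ => ?_
  by_cases h : (x + θ * Complex.I : ℂ) ∈ D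
  · simp only [indicator_of_mem h]
    rw [indicator_of_mem (show θ ∈ {θ : ℝ | (x + θ * Complex.I : ℂ) ∈ D} from h)]
    rcases le_total ‖deriv Φ (x + θ * Complex.I)‖ₑ (ENNReal.ofReal δ) with h' | h'
    · exact h'.trans le_self_add
    · refine le_trans ?_ le_add_self
      rw [sq, ← mul_assoc]
      refine le_mul_of_one_le_left zero_le ?_
      rw [← ENNReal.inv_mul_cancel hδ' ENNReal.ofReal_ne_top]
      gcongr
  · simp [indicator_of_notMem h]

open MeasureTheory in
theorem volume_fiber_le {D : Set ℂ} (hs : ∀ s ∈ D, |s.im| < Real.pi / 2) (x : ℝ) :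
    volume {θ : ℝ | (x + θ * Complex.I : ℂ) ∈ D} ≤ ENNReal.ofReal Real.pi := by
  have : {θ : ℝ | (x + θ * Complex.I : ℂ) ∈ D} ⊆ Ioo (-(Real.pi / 2)) (Real.pi / 2) := by
    intro θ hθ
    have := hs _ hθ
    simp at this
    exact abs_lt.1 this
  refine (measure_mono this).trans ?_
  rw [Real.volume_Ioo]
  exact le_of_eq (by congr 1; ring)

open MeasureTheory in
theorem not_eventually_le_fiberLength {D : Set ℂ} (hD : IsOpen D) {Φ : ℂ → ℂ}
    (hΦ : DifferentiableOn ℂ Φ D) (hinj : InjOn Φ D) (hs : ∀ s ∈ D, |s.im| < Real.pi / 2)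
    (hvol : volume (Φ '' D) ≠ ⊤) {c : ℝ} (hc : 0 < c) :
    ¬ ∀ᶠ x in atTop, ENNReal.ofReal c ≤ fiberLength D Φ x := by
  intro h
  obtain ⟨x₀, hx₀⟩ := eventually_atTop.1 h
  let δ := c / (2 * Real.pi)
  have hδ : 0 < δ := div_pos hc (by positivity)
  have h1 : ∀ x, x₀ ≤ x → ENNReal.ofReal δ * ENNReal.ofReal (c / 2) ≤ fiberEnergy D Φ x := by
    intro x hx
    have h2 := (hx₀ x hx).trans (fiberLength_le hD Φ x hδ)
    have h3 : ENNReal.ofReal δ * volume {θ : ℝ | (x + θ * Complex.I : ℂ) ∈ D} ≤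
        ENNReal.ofReal (c / 2) := by
      refine (mul_le_mul_right (volume_fiber_le hs x) _).trans ?_
      rw [← ENNReal.ofReal_mul hδ.le]
      refine ENNReal.ofReal_le_ofReal (le_of_eq ?_)
      simp only [δ]
      field_simp
    have h4 : ENNReal.ofReal c = ENNReal.ofReal (c / 2) + ENNReal.ofReal (c / 2) := by
      rw [← ENNReal.ofReal_add (by positivity) (by positivity)]; congr 1; ring
    rw [h4] at h2
    have h5 := (ENNReal.add_le_add_iff_left ENNReal.ofReal_ne_top).1
      (h2.trans (add_le_add_left h3 _))
    calc _ ≤ ENNReal.ofReal δ * ((ENNReal.ofReal δ)⁻¹ * fiberEnergy D Φ x) := by gcongr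
      _ = fiberEnergy D Φ x := by
        rw [← mul_assoc, ENNReal.mul_inv_cancel (by simpa using hδ) ENNReal.ofReal_ne_top, one_mul]
  have h2 : ∫⁻ x in Ici x₀, ENNReal.ofReal δ * ENNReal.ofReal (c / 2) ≤ ∫⁻ x, fiberEnergy D Φ x :=
    (setLIntegral_mono' measurableSet_Ici fun x hx => h1 x hx).trans (setLIntegral_le_lintegral _ _)
  rw [lintegral_fiberEnergy hD hΦ hinj, setLIntegral_const, Real.volume_Ici, ENNReal.mul_top] at h2
  · exact hvol (top_le_iff.1 h2)
  · exact mul_ne_zero (by simpa using hδ) (by simpa using hc)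

open MeasureTheory in
theorem ae_not_eventually_le_fiberLength {D : ℕ → Set ℂ} (hD : ∀ k, IsOpen (D k)) {Φ : ℂ → ℂ}
    (hΦ : ∀ k, DifferentiableOn ℂ Φ (D k)) (hinj : ∀ k, InjOn Φ (D k))
    (hs : ∀ k, ∀ s ∈ D k, |s.im| < Real.pi / 2) (hdisj : Pairwise fun i j => Disjoint (D i) (D j))
    {m : ℕ → ℝ} (hm : ∀ k, 0 < m k) {p : ℕ → ℂ} (hp : ∀ k, Φ '' D k ⊆ ball (p k) (m k)) :
    ∀ᵐ x, ¬ ∀ᶠ k in atTop, ENNReal.ofReal (m k / 4) ≤ fiberLength (D k) Φ x := by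
  let w : ℕ → ℝ := fun k => 1 / ((k + 1) * m k)
  have hw : ∀ k, 0 < w k := fun k => by have := hm k; positivity
  have hfin : ∫⁻ x, ∑' k, ENNReal.ofReal (w k) ^ 2 * fiberEnergy (D k) Φ x ≠ ⊤ := by
    rw [lintegral_tsum fun k => ((measurable_fiberEnergy (hD k) Φ).const_mul _).aemeasurable]
    simp only [lintegral_const_mul _ (measurable_fiberEnergy (hD _) Φ),
      lintegral_fiberEnergy (hD _) (hΦ _) (hinj _)]
    have hs2 : Summable fun k : ℕ => (1 / ((k : ℝ) + 1) ^ 2) * Real.pi := by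
      refine Summable.mul_right _ ?_
      have := (summable_nat_add_iff 1).2 (Real.summable_one_div_nat_pow.2 one_lt_two)
      simpa using this
    refine ne_top_of_le_ne_top hs2.tsum_ofReal_ne_top (ENNReal.tsum_le_tsum fun k => ?_)
    refine (mul_le_mul_right (measure_mono (hp k)) _).trans ?_
    rw [Complex.volume_ball, ← ENNReal.ofReal_coe_nnreal, ← ENNReal.ofReal_pow (hw k).le,
      ← ENNReal.ofReal_pow (hm k).le, ← ENNReal.ofReal_mul (by have := hm k; positivity),
      ← ENNReal.ofReal_mul (by have := hw k; positivity)]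
    refine ENNReal.ofReal_le_ofReal (le_of_eq ?_)
    have := (hm k).ne'
    simp only [w, NNReal.coe_real_pi]
    field_simp
  filter_upwards [ae_lt_top (Measurable.tsum fun k =>
    (measurable_fiberEnergy (hD k) Φ).const_mul _) hfin] with x hx hcon
  have hΘ : ∑' k, volume {θ : ℝ | (x + θ * Complex.I : ℂ) ∈ D k} ≤ ENNReal.ofReal Real.pi := by
    rw [← measure_iUnion]
    · refine le_trans (measure_mono ?_) (volume_fiber_le (D := ⋃ k, D k) ?_ x)
      · intro θ hθ
        obtain ⟨k, hk⟩ := mem_iUnion.1 hθ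
        exact mem_iUnion.2 ⟨k, hk⟩
      · intro s hs'
        obtain ⟨k, hk⟩ := mem_iUnion.1 hs'
        exact hs k s hk
    · intro i j hij
      rw [Function.onFun, disjoint_left]
      exact fun θ h1 h2 => disjoint_left.1 (hdisj hij) h1 h2
    · exact fun k => ((hD k).preimage (by fun_prop)).measurableSet
  have hsum : ∑' k, (volume {θ : ℝ | (x + θ * Complex.I : ℂ) ∈ D k} +
      ENNReal.ofReal (w k) ^ 2 * fiberEnergy (D k) Φ x) ≠ ⊤ := by
    rw [ENNReal.tsum_add]
    exact ENNReal.add_ne_top.2 ⟨ne_top_of_le_ne_top ENNReal.ofReal_ne_top hΘ, hx.ne⟩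
  have hsum' := ENNReal.summable_toReal hsum
  have hle : ∀ᶠ k : ℕ in atTop, ‖1 / (4 * ((k : ℝ) + 1))‖ ≤
      (volume {θ : ℝ | (x + θ * Complex.I : ℂ) ∈ D k} +
        ENNReal.ofReal (w k) ^ 2 * fiberEnergy (D k) Φ x).toReal := by
    filter_upwards [hcon] with k hk
    have hwk : ENNReal.ofReal (w k) ≠ 0 := by simpa using hw k
    have hk2 := hk.trans (fiberLength_le (hD k) Φ x (inv_pos.2 (hw k)))
    have hk3 := mul_le_mul_right hk2 (ENNReal.ofReal (w k))
    rw [mul_add, ENNReal.ofReal_inv_of_pos (hw k), inv_inv, ← mul_assoc, ← mul_assoc,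
      ENNReal.mul_inv_cancel hwk ENNReal.ofReal_ne_top, one_mul, ← sq,
      ← ENNReal.ofReal_mul (hw k).le] at hk3
    have h1 : w k * (m k / 4) = 1 / (4 * ((k : ℝ) + 1)) := by
      have := (hm k).ne'
      simp only [w]
      field_simp
    rw [h1] at hk3
    rw [Real.norm_of_nonneg (by positivity)]
    exact (ENNReal.ofReal_le_iff_le_toReal (ENNReal.ne_top_of_tsum_ne_top hsum k)).1 hk3
  have h2 := Summable.of_norm_bounded_eventually_nat hsum' hle
  have h3 : Summable fun k : ℕ => 1 / ((k : ℝ) + 1) := by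
    refine (h2.mul_left 4).congr fun k => ?_
    field_simp
  refine Real.not_summable_one_div_natCast ((summable_nat_add_iff 1).1 ?_)
  simpa using h3

/-- A thin tube `U` around the ray `γ`, with parameter function `τ`, radius function `r` and
chord lengths `m`. -/
structure IsTube (U : Set ℂ) (τ : ℂ → ℝ) (γ : ℝ → ℂ) (r : ℝ → ℝ) (m : ℕ → ℝ) : Prop where
  isOpen : IsOpen U
  isBounded : Bornology.IsBounded U
  isPreconnected : IsPreconnected U
  isPreconnected_compl : IsPreconnected Uᶜ
  continuousOn : ContinuousOn τ U
  nonneg : ∀ z, 0 ≤ τ z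
  continuous_curve : Continuous γ
  curve_mem : ∀ u, 0 ≤ u → γ u ∈ U
  apply_curve : ∀ u, 0 ≤ u → τ (γ u) = u
  dist_lt : ∀ z ∈ U, dist z (γ (τ z)) < r (τ z)
  exists_preconnected : ∀ z ∈ U, ∃ S ⊆ U, IsPreconnected S ∧ z ∈ S ∧ (∀ s ∈ S, τ s < τ z + 3) ∧
    ∃ u, 0 ≤ u ∧ u < τ z + 2 ∧ γ u ∈ S
  pos : ∀ k, 0 < m k
  dist_eq : ∀ k : ℕ, dist (γ (k + 1)) (γ k) = m k
  le_left : ∀ k : ℕ, r k ≤ m k / 4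
  le_right : ∀ k : ℕ, r (k + 1) ≤ m k / 4

theorem exists_crossing {U : Set ℂ} {τ : ℂ → ℝ} (hτ : ContinuousOn τ U) {p : ℂ} {m k : ℝ} (hm : 0 < m)
    (h0 : ∀ z ∈ U, τ z = k → dist z p < m / 4) (h1 : ∀ z ∈ U, τ z = k + 1 → m / 2 ≤ dist z p)
    {c : ℝ → ℂ} {a b : ℝ} (hab : a ≤ b) (hc : ContinuousOn c (Icc a b)) (hcU : MapsTo c (Icc a b) U)
    (ha : τ (c a) ≤ k) (hb : k + 1 ≤ τ (c b)) :
    ∃ σ t, a ≤ σ ∧ σ < t ∧ t ≤ b ∧ m / 4 ≤ dist (c σ) (c t) ∧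
      ∀ s ∈ Ioo σ t, k < τ (c s) ∧ τ (c s) < k + 1 ∧ dist (c s) p < m / 2 := by
  have hτc : ContinuousOn (fun s => τ (c s)) (Icc a b) := hτ.comp hc hcU
  have hd : ContinuousOn (fun s => dist (c s) p) (Icc a b) :=
    continuous_dist.comp_continuousOn (hc.prodMk continuousOn_const)
  let A : Set ℝ := Icc a b ∩ (fun s => τ (c s)) ⁻¹' Iic k
  let B : Set ℝ := (Icc a b ∩ (fun s => τ (c s)) ⁻¹' Ici (k + 1)) ∪
    ((Icc a b ∩ (fun s => τ (c s)) ⁻¹' Ici k) ∩ (Icc a b ∩ (fun s => dist (c s) p) ⁻¹' Ici (m / 2)))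
  have hAc : IsClosed A := hτc.preimage_isClosed_of_isClosed isClosed_Icc isClosed_Iic
  have hBc : IsClosed B := (hτc.preimage_isClosed_of_isClosed isClosed_Icc isClosed_Ici).union
    ((hτc.preimage_isClosed_of_isClosed isClosed_Icc isClosed_Ici).inter
      (hd.preimage_isClosed_of_isClosed isClosed_Icc isClosed_Ici))
  have hBI : B ⊆ Icc a b := by
    rintro s (h | h)
    · exact h.1
    · exact h.1.1
  have hBn : B.Nonempty := ⟨b, Or.inl ⟨⟨hab, le_rfl⟩, hb⟩⟩
  have hBb : BddBelow B := ⟨a, fun s hs => (hBI hs).1⟩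
  obtain ⟨t, htdef⟩ : ∃ t, t = sInf B := ⟨_, rfl⟩
  have htB : t ∈ B := htdef ▸ hBc.csInf_mem hBn hBb
  have htI := hBI htB
  have hA'c : IsClosed (A ∩ Iic t) := hAc.inter isClosed_Iic
  have hA'n : (A ∩ Iic t).Nonempty := ⟨a, ⟨⟨le_rfl, hab⟩, ha⟩, htI.1⟩
  have hA'b : BddAbove (A ∩ Iic t) := ⟨t, fun s hs => hs.2⟩
  obtain ⟨σ, hσdef⟩ : ∃ σ, σ = sSup (A ∩ Iic t) := ⟨_, rfl⟩
  have hσA : σ ∈ A ∩ Iic t := hσdef ▸ hA'c.csSup_mem hA'n hA'b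
  have hσI := hσA.1.1
  have hσk : τ (c σ) ≤ k := hσA.1.2
  have hne : σ ≠ t := by
    intro h
    rw [← h] at htB
    rcases htB with h | ⟨h, h'⟩
    · have : k + 1 ≤ τ (c σ) := h.2
      linarith
    · have h2 : k ≤ τ (c σ) := h.2
      have h3 := h0 _ (hcU hσI) (le_antisymm hσk h2)
      have h4 : m / 2 ≤ dist (c σ) p := h'.2
      linarith
  have hlt : σ < t := lt_of_le_of_ne hσA.2 hne
  have hIoo : ∀ s ∈ Ioo σ t, k < τ (c s) ∧ τ (c s) < k + 1 ∧ dist (c s) p < m / 2 := by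
    intro s hs
    have hsI : s ∈ Icc a b := ⟨hσI.1.trans hs.1.le, hs.2.le.trans htI.2⟩
    have h2 : k < τ (c s) := by
      by_contra! h
      have : s ≤ σ := by rw [hσdef]; exact le_csSup hA'b ⟨⟨hsI, h⟩, hs.2.le⟩
      linarith [hs.1]
    have h3 : s ∉ B := fun h => by
      have : t ≤ s := by rw [htdef]; exact csInf_le hBb h
      linarith [hs.2]
    refine ⟨h2, ?_, ?_⟩
    · by_contra! h
      exact h3 (Or.inl ⟨hsI, h⟩)
    · by_contra! h
      exact h3 (Or.inr ⟨⟨hsI, h2.le⟩, hsI, h⟩)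
  have hsubI : Icc σ t ⊆ Icc a b := Icc_subset_Icc hσI.1 htI.2
  have hclos : closure (Ioo σ t) = Icc σ t := closure_Ioo hlt.ne
  have hσk' : k ≤ τ (c σ) := by
    have h2 : ContinuousWithinAt (fun s => τ (c s)) (Ioo σ t) σ :=
      (hτc σ hσI).mono (Ioo_subset_Icc_self.trans hsubI)
    have : (𝓝[Ioo σ t] σ).NeBot := mem_closure_iff_nhdsWithin_neBot.1 (hclos ▸ ⟨le_rfl, hlt.le⟩)
    exact ge_of_tendsto h2 (eventually_nhdsWithin_of_forall fun s hs => (hIoo s hs).1.le)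
  have htk : τ (c t) ≤ k + 1 := by
    have h2 : ContinuousWithinAt (fun s => τ (c s)) (Ioo σ t) t :=
      (hτc t htI).mono (Ioo_subset_Icc_self.trans hsubI)
    have : (𝓝[Ioo σ t] t).NeBot := mem_closure_iff_nhdsWithin_neBot.1 (hclos ▸ ⟨hlt.le, le_rfl⟩)
    exact le_of_tendsto h2 (eventually_nhdsWithin_of_forall fun s hs => (hIoo s hs).2.1.le)
  have htp : m / 2 ≤ dist (c t) p := by
    rcases htB with h | ⟨-, h⟩
    · exact h1 _ (hcU htI) (le_antisymm htk h.2)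
    · exact h.2
  have hσp := h0 _ (hcU hσI) (le_antisymm hσk hσk')
  refine ⟨σ, t, hσI.1, hlt, htI.2, ?_, hIoo⟩
  have := dist_triangle (c t) (c σ) p
  rw [dist_comm (c t) (c σ)] at this
  linarith

open MeasureTheory in
theorem dist_le_fiberLength {Φ : ℂ → ℂ} {S D : Set ℂ} (hS : IsOpen S) (hΦ : DifferentiableOn ℂ Φ S)
    {x σ t : ℝ} (hσt : σ ≤ t) (hsub : ∀ s ∈ Icc σ t, (x + s * Complex.I : ℂ) ∈ S)
    (hD : ∀ s ∈ Ioo σ t, (x + s * Complex.I : ℂ) ∈ D) :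
    ENNReal.ofReal (dist (Φ (x + σ * Complex.I)) (Φ (x + t * Complex.I))) ≤ fiberLength D Φ x := by
  have hder : ∀ s ∈ uIcc σ t, HasDerivAt (fun s : ℝ => Φ (x + s * Complex.I))
      (deriv Φ (x + s * Complex.I) * Complex.I) s := by
    intro s hs
    rw [uIcc_of_le hσt] at hs
    have h1 : HasDerivAt (fun s : ℝ => (x + s * Complex.I : ℂ)) Complex.I s := by
      simpa using (((hasDerivAt_id s).ofReal_comp.mul_const Complex.I).const_add (x : ℂ))
    exact (hΦ.differentiableAt (hS.mem_nhds (hsub s hs))).hasDerivAt.comp s h1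
  have hcont : ContinuousOn (fun s : ℝ => deriv Φ (x + s * Complex.I) * Complex.I) (uIcc σ t) := by
    rw [uIcc_of_le hσt]
    refine ContinuousOn.mul ?_ continuousOn_const
    exact (hΦ.deriv hS).continuousOn.comp (by fun_prop) hsub
  have h1 := intervalIntegral.integral_eq_sub_of_hasDerivAt hder hcont.intervalIntegrable
  rw [intervalIntegral.integral_of_le hσt] at h1
  have h2 : ENNReal.ofReal (dist (Φ (x + σ * Complex.I)) (Φ (x + t * Complex.I))) =
      ‖∫ s in Ioc σ t, deriv Φ (x + s * Complex.I) * Complex.I‖ₑ := by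
    rw [h1, dist_comm, dist_eq_norm, ofReal_norm]
  rw [h2]
  refine (enorm_integral_le_lintegral_enorm _).trans ?_
  rw [← setLIntegral_congr Ioo_ae_eq_Ioc]
  refine le_trans (setLIntegral_mono' measurableSet_Ioo fun s hs => ?_) (setLIntegral_le_lintegral _ _)
  rw [indicator_of_mem (hD s hs)]
  rw [enorm_mul, ← ofReal_norm (x := Complex.I), Complex.norm_I]
  simp

namespace IsTube

variable {U : Set ℂ} {τ : ℂ → ℝ} {γ : ℝ → ℂ} {r : ℝ → ℝ} {m : ℕ → ℝ}

theorem dist_lt_of_eq (h : IsTube U τ γ r m) {k : ℕ} {z : ℂ} (hz : z ∈ U) (hk : τ z = k) :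
    dist z (γ k) < m k / 4 := by
  have := h.dist_lt z hz
  rw [hk] at this
  exact this.trans_le (h.le_left k)

theorem le_dist_of_eq (h : IsTube U τ γ r m) {k : ℕ} {z : ℂ} (hz : z ∈ U) (hk : τ z = k + 1) :
    m k / 2 ≤ dist z (γ k) := by
  have h1 := h.dist_lt z hz
  rw [hk] at h1
  have h2 := h.le_right k
  have h3 := h.dist_eq k
  have h4 := dist_triangle_left (γ (k + 1)) (γ k) z
  have := h.pos k
  linarith

/-- The part of the strip that `φ ∘ exp` maps to the `k`-th cell of the tube. -/
def cell (U : Set ℂ) (τ : ℂ → ℝ) (γ : ℝ → ℂ) (m : ℕ → ℝ) (φ : ℂ → ℂ) (k : ℕ) : Set ℂ :=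
  {s | |s.im| < Real.pi / 2 ∧ φ (Complex.exp s) ∈
    {z | z ∈ U ∧ k < τ z ∧ τ z < k + 1 ∧ dist z (γ k) < m k / 2}}

theorem exp_mem_halfPlane {s : ℂ} (hs : |s.im| < Real.pi / 2) : 0 < (Complex.exp s).re := by
  rw [Complex.exp_re]
  exact mul_pos (Real.exp_pos _) (Real.cos_pos_of_mem_Ioo (abs_lt.1 hs))

theorem isOpen_strip : IsOpen {s : ℂ | |s.im| < Real.pi / 2} :=
  isOpen_lt (by fun_prop) continuous_const

theorem differentiableOn_comp_exp {φ : ℂ → ℂ} (hφ : DifferentiableOn ℂ φ {z | 0 < z.re}) :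
    DifferentiableOn ℂ (fun s => φ (Complex.exp s)) {s : ℂ | |s.im| < Real.pi / 2} :=
  hφ.comp Complex.differentiable_exp.differentiableOn fun _ hs => exp_mem_halfPlane hs

theorem isOpen_cell (h : IsTube U τ γ r m) {φ : ℂ → ℂ} (hφ : DifferentiableOn ℂ φ {z | 0 < z.re})
    (k : ℕ) : IsOpen (cell U τ γ m φ k) := by
  have h1 : IsOpen {z | z ∈ U ∧ k < τ z ∧ τ z < k + 1 ∧ dist z (γ k) < m k / 2} := by
    have h2 := (h.continuousOn.isOpen_inter_preimage h.isOpen (isOpen_Ioo (a := (k : ℝ))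
      (b := k + 1))).inter (isOpen_ball (x := γ k) (ε := m k / 2))
    convert h2 using 1
    ext z
    simp [and_assoc]
    tauto
  exact (differentiableOn_comp_exp hφ).continuousOn.isOpen_inter_preimage isOpen_strip h1

theorem injOn_comp_exp {φ : ℂ → ℂ} (hinj : InjOn φ {z | 0 < z.re}) :
    InjOn (fun s => φ (Complex.exp s)) {s : ℂ | |s.im| < Real.pi / 2} := by
  intro s hs t ht hst
  have h1 := hinj (exp_mem_halfPlane hs) (exp_mem_halfPlane ht) hst
  have hs' := abs_lt.1 (show |s.im| < Real.pi / 2 from hs)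
  have ht' := abs_lt.1 (show |t.im| < Real.pi / 2 from ht)
  have := Real.pi_pos
  exact Complex.exp_inj_of_neg_pi_lt_of_le_pi (by linarith) (by linarith) (by linarith) (by linarith) h1

theorem le_fiberLength (h : IsTube U τ γ r m) {φ : ℂ → ℂ} (hφ : DifferentiableOn ℂ φ {z | 0 < z.re})
    (hmaps : MapsTo φ {z | 0 < z.re} U) {k : ℕ} {x : ℝ} {ζ₁ ζ₂ : ℂ} (h1 : 0 < ζ₁.re) (h2 : 0 < ζ₂.re)
    (hn1 : ‖ζ₁‖ = Real.exp x) (hn2 : ‖ζ₂‖ = Real.exp x) (hk1 : τ (φ ζ₁) ≤ k)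
    (hk2 : k + 1 ≤ τ (φ ζ₂)) :
    ENNReal.ofReal (m k / 4) ≤ fiberLength (cell U τ γ m φ k) (fun s => φ (Complex.exp s)) x := by
  have hlog : ∀ ζ : ℂ, 0 < ζ.re → ‖ζ‖ = Real.exp x → |ζ.arg| < Real.pi / 2 ∧
      Complex.exp (x + ζ.arg * Complex.I) = ζ := by
    intro ζ hζ hn
    refine ⟨Complex.abs_arg_lt_pi_div_two_iff.2 (Or.inl hζ), ?_⟩
    have h3 : (x + ζ.arg * Complex.I : ℂ) = Complex.log ζ := by
      rw [Complex.log, hn, Real.log_exp]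
    rw [h3, Complex.exp_log]
    rintro rfl
    simp at hζ
  obtain ⟨ha1, he1⟩ := hlog ζ₁ h1 hn1
  obtain ⟨ha2, he2⟩ := hlog ζ₂ h2 hn2
  let f : ℝ → ℂ := fun θ => φ (Complex.exp (x + θ * Complex.I))
  have hmem : ∀ θ : ℝ, |θ| < Real.pi / 2 →
      (x + θ * Complex.I : ℂ) ∈ {s : ℂ | |s.im| < Real.pi / 2} := fun θ hθ => by simpa using hθ
  have hfc : ContinuousOn f {θ | |θ| < Real.pi / 2} :=
    (differentiableOn_comp_exp hφ).continuousOn.comp (by fun_prop) hmem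
  have hfU : MapsTo f {θ | |θ| < Real.pi / 2} U := fun θ hθ => hmaps (exp_mem_halfPlane (hmem θ hθ))
  have hI : ∀ a b : ℝ, |a| < Real.pi / 2 → |b| < Real.pi / 2 → Icc a b ⊆ {θ | |θ| < Real.pi / 2} :=
    fun a b ha hb θ hθ => abs_lt.2 ⟨(abs_lt.1 ha).1.trans_le hθ.1, hθ.2.trans_lt (abs_lt.1 hb).2⟩
  suffices H : ∃ σ t, σ ≤ t ∧ Icc σ t ⊆ {θ | |θ| < Real.pi / 2} ∧ m k / 4 ≤ dist (f σ) (f t) ∧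
      ∀ s ∈ Ioo σ t, k < τ (f s) ∧ τ (f s) < k + 1 ∧ dist (f s) (γ k) < m k / 2 by
    obtain ⟨σ, t, hσt, hsub, hd, hs⟩ := H
    refine (ENNReal.ofReal_le_ofReal hd).trans ?_
    exact dist_le_fiberLength isOpen_strip (differentiableOn_comp_exp hφ) hσt
      (fun s hs => hmem s (hsub hs)) fun s hs' =>
        ⟨hmem s (hsub (Ioo_subset_Icc_self hs')), hfU (hsub (Ioo_subset_Icc_self hs')), hs s hs'⟩
  rcases le_total ζ₁.arg ζ₂.arg with hle | hle
  · obtain ⟨σ, t, h3, h4, h5, h6, h7⟩ := exists_crossing h.continuousOn (h.pos k)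
      (fun z hz => h.dist_lt_of_eq hz) (fun z hz => h.le_dist_of_eq hz) hle (hfc.mono (hI _ _ ha1 ha2))
      (hfU.mono_left (hI _ _ ha1 ha2)) (by simpa only [f, he1] using hk1)
      (by simpa only [f, he2] using hk2)
    exact ⟨σ, t, h4.le, (Icc_subset_Icc h3 h5).trans (hI _ _ ha1 ha2), h6, h7⟩
  · have hneg : MapsTo (fun θ : ℝ => -θ) (Icc (-ζ₁.arg) (-ζ₂.arg)) (Icc ζ₂.arg ζ₁.arg) :=
      fun θ hθ => ⟨by linarith [hθ.2], by linarith [hθ.1]⟩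
    obtain ⟨σ, t, h3, h4, h5, h6, h7⟩ := exists_crossing (c := fun θ => f (-θ)) h.continuousOn (h.pos k)
      (fun z hz => h.dist_lt_of_eq hz) (fun z hz => h.le_dist_of_eq hz) (neg_le_neg hle)
      (hfc.comp continuous_neg.continuousOn fun θ hθ => hI _ _ ha2 ha1 (hneg hθ))
      (fun θ hθ => hfU (hI _ _ ha2 ha1 (hneg hθ))) (by simpa only [f, he1, neg_neg] using hk1)
      (by simpa only [f, he2, neg_neg] using hk2)
    refine ⟨-t, -σ, by linarith, (Icc_subset_Icc (by linarith) (by linarith)).trans (hI _ _ ha2 ha1),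
      by rwa [dist_comm], fun s hs => ?_⟩
    have := h7 (-s) ⟨by linarith [hs.2], by linarith [hs.1]⟩
    simpa only [neg_neg] using this

end IsTube

/-- `φ` maps the right half-plane biholomorphically onto `U`, with inverse `ψ`. -/
structure IsUniformization (φ ψ : ℂ → ℂ) (U : Set ℂ) : Prop where
  differentiableOn : DifferentiableOn ℂ φ {z | 0 < z.re}
  mapsTo : MapsTo φ {z | 0 < z.re} U
  differentiableOn_inv : DifferentiableOn ℂ ψ U
  mapsTo_inv : MapsTo ψ U {z | 0 < z.re}
  left_inv : ∀ ζ : ℂ, 0 < ζ.re → ψ (φ ζ) = ζ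
  right_inv : ∀ z ∈ U, φ (ψ z) = z

namespace IsTube

variable {U : Set ℂ} {τ : ℂ → ℝ} {γ : ℝ → ℂ} {r : ℝ → ℝ} {m : ℕ → ℝ} {φ ψ : ℂ → ℂ}

theorem continuousOn_lift (h : IsTube U τ γ r m) (H : IsUniformization φ ψ U) :
    ContinuousOn (fun u => ψ (γ u)) (Ici 0) :=
  H.differentiableOn_inv.continuousOn.comp h.continuous_curve.continuousOn h.curve_mem

theorem exists_norm_lift_le (h : IsTube U τ γ r m) (H : IsUniformization φ ψ U) (T : ℝ) :
    ∃ M : ℝ, ∀ u, 0 ≤ u → u ≤ T → ‖ψ (γ u)‖ ≤ M := by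
  obtain ⟨M, hM⟩ := (isCompact_Icc (a := (0 : ℝ)) (b := T)).exists_bound_of_continuousOn
    ((h.continuousOn_lift H).mono Icc_subset_Ici_self)
  exact ⟨M, fun u h0 h1 => hM u ⟨h0, h1⟩⟩

theorem exists_norm_lift_eq (h : IsTube U τ γ r m) (H : IsUniformization φ ψ U)
    (hub : ∀ R : ℝ, ∃ u, 0 ≤ u ∧ R ≤ ‖ψ (γ u)‖) {u₁ R : ℝ} (hu₁ : 0 ≤ u₁) (hR : ‖ψ (γ u₁)‖ ≤ R) :
    ∃ u, u₁ ≤ u ∧ ‖ψ (γ u)‖ = R := by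
  obtain ⟨M, hM⟩ := h.exists_norm_lift_le H u₁
  obtain ⟨u₂, h0, h2⟩ := hub (max R (M + 1))
  have h3 : u₁ ≤ u₂ := by
    by_contra! h4
    linarith [hM u₂ h0 h4.le, le_max_right R (M + 1)]
  obtain ⟨u, hu, hu'⟩ := intermediate_value_Icc h3
    ((h.continuousOn_lift H).norm.mono fun s hs => hu₁.trans hs.1)
    (show R ∈ Icc ‖ψ (γ u₁)‖ ‖ψ (γ u₂)‖ from ⟨hR, (le_max_left _ _).trans h2⟩)
  exact ⟨u, hu.1, hu'⟩

theorem differentiableOn_cell (H : IsUniformization φ ψ U) (k : ℕ) :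
    DifferentiableOn ℂ (fun s => φ (Complex.exp s)) (cell U τ γ m φ k) :=
  (differentiableOn_comp_exp H.differentiableOn).mono fun _ hs => hs.1

theorem injOn_cell (H : IsUniformization φ ψ U) (k : ℕ) :
    InjOn (fun s => φ (Complex.exp s)) (cell U τ γ m φ k) :=
  (injOn_comp_exp (LeftInvOn.injOn (f₁' := ψ) fun _ hs => H.left_inv _ hs)).mono fun _ hs => hs.1

theorem image_cell_subset (h : IsTube U τ γ r m) (k : ℕ) :
    (fun s => φ (Complex.exp s)) '' cell U τ γ m φ k ⊆ ball (γ k) (m k) := by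
  rintro _ ⟨s, hs, rfl⟩
  have := hs.2.2.2.2
  have := h.pos k
  rw [mem_ball]
  linarith

theorem tendsto_norm_lift (h : IsTube U τ γ r m) (H : IsUniformization φ ψ U)
    (hub : ∀ R : ℝ, ∃ u, 0 ≤ u ∧ R ≤ ‖ψ (γ u)‖) : Tendsto (fun u => ‖ψ (γ u)‖) atTop atTop := by
  rw [Filter.tendsto_atTop]
  by_contra! hcon
  obtain ⟨M, hM⟩ := hcon
  have hae := ae_not_eventually_le_fiberLength (fun k => h.isOpen_cell H.differentiableOn k)
    (fun k => differentiableOn_cell H k) (fun k => injOn_cell H k) (fun k s hs => hs.1)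
    (fun i j hij => disjoint_left.2 fun s hi hj => hij ?_) h.pos (fun k => h.image_cell_subset k)
  · obtain ⟨x, hx, hx'⟩ := (MeasureTheory.Measure.dense_of_ae hae).exists_gt (Real.log (max M 1))
    refine hx ?_
    have hMx : M ≤ Real.exp x := by
      have := Real.exp_lt_exp.2 hx'
      rw [Real.exp_log (by positivity)] at this
      exact (le_max_left _ _).trans this.le
    filter_upwards [eventually_ge_atTop ⌈τ (φ (Real.exp x))⌉₊] with k hk
    obtain ⟨u₁, hu₁, hu₁'⟩ := frequently_atTop.1 hM (k + 1)
    have hk0 : (0 : ℝ) ≤ k := k.cast_nonneg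
    obtain ⟨u, hu, hu'⟩ := h.exists_norm_lift_eq H hub (by linarith) (hu₁'.le.trans hMx)
    have huU := h.curve_mem u (by linarith)
    refine h.le_fiberLength H.differentiableOn H.mapsTo (ζ₁ := Real.exp x) (ζ₂ := ψ (γ u))
      ?_ (H.mapsTo_inv huU) ?_ hu' (Nat.ceil_le.1 hk) ?_
    · rw [Complex.ofReal_re]; exact Real.exp_pos x
    · rw [Complex.norm_real, Real.norm_of_nonneg (Real.exp_pos x).le]
    · rw [H.right_inv _ huU, h.apply_curve u (by linarith)]
      linarith
  · have h1 := hi.2.2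
    have h2 := hj.2.2
    have h3 : (i : ℝ) < j + 1 := h1.1.trans h2.2.1
    have h4 : (j : ℝ) < i + 1 := h2.1.trans h1.2.1
    norm_cast at h3 h4
    omega

theorem exists_lt_parameter (h : IsTube U τ γ r m) (H : IsUniformization φ ψ U)
    (hub : ∀ R : ℝ, ∃ u, 0 ≤ u ∧ R ≤ ‖ψ (γ u)‖) (k : ℕ) :
    ∃ R : ℝ, ∀ ζ : ℂ, 0 < ζ.re → R ≤ ‖ζ‖ → k < τ (φ ζ) := by
  by_contra! hcon
  obtain ⟨M, hM⟩ := h.exists_norm_lift_le H (k + 4)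
  have hk0 : (0 : ℝ) ≤ k := k.cast_nonneg
  refine not_eventually_le_fiberLength (h.isOpen_cell H.differentiableOn (k + 3))
    (differentiableOn_cell H _) (injOn_cell H _) (fun s hs => hs.1) (ne_top_of_le_ne_top
      (MeasureTheory.measure_ball_lt_top (x := γ (k + 3 : ℕ)) (r := m (k + 3))).ne
      (MeasureTheory.measure_mono (h.image_cell_subset (k + 3))))
    (div_pos (h.pos (k + 3)) (by norm_num : (0 : ℝ) < 4)) ?_
  filter_upwards [eventually_ge_atTop (Real.log (max M 1))] with x hx
  have hMx : M ≤ Real.exp x := by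
    have := Real.exp_le_exp.2 hx
    rw [Real.exp_log (by positivity)] at this
    exact (le_max_left _ _).trans this
  obtain ⟨ζ, hζ, hζx, hζk⟩ := hcon (Real.exp x)
  obtain ⟨S, hSU, hS, hζS, hSτ, u, hu0, huk, huS⟩ := h.exists_preconnected _ (H.mapsTo hζ)
  have hnS : IsPreconnected ((fun z => ‖ψ z‖) '' S) :=
    hS.image _ (H.differentiableOn_inv.continuousOn.norm.mono hSU)
  obtain ⟨s, hsS, hs⟩ := hnS.Icc_subset (mem_image_of_mem _ huS) (mem_image_of_mem _ hζS)
    (show Real.exp x ∈ Icc ‖ψ (γ u)‖ ‖ψ (φ ζ)‖ from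
      ⟨(hM u hu0 (by linarith)).trans hMx, by rwa [H.left_inv ζ hζ]⟩)
  obtain ⟨v, hv, hv'⟩ := h.exists_norm_lift_eq H hub (u₁ := k + 4) (by linarith)
    ((hM (k + 4) (by linarith) le_rfl).trans hMx)
  have hvU := h.curve_mem v (by linarith)
  refine h.le_fiberLength H.differentiableOn H.mapsTo (H.mapsTo_inv (hSU hsS)) (H.mapsTo_inv hvU)
    hs hv' ?_ ?_
  · rw [H.right_inv _ (hSU hsS)]
    push_cast
    linarith [hSτ s hsS]
  · rw [H.right_inv _ hvU, h.apply_curve v (by linarith)]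
    push_cast
    linarith

end IsTube

theorem exists_pos_le_dist_curve {W : Set ℂ} (hW : IsOpen W) {γ : ℝ → ℂ} (hγ : Continuous γ)
    (hγW : ∀ t, 0 ≤ t → γ t ∈ W) (hinj : InjOn γ (Ici 0))
    (hproper : ∀ C, IsCompact C → C ⊆ W → ∃ T : ℝ, ∀ t, T ≤ t → γ t ∉ C)
    {I : Set ℝ} (hI : IsCompact I) (hI0 : I ⊆ Ici 0) :
    ∃ c, 0 < c ∧ ∀ u ∈ I, ∀ v, 0 ≤ v → 1 ≤ |u - v| → c ≤ dist (γ u) (γ v) := by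
  have hC : IsCompact (γ '' I) := hI.image hγ
  obtain ⟨δ, hδ, hδW⟩ := hC.exists_cthickening_subset_open hW
    (by rintro _ ⟨u, hu, rfl⟩; exact hγW u (hI0 hu))
  obtain ⟨T, hT⟩ := hproper _ (hC.cthickening (r := δ)) hδW
  have hP : IsCompact ((I ×ˢ Icc 0 T) ∩ {p : ℝ × ℝ | 1 ≤ |p.1 - p.2|}) :=
    (hI.prod isCompact_Icc).inter_right (isClosed_le continuous_const (by fun_prop))
  obtain ⟨c, hc, hcP⟩ := hP.exists_forall_le' (f := fun p => dist (γ p.1) (γ p.2)) (a := 0)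
    (by fun_prop) (by
      rintro ⟨u, v⟩ ⟨⟨hu, hv⟩, huv⟩
      refine dist_pos.2 fun h => ?_
      have h1 : u = v := hinj (hI0 hu) hv.1 h
      simp only [mem_ofPred_eq, h1, sub_self, abs_zero] at huv
      linarith)
  refine ⟨min c δ, lt_min hc hδ, fun u hu v hv huv => ?_⟩
  rcases le_total T v with h | h
  · refine (min_le_right _ _).trans ?_
    by_contra! hlt
    exact hT v h (mem_cthickening_of_dist_le _ _ _ _ (mem_image_of_mem γ hu) (dist_comm (γ u) (γ v) ▸ hlt.le))
  · exact (min_le_left _ _).trans (hcP (u, v) ⟨⟨hu, hv, h⟩, huv⟩)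

theorem exists_radius {W : Set ℂ} (hW : IsOpen W) (hWf : (frontier W).Nonempty) {γ : ℝ → ℂ}
    (hγ : Continuous γ) (hγW : ∀ t, 0 ≤ t → γ t ∈ W) (hinj : InjOn γ (Ici 0))
    (hproper : ∀ C, IsCompact C → C ⊆ W → ∃ T : ℝ, ∀ t, T ≤ t → γ t ∉ C)
    {d : ℕ → ℝ} (hd : ∀ k, 0 < d k) :
    ∃ r : ℝ → ℝ, Continuous r ∧ (∀ u, 0 < r u) ∧ (∀ u, 0 ≤ u → r u ≤ infDist (γ u) (frontier W) / 2) ∧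
      (∀ u v, 0 ≤ u → 0 ≤ v → 1 ≤ |u - v| → r u + r v ≤ dist (γ u) (γ v)) ∧ (∀ k : ℕ, r k ≤ d k) ∧
      ∀ u, r u * (|u| + 1) ≤ 1 := by
  let t : ℝ → Set ℝ := fun u => {s | 0 < s ∧ (0 ≤ u → s ≤ infDist (γ u) (frontier W) / 2) ∧
    (∀ v, 0 ≤ u → 0 ≤ v → 1 ≤ |u - v| → s ≤ dist (γ u) (γ v) / 2) ∧ (∀ k : ℕ, u = k → s ≤ d k) ∧
    s * (|u| + 1) ≤ 1}
  have ht : ∀ u, Convex ℝ (t u) := by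
    intro u
    refine OrdConnected.convex ⟨?_⟩
    rintro a ⟨ha, -⟩ b ⟨-, hb1, hb2, hb3, hb4⟩ s ⟨hs1, hs2⟩
    exact ⟨ha.trans_le hs1, fun hu => hs2.trans (hb1 hu), fun v hu hv huv => hs2.trans (hb2 v hu hv huv),
      fun k hk => hs2.trans (hb3 k hk), (mul_le_mul_of_nonneg_right hs2 (by positivity)).trans hb4⟩
  have H : ∀ x : ℝ, ∃ c : ℝ, ∀ᶠ y in 𝓝 x, c ∈ t y := by
    intro x
    have hI : IsCompact (Icc (x - 1) (x + 1) ∩ Ici 0) := isCompact_Icc.inter_right isClosed_Ici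
    obtain ⟨c1, hc1, hc1'⟩ := hI.exists_forall_le' (f := fun u => infDist (γ u) (frontier W)) (a := 0)
      (((continuous_infDist_pt _).comp hγ).continuousOn) (by
        rintro u ⟨-, hu⟩
        refine (isClosed_frontier.notMem_iff_infDist_pos hWf).1 fun h => ?_
        rw [hW.frontier_eq] at h
        exact h.2 (hγW u hu))
    obtain ⟨c2, hc2, hc2'⟩ := exists_pos_le_dist_curve hW hγ hγW hinj hproper hI inter_subset_right
    obtain ⟨k₀, -, hk₀⟩ := Finset.exists_min_image (Finset.range (⌈x + 1⌉₊ + 1)) d ⟨0, by simp⟩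
    refine ⟨min (min (c1 / 2) (c2 / 2)) (min (d k₀) (1 / (|x| + 2))), ?_⟩
    filter_upwards [Icc_mem_nhds (sub_one_lt x) (lt_add_one x)] with u hu
    have h0 : 0 < |x| + 2 := by positivity
    refine ⟨lt_min (lt_min (by linarith) (by linarith)) (lt_min (hd _) (by positivity)),
      fun h => ?_, fun v hu0 hv huv => ?_, fun k hk => ?_, ?_⟩
    · exact (min_le_left _ _).trans ((min_le_left _ _).trans (by linarith [hc1' u ⟨hu, h⟩]))
    · exact (min_le_left _ _).trans ((min_le_right _ _).trans (by linarith [hc2' u ⟨hu, hu0⟩ v hv huv]))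
    · refine (min_le_right _ _).trans ((min_le_left _ _).trans (hk₀ k ?_))
      rw [Finset.mem_range, Nat.lt_succ_iff, ← Nat.cast_le (α := ℝ), ← hk]
      exact hu.2.trans (Nat.le_ceil _)
    · have h1 : |u| + 1 ≤ |x| + 2 := by
        have := abs_sub_abs_le_abs_sub u x
        have : |u - x| ≤ 1 := abs_le.2 ⟨by linarith [hu.1], by linarith [hu.2]⟩
        linarith
      calc _ ≤ 1 / (|x| + 2) * (|x| + 2) := mul_le_mul ((min_le_right _ _).trans (min_le_right _ _)) h1
            (by positivity) (by positivity)
        _ = 1 := by field_simp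
  obtain ⟨r, hr⟩ := exists_continuous_forall_mem_convex_of_local_const ht H
  refine ⟨r, r.continuous, fun u => (hr u).1, fun u => (hr u).2.1, fun u v hu hv huv => ?_,
    fun k => (hr k).2.2.2.1 k rfl, fun u => (hr u).2.2.2.2⟩
  have h1 := (hr u).2.2.1 v hu hv huv
  have h2 := (hr v).2.2.1 u hv hu (by rwa [abs_sub_comm])
  rw [dist_comm] at h2
  linarith

theorem exists_notMem_curve {W : Set ℂ} (hW : IsOpen W) {γ : ℝ → ℂ} (hγ : Continuous γ)
    (hγW : ∀ t, 0 ≤ t → γ t ∈ W) (hinj : InjOn γ (Ici 0))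
    (hproper : ∀ C, IsCompact C → C ⊆ W → ∃ T : ℝ, ∀ t, T ≤ t → γ t ∉ C)
    (p : ℂ) {δ : ℝ} (hδ : 0 < δ) : ∃ a, dist a p < δ ∧ a ∉ γ '' Ici 0 := by
  obtain ⟨τ, hτc, -, hτγ⟩ := exists_continuousOn_parameter hW hγ hγW hinj hproper
  by_contra! hcon
  have hmem : ∀ θ, circleMap p (δ / 2) θ ∈ γ '' Ici 0 := fun θ => hcon _ (by
    rw [dist_eq_norm, circleMap_sub_center, norm_circleMap_zero, abs_of_pos (by positivity)]
    linarith)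
  have hsub : γ '' Ici 0 ⊆ W := by
    rintro _ ⟨u, hu, rfl⟩; exact hγW u hu
  have hc : Continuous fun θ => τ (circleMap p (δ / 2) θ) :=
    hτc.comp_continuous (continuous_circleMap _ _) fun θ => hsub (hmem θ)
  have hper : circleMap p (δ / 2) (Real.pi + Real.pi) = circleMap p (δ / 2) 0 := by
    have := periodic_circleMap p (δ / 2) 0
    rwa [zero_add, two_mul] at this
  obtain ⟨θ, -, hθ⟩ : (0 : ℝ) ∈ (fun θ => τ (circleMap p (δ / 2) (θ + Real.pi)) - τ (circleMap p (δ / 2) θ)) ''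
      uIcc 0 Real.pi := by
    refine intermediate_value_uIcc
      ((hc.comp (continuous_add_const Real.pi)).sub hc).continuousOn ?_
    simp only [Pi.sub_apply, Function.comp_apply, zero_add, hper, mem_uIcc]
    rcases le_total (τ (circleMap p (δ / 2) Real.pi)) (τ (circleMap p (δ / 2) 0)) with h | h
    · left; constructor <;> linarith
    · right; constructor <;> linarith
  obtain ⟨u, hu, hu'⟩ := hmem θ
  obtain ⟨v, hv, hv'⟩ := hmem (θ + Real.pi)
  have h1 : v = u := by
    simp only [← hu', ← hv', hτγ u hu, hτγ v hv] at hθ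
    linarith
  rw [h1, hu'] at hv'
  simp only [circleMap, add_right_inj, mul_eq_mul_left_iff] at hv'
  rcases hv' with h | h
  · rw [Complex.ofReal_add, add_mul, Complex.exp_add, Complex.exp_pi_mul_I] at h
    have := Complex.exp_ne_zero (θ * Complex.I)
    refine this ?_
    linear_combination h / 2
  · have : δ / 2 = 0 := by exact_mod_cast h
    linarith

theorem exists_isTube {W : Set ℂ} (hW : IsOpen W) (hWb : Bornology.IsBounded W)
    (hWf : (frontier W).Nonempty) {γ : ℝ → ℂ}
    (hγ : Continuous γ) (hγW : ∀ t, 0 ≤ t → γ t ∈ W) (hinj : InjOn γ (Ici 0))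
    (hproper : ∀ C, IsCompact C → C ⊆ W → ∃ T : ℝ, ∀ t, T ≤ t → γ t ∉ C)
    {δ : ℕ → ℝ} (hδ : ∀ k, 0 < δ k) :
    ∃ (U : Set ℂ) (τ : ℂ → ℝ) (r : ℝ → ℝ) (a : ℕ → ℂ),
      IsTube U τ γ r (fun k => dist (γ (k + 1)) (γ k)) ∧ U ⊆ W ∧ (∀ k, a k ∉ U) ∧
      (∀ k, dist (a k) (γ k) < δ k) ∧ (∀ k : ℕ, r k ≤ δ k) ∧
      (∀ u, 0 ≤ u → r u ≤ infDist (γ u) (frontier W) / 2) ∧ Tendsto r atTop (𝓝 0) := by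
  let m : ℕ → ℝ := fun k => dist (γ (k + 1)) (γ k)
  have hm : ∀ k, 0 < m k := fun k => dist_pos.2 fun h => by
    have := hinj (show (0 : ℝ) ≤ k + 1 by positivity) (show (0 : ℝ) ≤ k by positivity) h
    linarith
  obtain ⟨r, hrc, hr0, hrf, hrd, hrk, hr1⟩ := exists_radius hW hWf hγ hγW hinj hproper
    (d := fun k => min (δ k) (min (m k / 4) (m (k - 1) / 4)))
    (fun k => lt_min (hδ k) (lt_min (by linarith [hm k]) (by linarith [hm (k - 1)])))
  choose a ha haΓ using fun k : ℕ => exists_notMem_curve hW hγ hγW hinj hproper (γ k)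
    (lt_min (hδ k) (Nat.one_div_pos_of_nat (n := k)))
  have hopen : IsOpen (W \ range a) := by
    refine isOpen_iff.2 fun z hz => ?_
    obtain ⟨ρ, hρ, hρW⟩ := nhds_basis_closedBall.mem_iff.1 (hW.mem_nhds hz.1)
    obtain ⟨T, hT⟩ := hproper _ (isCompact_closedBall z ρ) hρW
    obtain ⟨N, hN⟩ := exists_nat_gt (max T (2 / ρ))
    have hfin : IsClosed (a '' Iio N) := ((finite_Iio N).image a).isClosed
    have hzfin : z ∈ (a '' Iio N)ᶜ := fun ⟨k, _, hk⟩ => hz.2 ⟨k, hk⟩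
    obtain ⟨η, hη, hη'⟩ := isOpen_iff.1 hfin.isOpen_compl z hzfin
    refine ⟨min η (ρ / 2), lt_min hη (by positivity), fun w hw => ?_⟩
    rw [mem_ball] at hw
    refine ⟨hρW (mem_closedBall.2 (hw.le.trans ((min_le_right _ _).trans (by linarith)))), ?_⟩
    rintro ⟨k, rfl⟩
    rcases lt_or_ge k N with hk | hk
    · exact hη' (mem_ball.2 (hw.trans_le (min_le_left _ _))) ⟨k, hk, rfl⟩
    · have hkN : (N : ℝ) ≤ k := by exact_mod_cast hk
      have h1 : ρ < dist (γ k) z := by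
        have := hT k ((le_max_left _ _).trans (hN.le.trans hkN))
        simpa using this
      have h2 := (ha k).trans_le (min_le_right _ _)
      have h3 : (1 : ℝ) / (k + 1) ≤ ρ / 2 := by
        have h4 : 2 / ρ < k + 1 := by linarith [(le_max_right T (2 / ρ))]
        rw [div_lt_iff₀ hρ] at h4
        rw [div_le_iff₀ (by positivity)]
        linarith
      have h4 := dist_triangle_left (γ k) z (a k)
      linarith [min_le_right η (ρ / 2)]
  obtain ⟨U, τ, hUo, hUW, hUc, hUc', hτc, hτ0, hτγ, hτr, hτS⟩ := exists_tube hopen (hWb.subset sdiff_subset)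
    hγ (fun t ht => ⟨hγW t ht, fun ⟨k, hk⟩ => haΓ k ⟨t, ht, hk.symm⟩⟩) hinj
    (fun C hC hCW => hproper C hC (hCW.trans sdiff_subset)) hrc hr0 hrd
  refine ⟨U, τ, r, a, ⟨hUo, hWb.subset (hUW.trans sdiff_subset), hUc, hUc', hτc, hτ0, hγ,
    fun u hu => (hτγ u hu).1, fun u hu => (hτγ u hu).2, hτr, hτS, hm, fun k => rfl, fun k => ?_, fun k => ?_⟩,
    hUW.trans sdiff_subset, fun k hk => (hUW hk).2 ⟨k, rfl⟩, fun k => (ha k).trans_le (min_le_left _ _),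
    fun k => (hrk k).trans (min_le_left _ _), hrf, ?_⟩
  · exact (hrk k).trans ((min_le_right _ _).trans (min_le_left _ _))
  · have := (hrk (k + 1)).trans ((min_le_right _ _).trans (min_le_right _ _))
    simpa using this
  · refine squeeze_zero' (g := fun u => 1 / u) (Eventually.of_forall fun u => (hr0 u).le) ?_ ?_
    · filter_upwards [eventually_gt_atTop 0] with u hu
      rw [le_div_iff₀ hu]
      refine le_trans (mul_le_mul_of_nonneg_left ?_ (hr0 u).le) (hr1 u)
      rw [abs_of_pos hu]
      linarith
    · simpa using tendsto_inv_atTop_zero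

theorem norm_sub_one_lt_norm_add_one {ζ : ℂ} (h : 0 < ζ.re) : ‖ζ - 1‖ < ‖ζ + 1‖ := by
  rw [← sq_lt_sq₀ (norm_nonneg _) (norm_nonneg _), Complex.sq_norm, Complex.sq_norm,
    Complex.normSq_apply, Complex.normSq_apply]
  simp
  linarith

theorem re_div_pos_of_norm_lt {ξ w : ℂ} (h : ‖w‖ < ‖ξ‖) : 0 < ((ξ + w) / (ξ - w)).re := by
  have hne : ξ - w ≠ 0 := fun h0 => by
    rw [sub_eq_zero] at h0
    exact h.ne (h0 ▸ rfl)
  rw [← sq_lt_sq₀ (norm_nonneg _) (norm_nonneg _), Complex.sq_norm, Complex.sq_norm,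
    Complex.normSq_apply, Complex.normSq_apply] at h
  rw [Complex.div_re, ← add_div]
  refine div_pos ?_ (Complex.normSq_pos.2 hne)
  simp
  nlinarith

theorem IsTube.exists_isUniformization {U : Set ℂ} {τ : ℂ → ℝ} {γ : ℝ → ℂ} {r : ℝ → ℝ} {m : ℕ → ℝ}
    (h : IsTube U τ γ r m) :
    ∃ φ ψ, IsUniformization φ ψ U ∧ ∀ R : ℝ, ∃ u, 0 ≤ u ∧ R ≤ ‖ψ (γ u)‖ := by
  obtain ⟨F, hF, hFb⟩ := exists_bijOn_ball h.isOpen h.isPreconnected h.isBounded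
    (fun f hf => isExactOn_of_isPreconnected_compl h.isOpen h.isPreconnected h.isBounded
      h.isPreconnected_compl hf) (h.curve_mem 0 le_rfl)
  let G := Function.invFunOn F U
  have hG : DifferentiableOn ℂ G (ball 0 1) :=
    hFb.image_eq ▸ (differentiableOn_invFunOn_of_injOn h.isOpen hF hFb.injOn).2
  have hGU : MapsTo G (ball 0 1) U := hFb.surjOn.mapsTo_invFunOn
  have hFG : ∀ w ∈ ball (0 : ℂ) 1, F (G w) = w := hFb.invOn_invFunOn.2
  have hGF : ∀ z ∈ U, G (F z) = z := hFb.invOn_invFunOn.1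
  have hFlt : ∀ z ∈ U, ‖F z‖ < 1 := fun z hz => by simpa using hFb.mapsTo hz
  have hγU : ∀ n : ℕ, γ n ∈ U := fun n => h.curve_mem n n.cast_nonneg
  obtain ⟨ξ, hξ, k, hk, hlim⟩ := (isCompact_closedBall (0 : ℂ) 1).tendsto_subseq
    (x := fun n : ℕ => F (γ n)) fun n => by simpa using (hFlt _ (hγU n)).le
  have hξ1 : ‖ξ‖ = 1 := by
    by_contra hne
    have hlt : ξ ∈ ball (0 : ℂ) 1 := by
      rw [mem_ball_zero_iff]
      exact lt_of_le_of_ne (by simpa using hξ) hne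
    have h1 : Tendsto (fun n => τ (G (F (γ (k n))))) atTop (𝓝 (τ (G ξ))) :=
      ((h.continuousOn.continuousAt (h.isOpen.mem_nhds (hGU hlt))).tendsto.comp
        (hG.continuousOn.continuousAt (isOpen_ball.mem_nhds hlt)).tendsto).comp hlim
    have h2 : (fun n => τ (G (F (γ (k n))))) = fun n => ((k n : ℕ) : ℝ) := by
      funext n
      rw [hGF _ (hγU _), h.apply_curve _ (k n).cast_nonneg]
    rw [h2] at h1
    exact not_tendsto_nhds_of_tendsto_atTop (tendsto_natCast_atTop_atTop.comp hk.tendsto_atTop) _ h1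
  have hξ0 : ξ ≠ 0 := by rintro rfl; simp at hξ1
  have hp : ∀ ζ : ℂ, 0 < ζ.re → ζ + 1 ≠ 0 := fun ζ hζ h0 => by
    have := congrArg Complex.re h0
    simp at this
    linarith
  have hball : ∀ ζ : ℂ, 0 < ζ.re → ξ * (ζ - 1) / (ζ + 1) ∈ ball (0 : ℂ) 1 := by
    intro ζ hζ
    rw [mem_ball_zero_iff, norm_div, norm_mul, hξ1, one_mul, div_lt_one (norm_pos_iff.2 (hp ζ hζ))]
    exact norm_sub_one_lt_norm_add_one hζ
  have hsub : ∀ z ∈ U, ξ - F z ≠ 0 := fun z hz h0 => by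
    have := hFlt z hz
    rw [← sub_eq_zero.1 h0, hξ1] at this
    exact lt_irrefl _ this
  refine ⟨fun ζ => G (ξ * (ζ - 1) / (ζ + 1)), fun z => (ξ + F z) / (ξ - F z), ⟨?_, ?_, ?_, ?_, ?_, ?_⟩, ?_⟩
  · refine hG.comp (DifferentiableOn.div (by fun_prop) (by fun_prop) fun ζ hζ => hp ζ hζ) hball
  · exact fun ζ hζ => hGU (hball ζ hζ)
  · exact (hF.const_add _).div (hF.const_sub _) hsub
  · exact fun z hz => re_div_pos_of_norm_lt (by rw [hξ1]; exact hFlt z hz)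
  · intro ζ hζ
    have h1 := hp ζ hζ
    have h2 : ξ - ξ * (ζ - 1) / (ζ + 1) ≠ 0 := by
      have : ξ - ξ * (ζ - 1) / (ζ + 1) = 2 * ξ / (ζ + 1) := by field_simp; ring
      rw [this]
      exact div_ne_zero (mul_ne_zero two_ne_zero hξ0) h1
    simp only [hFG _ (hball ζ hζ)]
    rw [div_eq_iff h2]
    field_simp
    ring
  · intro z hz
    have h1 := hsub z hz
    have h2 : ξ * ((ξ + F z) / (ξ - F z) - 1) / ((ξ + F z) / (ξ - F z) + 1) = F z := by
      have h3 : (ξ + F z) / (ξ - F z) - 1 = 2 * F z / (ξ - F z) := by field_simp; ring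
      have h4 : (ξ + F z) / (ξ - F z) + 1 = 2 * ξ / (ξ - F z) := by field_simp; ring
      rw [h3, h4]
      field_simp
    simp only [h2, hGF z hz]
  · intro R
    have h1 : Tendsto (fun n => ‖ξ - F (γ (k n))‖) atTop (𝓝 0) := by
      simpa using ((tendsto_const_nhds (x := ξ)).sub hlim).norm
    obtain ⟨n, hn⟩ := (h1.eventually_lt_const (show (0 : ℝ) < 1 / (|R| + 1) by positivity)).exists
    refine ⟨k n, (k n).cast_nonneg, ?_⟩
    have h2 : 0 < ‖ξ - F (γ (k n))‖ := norm_pos_iff.2 (hsub _ (hγU _))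
    rw [norm_div, le_div_iff₀ h2]
    have h3 : 1 ≤ ‖ξ + F (γ (k n))‖ := by
      have h4 : (2 : ℝ) ≤ ‖ξ + F (γ (k n))‖ + ‖ξ - F (γ (k n))‖ := by
        have : ξ + F (γ (k n)) + (ξ - F (γ (k n))) = 2 * ξ := by ring
        calc (2 : ℝ) = ‖2 * ξ‖ := by rw [norm_mul, hξ1]; simp
          _ ≤ _ := this ▸ norm_add_le _ _
      have h5 : (1 : ℝ) / (|R| + 1) ≤ 1 := (div_le_one (by positivity)).2 (by linarith [abs_nonneg R])
      linarith
    calc R * ‖ξ - F (γ (k n))‖ ≤ (|R| + 1) * ‖ξ - F (γ (k n))‖ := by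
          gcongr
          linarith [le_abs_self R]
      _ ≤ (|R| + 1) * (1 / (|R| + 1)) := by gcongr
      _ = 1 := by field_simp
      _ ≤ _ := h3

namespace IsTube

variable {U : Set ℂ} {τ : ℂ → ℝ} {γ : ℝ → ℂ} {r : ℝ → ℝ} {m : ℕ → ℝ} {φ ψ : ℂ → ℂ}

theorem dist_le_mul_exp (h : IsTube U τ γ r m) (H : IsUniformization φ ψ U) {a : ℂ} (ha : a ∉ U)
    {z w : ℂ} {x R : ℝ} (hx : 0 < x) (hz : x ≤ z.re) (hw : x ≤ w.re) (hzR : ‖z‖ ≤ R) (hwR : ‖w‖ ≤ R) :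
    dist (φ w) a ≤ dist (φ z) a * Real.exp (672 * (Real.log (R / x) + 1)) := by
  obtain ⟨l, hl, hle⟩ := exists_log_of_isExactOn h.isOpen h.isPreconnected
    (fun f hf => isExactOn_of_isPreconnected_compl h.isOpen h.isPreconnected h.isBounded
      h.isPreconnected_compl hf) (f := fun z => z - a) (by fun_prop)
    (fun z hz h0 => ha (sub_eq_zero.1 h0 ▸ hz))
  let L : ℂ → ℂ := fun ζ => l (φ ζ)
  have hL : DifferentiableOn ℂ L {z | 0 < z.re} := hl.comp H.differentiableOn H.mapsTo
  have hLe : ∀ ζ : ℂ, 0 < ζ.re → Complex.exp (L ζ) = φ ζ - a := fun ζ hζ => hle _ (H.mapsTo hζ)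
  have hball : ∀ v, ¬ ball v 7 ⊆ L '' {z | 0 < z.re} := by
    intro v hv
    obtain ⟨z₁, hz₁, h1⟩ := hv (mem_ball_self (by norm_num))
    obtain ⟨z₂, hz₂, h2⟩ := hv (show v + 2 * Real.pi * Complex.I ∈ ball v 7 by
      rw [mem_ball, dist_eq_norm, add_sub_cancel_left, norm_mul, norm_mul, Complex.norm_I, Complex.norm_real,
        Real.norm_of_nonneg Real.pi_pos.le]
      simp
      linarith [Real.pi_lt_d2])
    have h3 : φ z₁ = φ z₂ := by
      have := hLe z₂ hz₂
      rw [h2, Complex.exp_add, Complex.exp_two_pi_mul_I, mul_one, ← h1, hLe z₁ hz₁] at this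
      linear_combination this
    have h4 : z₁ = z₂ := by rw [← H.left_inv z₁ hz₁, h3, H.left_inv z₂ hz₂]
    rw [← h4, h1] at h2
    have h5 : 2 * Real.pi * Complex.I = 0 := by linear_combination -h2
    exact Complex.two_pi_I_ne_zero h5
  have hle := norm_sub_le_log_of_re_pos hL hball hx hw hz hwR hzR
  rw [dist_eq_norm, dist_eq_norm, ← hLe w (hx.trans_le hw), ← hLe z (hx.trans_le hz), Complex.norm_exp,
    Complex.norm_exp, ← Real.exp_add, Real.exp_le_exp]
  have := (Complex.re_le_norm (L w - L z)).trans hle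
  rw [Complex.sub_re] at this
  linarith

theorem exists_ball_subset (h : IsTube U τ γ r m) (H : IsUniformization φ ψ U) :
    ∃ c : ℝ, 0 < c ∧ ∀ ζ : ℂ, 1 ≤ ζ.re → ball (φ ζ) (c * Real.exp (-(672 * Real.log (‖ζ‖ + 1)))) ⊆ U := by
  obtain ⟨d, hd, hdU⟩ := isOpen_iff.1 h.isOpen (φ 1) (H.mapsTo (by simp))
  refine ⟨d * Real.exp (-672), by positivity, fun ζ hζ a hma => ?_⟩
  by_contra ha
  have h1 := h.dist_le_mul_exp H ha one_pos hζ (w := 1) (by simp) (R := ‖ζ‖ + 1) (by linarith) (by simp)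
  have h2 : d ≤ dist (φ 1) a := by
    by_contra! h3
    exact ha (hdU (by rwa [mem_ball, dist_comm]))
  rw [mem_ball, dist_comm] at hma
  rw [div_one] at h1
  have h3 : dist (φ ζ) a * Real.exp (672 * (Real.log (‖ζ‖ + 1) + 1)) <
      d * Real.exp (-672) * Real.exp (-(672 * Real.log (‖ζ‖ + 1))) *
        Real.exp (672 * (Real.log (‖ζ‖ + 1) + 1)) := by gcongr
  rw [mul_assoc, mul_assoc, ← Real.exp_add, ← Real.exp_add] at h3
  ring_nf at h3 h1
  simp only [Real.exp_zero, mul_one] at h3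
  linarith

end IsTube

theorem le_re_of_step {ζ : ℕ → ℂ} (hstep : ∀ n, ‖ζ (n + 1) - ζ n - 1‖ ≤ 1 / 2) (n : ℕ) :
    (ζ 0).re + n / 2 ≤ (ζ n).re := by
  induction n with
  | zero => simp
  | succ n ih =>
    have := (abs_le.1 ((Complex.abs_re_le_norm _).trans (hstep n))).1
    simp only [Complex.sub_re, Complex.one_re] at this
    push_cast
    linarith

theorem norm_sub_le_of_step {ζ : ℕ → ℂ} (hstep : ∀ n, ‖ζ (n + 1) - ζ n - 1‖ ≤ 1 / 2) (n : ℕ) :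
    ‖ζ (n + 1) - ζ n‖ ≤ 3 / 2 := by
  calc ‖ζ (n + 1) - ζ n‖ = ‖(ζ (n + 1) - ζ n - 1) + 1‖ := by rw [sub_add_cancel]
    _ ≤ ‖ζ (n + 1) - ζ n - 1‖ + ‖(1 : ℂ)‖ := norm_add_le _ _
    _ ≤ 3 / 2 := by rw [norm_one]; linarith [hstep n]

theorem norm_le_of_step {ζ : ℕ → ℂ} (hstep : ∀ n, ‖ζ (n + 1) - ζ n - 1‖ ≤ 1 / 2) (n : ℕ) :
    ‖ζ n‖ ≤ ‖ζ 0‖ + 3 / 2 * n := by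
  induction n with
  | zero => simp
  | succ n ih =>
    have h1 := norm_sub_le_of_step hstep n
    have h2 := norm_le_norm_add_norm_sub' (ζ (n + 1)) (ζ n)
    push_cast
    linarith

namespace IsTube

variable {U : Set ℂ} {τ : ℂ → ℝ} {γ : ℝ → ℂ} {r : ℝ → ℝ} {m : ℕ → ℝ} {φ ψ : ℂ → ℂ}

theorem exists_mem_segment_parameter_eq (h : IsTube U τ γ r m) (H : IsUniformization φ ψ U) {z w : ℂ}
    (hz : 0 < z.re) (hw : 0 < w.re) {c : ℝ} (hc : τ (φ z) ≤ c) (hc' : c ≤ τ (φ w)) :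
    ∃ p ∈ segment ℝ z w, τ (φ p) = c := by
  have hsub : segment ℝ z w ⊆ {z | 0 < z.re} := (convex_halfSpace_re_gt 0).segment_subset hz hw
  have h1 : ContinuousOn (fun p => τ (φ p)) (segment ℝ z w) :=
    h.continuousOn.comp (H.differentiableOn.continuousOn.mono hsub) fun p hp => H.mapsTo (hsub hp)
  obtain ⟨p, hp, hpc⟩ := ((convex_segment z w).isPreconnected.image _ h1).Icc_subset
    (mem_image_of_mem _ (left_mem_segment ℝ z w)) (mem_image_of_mem _ (right_mem_segment ℝ z w)) ⟨hc, hc'⟩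
  exact ⟨p, hp, hpc⟩

theorem eventually_le_of_step (h : IsTube U τ γ r m) (H : IsUniformization φ ψ U)
    {a : ℕ → ℂ} {δ : ℕ → ℝ} {N : ℕ → ℕ} (ha : ∀ k, a k ∉ U) (haγ : ∀ k, dist (a k) (γ k) < δ k)
    (hrδ : ∀ k : ℕ, r k ≤ δ k)
    (hδ : ∀ k, δ k ≤ m k / 4 * Real.exp (-(672 * Real.log (N (k + 1) + 1)) - k))
    {ζ : ℕ → ℂ} (h0 : 0 < (ζ 0).re) (hstep : ∀ n, ‖ζ (n + 1) - ζ n - 1‖ ≤ 1 / 2) :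
    ∀ᶠ n in atTop, N ⌊τ (φ (ζ n))⌋₊ ≤ n := by
  let A : ℝ := (‖ζ 0‖ + 3 / 2) / (ζ 0).re
  have hA : 0 < A := by positivity
  obtain ⟨J, hJ⟩ := exists_nat_gt (max (τ (φ (ζ 0))) (672 * (Real.log A + 1) + Real.log 2))
  have hcross : ∀ n k : ℕ, J ≤ k → (k + 1 : ℝ) ≤ τ (φ (ζ n)) → N (k + 1) ≤ n := by
    intro n k hk hkn
    by_contra! hnN
    have hJk : (J : ℝ) ≤ k := by exact_mod_cast hk
    have hre : (ζ 0).re ≤ (ζ n).re := by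
      have := le_re_of_step hstep n
      have : (0 : ℝ) ≤ n := n.cast_nonneg
      linarith
    have hn0 : 0 < (ζ n).re := h0.trans_le hre
    obtain ⟨p, hp, hpk⟩ := h.exists_mem_segment_parameter_eq H h0 hn0 (c := k)
      (((le_max_left _ _).trans hJ.le).trans hJk) (by linarith)
    obtain ⟨q, hq, hqk⟩ := h.exists_mem_segment_parameter_eq H h0 hn0 (c := k + 1)
      (by linarith [((le_max_left _ _).trans hJ.le).trans hJk]) hkn
    have hseg : ∀ s ∈ segment ℝ (ζ 0) (ζ n), (ζ 0).re ≤ s.re ∧ ‖s‖ ≤ ‖ζ 0‖ + 3 / 2 * n := by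
      intro s hs
      refine ⟨(convex_halfSpace_re_ge _).segment_subset (le_refl (ζ 0).re) hre hs, ?_⟩
      have := (convex_closedBall (0 : ℂ) (‖ζ 0‖ + 3 / 2 * n)).segment_subset
        (mem_closedBall_zero_iff.2 (by linarith [n.cast_nonneg (α := ℝ)]))
        (mem_closedBall_zero_iff.2 (norm_le_of_step hstep n)) hs
      exact mem_closedBall_zero_iff.1 this
    obtain ⟨hp1, hp2⟩ := hseg p hp
    obtain ⟨hq1, hq2⟩ := hseg q hq
    have hpU := H.mapsTo (h0.trans_le hp1)
    have hqU := H.mapsTo (h0.trans_le hq1)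
    have hmain := h.dist_le_mul_exp H (ha k) h0 hp1 hq1 hp2 hq2
    have hmk := h.pos k
    have hexp1 : Real.exp (-(672 * Real.log (N (k + 1) + 1)) - k) ≤ 1 := by
      refine Real.exp_le_one_iff.2 ?_
      have : 0 ≤ Real.log ((N (k + 1) : ℝ) + 1) := Real.log_nonneg (by
        linarith [(N (k + 1)).cast_nonneg (α := ℝ)])
      linarith [k.cast_nonneg (α := ℝ)]
    have hδm : δ k ≤ m k / 4 := (hδ k).trans (mul_le_of_le_one_right (by linarith) hexp1)
    have h1 : dist (φ p) (a k) ≤ 2 * δ k := by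
      have h2 := h.dist_lt _ hpU
      rw [hpk] at h2
      have := dist_triangle_right (φ p) (a k) (γ k)
      linarith [haγ k, hrδ k]
    have h2 : m k / 4 ≤ dist (φ q) (a k) := by
      have h3 := h.le_dist_of_eq hqU hqk
      have := dist_triangle (φ q) (a k) (γ k)
      linarith [haγ k]
    have hR : (‖ζ 0‖ + 3 / 2 * n) / (ζ 0).re ≤ A * (N (k + 1) + 1) := by
      have hnN' : (n : ℝ) ≤ N (k + 1) := by exact_mod_cast hnN.le
      change _ ≤ (‖ζ 0‖ + 3 / 2) / (ζ 0).re * _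
      rw [div_mul_eq_mul_div (‖ζ 0‖ + 3 / 2)]
      refine div_le_div_of_nonneg_right ?_ h0.le
      nlinarith [norm_nonneg (ζ 0), n.cast_nonneg (α := ℝ)]
    have hlog : Real.log ((‖ζ 0‖ + 3 / 2 * n) / (ζ 0).re) ≤ Real.log A + Real.log (N (k + 1) + 1) := by
      rw [← Real.log_mul hA.ne' (by positivity)]
      rcases eq_or_lt_of_le (show 0 ≤ (‖ζ 0‖ + 3 / 2 * n) / (ζ 0).re by positivity) with h4 | h4
      · exfalso
        have : (ζ 0) ≠ 0 := fun h5 => by simp [h5] at h0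
        have : 0 < ‖ζ 0‖ := norm_pos_iff.2 this
        have : 0 < (‖ζ 0‖ + 3 / 2 * n) / (ζ 0).re := by positivity
        linarith
      · exact Real.log_le_log h4 hR
    have h5 : m k / 4 ≤ 2 * (m k / 4 * Real.exp (-(672 * Real.log (N (k + 1) + 1)) - k)) *
        Real.exp (672 * (Real.log A + Real.log (N (k + 1) + 1) + 1)) := by
      refine (h2.trans hmain).trans ?_
      refine mul_le_mul (h1.trans (by linarith [hδ k])) (Real.exp_le_exp.2 (by linarith)) (Real.exp_pos _).le ?_
      positivity
    have h6 : 2 * (m k / 4 * Real.exp (-(672 * Real.log (N (k + 1) + 1)) - k)) *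
        Real.exp (672 * (Real.log A + Real.log (N (k + 1) + 1) + 1)) =
        m k / 4 * Real.exp (672 * (Real.log A + 1) + Real.log 2 - k) := by
      have h7 : 672 * (Real.log A + 1) + Real.log 2 - k = (-(672 * Real.log (N (k + 1) + 1)) - k) +
        672 * (Real.log A + Real.log (N (k + 1) + 1) + 1) + Real.log 2 := by ring
      rw [h7, Real.exp_add, Real.exp_add, Real.exp_log two_pos]
      ring
    rw [h6] at h5
    have h8 : Real.exp (672 * (Real.log A + 1) + Real.log 2 - k) < 1 := by
      rw [Real.exp_lt_one_iff]
      have := (le_max_right (τ (φ (ζ 0))) _).trans_lt hJ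
      linarith
    nlinarith
  obtain ⟨B, hB⟩ : ∃ B, ∀ k ≤ J, N k ≤ B :=
    ⟨(Finset.range (J + 1)).sup N, fun k hk => Finset.le_sup (Finset.mem_range.2 (by omega))⟩
  filter_upwards [eventually_ge_atTop B] with n hn
  rcases le_or_gt ⌊τ (φ (ζ n))⌋₊ J with hk | hk
  · exact (hB _ hk).trans hn
  · have h1 := Nat.floor_le (h.nonneg (φ (ζ n)))
    obtain ⟨k, hk'⟩ : ∃ k, ⌊τ (φ (ζ n))⌋₊ = k + 1 := ⟨⌊τ (φ (ζ n))⌋₊ - 1, by omega⟩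
    rw [hk'] at h1 hk ⊢
    exact hcross n k (by omega) (by exact_mod_cast h1)

theorem tendsto_parameter (h : IsTube U τ γ r m) (H : IsUniformization φ ψ U)
    (hub : ∀ R : ℝ, ∃ u, 0 ≤ u ∧ R ≤ ‖ψ (γ u)‖) {ζ : ℕ → ℂ} (h0 : 0 < (ζ 0).re)
    (hstep : ∀ n, ‖ζ (n + 1) - ζ n - 1‖ ≤ 1 / 2) : Tendsto (fun n => τ (φ (ζ n))) atTop atTop := by
  refine Filter.tendsto_atTop.2 fun b => ?_
  obtain ⟨R, hR⟩ := h.exists_lt_parameter H hub ⌈b⌉₊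
  filter_upwards [eventually_ge_atTop ⌈2 * R⌉₊] with n hn
  have h1 := le_re_of_step hstep n
  have h2 := Nat.ceil_le.1 hn
  have h3 := Complex.re_le_norm (ζ n)
  have h4 : 0 < (ζ n).re := by linarith [n.cast_nonneg (α := ℝ)]
  exact (Nat.le_ceil b).trans (hR _ h4 (by linarith)).le

theorem setOf_accumulation_eq (h : IsTube U τ γ r m) (H : IsUniformization φ ψ U)
    (hub : ∀ R : ℝ, ∃ u, 0 ≤ u ∧ R ≤ ‖ψ (γ u)‖) (hr : Tendsto r atTop (𝓝 0)) {ζ : ℕ → ℂ}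
    (h0 : 0 < (ζ 0).re) (hstep : ∀ n, ‖ζ (n + 1) - ζ n - 1‖ ≤ 1 / 2) :
    {w : ℂ | ∃ k : ℕ → ℕ, StrictMono k ∧ Tendsto (fun j => φ (ζ (k j))) atTop (𝓝 w)} =
      {w : ℂ | ∃ t : ℕ → ℝ, (∀ n, 0 ≤ t n) ∧ Tendsto t atTop atTop ∧
        Tendsto (fun n => γ (t n)) atTop (𝓝 w)} := by
  have hτ := h.tendsto_parameter H hub h0 hstep
  have hpos : ∀ n, 0 < (ζ n).re := fun n => by
    have := le_re_of_step hstep n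
    linarith [n.cast_nonneg (α := ℝ)]
  ext w
  constructor
  · rintro ⟨k, hk, hw⟩
    have ht := hτ.comp hk.tendsto_atTop
    refine ⟨fun j => τ (φ (ζ (k j))), fun j => h.nonneg _, ht, ?_⟩
    refine tendsto_iff_dist_tendsto_zero.2 ?_
    have h1 : Tendsto (fun j => r (τ (φ (ζ (k j)))) + dist (φ (ζ (k j))) w) atTop (𝓝 0) := by
      simpa using (hr.comp ht).add (tendsto_iff_dist_tendsto_zero.1 hw)
    refine squeeze_zero (fun _ => dist_nonneg) (fun j => ?_) h1
    have := dist_triangle_left (γ (τ (φ (ζ (k j))))) w (φ (ζ (k j)))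
    linarith [h.dist_lt _ (H.mapsTo (hpos (k j)))]
  · rintro ⟨t, ht0, ht, hw⟩
    obtain ⟨D, hD⟩ := h.isBounded.subset_ball_lt 0 0
    refine MapClusterPt.tendsto_subseq (u := fun n => φ (ζ n)) ?_
    rw [mapClusterPt_iff_frequently]
    intro s hs
    obtain ⟨η, hη, hηs⟩ := Metric.mem_nhds_iff.1 hs
    rw [frequently_atTop]
    intro N
    obtain ⟨N', hN'⟩ := exists_nat_gt (max (max (N : ℝ) 4) (18 * D / η))
    have hN4 : (4 : ℝ) < N' := ((le_max_right _ _).trans (le_max_left _ _)).trans_lt hN'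
    have hND : 18 * D / η < N' := (le_max_right _ _).trans_lt hN'
    have hNN : N ≤ N' := by
      have : (N : ℝ) < N' := ((le_max_left _ _).trans (le_max_left _ _)).trans_lt hN'
      exact_mod_cast this.le
    have hr' := (hr.comp ht).eventually_lt_const (show 0 < η / 3 by linarith)
    have hw' := (tendsto_iff_dist_tendsto_zero.1 hw).eventually_lt_const (show 0 < η / 3 by linarith)
    obtain ⟨j, hj1, hj2, hj3⟩ := (hr'.and (hw'.and (ht.eventually_ge_atTop (τ (φ (ζ N')))))).exists
    obtain ⟨n, hn, hn1, hn2⟩ : ∃ n, N' ≤ n ∧ τ (φ (ζ n)) ≤ t j ∧ t j ≤ τ (φ (ζ (n + 1))) := by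
      by_contra! hcon
      have h1 : ∀ n, N' ≤ n → τ (φ (ζ n)) ≤ t j := fun n hn =>
        Nat.le_induction hj3 (fun n hn ih => (hcon n hn ih).le) n hn
      obtain ⟨n, hn, hn'⟩ := ((hτ.eventually_gt_atTop (t j)).and (eventually_ge_atTop N')).exists
      linarith [h1 n hn']
    obtain ⟨p, hp, hpt⟩ := h.exists_mem_segment_parameter_eq H (hpos n) (hpos (n + 1)) hn1 hn2
    refine ⟨n, hNN.trans hn, hηs ?_⟩
    have hnN : (N' : ℝ) ≤ n := by exact_mod_cast hn
    have hren : (n : ℝ) / 2 ≤ (ζ n).re := by linarith [le_re_of_step hstep n]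
    have hpn : dist p (ζ n) ≤ 3 / 2 := by
      have := (convex_closedBall (ζ n) (3 / 2)).segment_subset (mem_closedBall_self (by norm_num))
        (mem_closedBall.2 (by rw [dist_eq_norm]; exact norm_sub_le_of_step hstep n)) hp
      exact this
    have hballre : ball (ζ n) (n / 2) ⊆ {z | 0 < z.re} := by
      intro z hz
      rw [mem_ball, dist_eq_norm] at hz
      have := (abs_lt.1 ((Complex.abs_re_le_norm _).trans_lt hz)).1
      rw [Complex.sub_re] at this
      show 0 < z.re
      linarith
    have hpb : p ∈ ball (ζ n) (n / 2) := by
      rw [mem_ball]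
      linarith
    have hpU := H.mapsTo (hballre hpb)
    have h1 : dist (φ p) (φ (ζ n)) ≤ 2 * D / (n / 2) * dist p (ζ n) := by
      refine Complex.dist_le_div_mul_dist_of_mapsTo_ball (H.differentiableOn.mono hballre) (fun z hz => ?_) hpb
      have h2 := mem_ball_zero_iff.1 (hD.2 (H.mapsTo (hballre hz)))
      have h3 := mem_ball_zero_iff.1 (hD.2 (H.mapsTo (hpos n)))
      rw [mem_closedBall, dist_eq_norm]
      linarith [norm_sub_le (φ z) (φ (ζ n))]
    have hn0 : (0 : ℝ) < n := by linarith
    have h2 : 2 * D / (n / 2) * dist p (ζ n) < η / 3 := by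
      calc 2 * D / (n / 2) * dist p (ζ n) ≤ 2 * D / (n / 2) * (3 / 2) := by
            have := hD.1
            gcongr
        _ = 6 * D / n := by field_simp; ring
        _ < η / 3 := by
            rw [div_lt_iff₀ hη] at hND
            rw [div_lt_iff₀ hn0]
            nlinarith
    have h3 := h.dist_lt _ hpU
    rw [hpt] at h3
    rw [mem_ball]
    have h4 := dist_triangle4 (φ (ζ n)) (φ p) (γ (t j)) w
    rw [dist_comm (φ (ζ n)) (φ p)] at h4
    simp only [Function.comp_apply] at hj1
    linarith

end IsTube

theorem IsTube.exists_barrier {U : Set ℂ} {τ : ℂ → ℝ} {γ : ℝ → ℂ} {r : ℝ → ℝ} {m : ℕ → ℝ} {φ ψ : ℂ → ℂ}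
    (h : IsTube U τ γ r m) (H : IsUniformization φ ψ U)
    (hub : ∀ R : ℝ, ∃ u, 0 ≤ u ∧ R ≤ ‖ψ (γ u)‖) :
    ∃ w : ℝ → ℝ, (∀ y, 0 < w y) ∧ (∀ y y', w y ≤ w y' + |y - y'| / 2) ∧
      ∀ u, 0 ≤ u → w (ψ (γ u)).im < (ψ (γ u)).re := by
  let S : Set ℂ := (fun u => ψ (γ u)) '' Ici 0
  have hS : S.Nonempty := ⟨_, 0, le_refl (0:ℝ), rfl⟩
  have hre : ∀ u, 0 ≤ u → 0 < (ψ (γ u)).re := fun u hu => H.mapsTo_inv (h.curve_mem u hu)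
  refine ⟨fun y => infDist (y * Complex.I) S / 2, fun y => ?_, fun y y' => ?_, fun u hu => ?_⟩
  · obtain ⟨T, hT⟩ := eventually_atTop.1 ((h.tendsto_norm_lift H hub).eventually_ge_atTop (|y| + 1))
    obtain ⟨c, hc, hcT⟩ := (isCompact_Icc (a := (0 : ℝ)) (b := T)).exists_forall_le'
      (f := fun u => dist (y * Complex.I) (ψ (γ u))) (a := 0)
      (continuous_dist.comp_continuousOn
        (continuousOn_const.prodMk ((h.continuousOn_lift H).mono Icc_subset_Ici_self))) (by
        intro u hu
        refine dist_pos.2 fun h0 => ?_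
        have h1 := hre u hu.1
        rw [← h0] at h1
        simp at h1)
    have : min c 1 ≤ infDist (y * Complex.I) S := by
      refine (le_infDist hS).2 ?_
      rintro _ ⟨u, hu, rfl⟩
      rcases le_total T u with hTu | hTu
      · refine (min_le_right _ _).trans ?_
        have h1 := hT u hTu
        have h2 := norm_sub_norm_le (ψ (γ u)) (y * Complex.I)
        rw [norm_mul, Complex.norm_I, mul_one, Complex.norm_real, Real.norm_eq_abs] at h2
        rw [dist_comm, dist_eq_norm]
        linarith
      · exact (min_le_left _ _).trans (hcT u ⟨hu, hTu⟩)
    have := lt_min hc one_pos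
    linarith
  · have h1 := infDist_le_infDist_add_dist (s := S) (x := (y * Complex.I : ℂ)) (y := y' * Complex.I)
    rw [dist_eq_norm, ← sub_mul, norm_mul, Complex.norm_I, mul_one, ← Complex.ofReal_sub, Complex.norm_real,
      Real.norm_eq_abs] at h1
    linarith
  · have h1 : infDist ((ψ (γ u)).im * Complex.I) S ≤ dist ((ψ (γ u)).im * Complex.I) (ψ (γ u)) :=
      infDist_le_dist_of_mem ⟨u, hu, rfl⟩
    have h2 : dist ((ψ (γ u)).im * Complex.I) (ψ (γ u)) = (ψ (γ u)).re := by
      have h3 : ((ψ (γ u)).im * Complex.I : ℂ) - ψ (γ u) = -((ψ (γ u)).re : ℂ) := by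
        linear_combination Complex.re_add_im (ψ (γ u))
      rw [dist_eq_norm, h3, norm_neg, Complex.norm_real, Real.norm_of_nonneg (hre u hu).le]
    have := hre u hu
    linarith

theorem continuous_of_le_add_abs {w : ℝ → ℝ} (hw : ∀ y y', w y ≤ w y' + |y - y'| / 2) : Continuous w := by
  refine LipschitzWith.continuous (K := 1) (LipschitzWith.of_le_add fun y y' => ?_)
  rw [Real.dist_eq]
  linarith [hw y y', abs_nonneg (y - y')]

namespace IsUniformization

variable {U : Set ℂ} {φ ψ : ℂ → ℂ} {w : ℝ → ℝ}

theorem injOn (H : IsUniformization φ ψ U) : InjOn φ {z | 0 < z.re} :=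
  LeftInvOn.injOn (f₁' := ψ) fun _ hs => H.left_inv _ hs

theorem isOpen_image (H : IsUniformization φ ψ U) (hU : IsOpen U) (hw0 : ∀ y, 0 ≤ w y) (hw : Continuous w) :
    IsOpen (φ '' {ζ | w ζ.im < ζ.re}) := by
  have h1 : φ '' {ζ | w ζ.im < ζ.re} = U ∩ ψ ⁻¹' {ζ | w ζ.im < ζ.re} := by
    ext z
    constructor
    · rintro ⟨ζ, hζ, rfl⟩
      have hζ' : 0 < ζ.re := (hw0 _).trans_lt hζ
      refine ⟨H.mapsTo hζ', ?_⟩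
      rw [mem_preimage, H.left_inv ζ hζ']
      exact hζ
    · rintro ⟨hz, hz'⟩
      exact ⟨ψ z, hz', H.right_inv z hz⟩
  rw [h1]
  exact H.differentiableOn_inv.continuousOn.isOpen_inter_preimage hU
    (isOpen_lt (hw.comp Complex.continuous_im) Complex.continuous_re)

theorem simplyConnectedSpace_image (H : IsUniformization φ ψ U) (hw0 : ∀ y, 0 ≤ w y) (hw : Continuous w) :
    SimplyConnectedSpace (φ '' {ζ | w ζ.im < ζ.re}) := by
  have hpos : ∀ ζ : ℂ, w ζ.im < ζ.re → 0 < ζ.re := fun ζ hζ => (hw0 _).trans_lt hζ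
  have hmemU : ∀ z ∈ φ '' {ζ | w ζ.im < ζ.re}, z ∈ U ∧ w (ψ z).im < (ψ z).re := by
    rintro _ ⟨ζ, hζ, rfl⟩
    refine ⟨H.mapsTo (hpos ζ hζ), ?_⟩
    rw [H.left_inv ζ (hpos ζ hζ)]
    exact hζ
  have hshift : ∀ ζ : ℂ, 0 < ζ.re → w (ζ + w ζ.im).im < (ζ + w ζ.im).re := fun ζ hζ => by
    simpa using hζ
  let P : Set ℂ := {ζ : ℂ | 0 < ζ.re}
  let e : φ '' {ζ | w ζ.im < ζ.re} ≃ₜ P :=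
    { toFun := fun z => ⟨ψ z - w (ψ z).im, by simpa [P] using (hmemU z z.2).2⟩
      invFun := fun (ζ : P) => ⟨φ (ζ + w (ζ : ℂ).im), ⟨ζ + w (ζ : ℂ).im, hshift ζ ζ.property, rfl⟩⟩
      left_inv := fun z => by
        refine Subtype.ext ?_
        simp [H.right_inv z (hmemU z z.2).1]
      right_inv := fun ζ => by
        refine Subtype.ext ?_
        simp only [H.left_inv _ (hpos _ (hshift ζ ζ.property))]
        simp
      continuous_toFun := by
        have h1 : Continuous fun z : φ '' {ζ | w ζ.im < ζ.re} => ψ z :=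
          H.differentiableOn_inv.continuousOn.comp_continuous continuous_subtype_val fun z => (hmemU z z.2).1
        exact (h1.sub (Complex.continuous_ofReal.comp (hw.comp (Complex.continuous_im.comp h1)))).subtype_mk _
      continuous_invFun := by
        refine Continuous.subtype_mk (H.differentiableOn.continuousOn.comp_continuous ?_
          fun ζ : P => hpos _ (hshift ζ ζ.property)) _
        have : Continuous fun ζ : P => (ζ : ℂ).im := by fun_prop
        exact continuous_subtype_val.add (Complex.continuous_ofReal.comp (hw.comp this)) }
  have : ContractibleSpace P :=
    (convex_halfSpace_re_gt 0).contractibleSpace ⟨1, by simp⟩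
  have := e.contractibleSpace
  infer_instance

end IsUniformization

theorem lt_re_of_norm_sub_lt {w : ℝ → ℝ} (hw : ∀ y y', w y ≤ w y' + |y - y'| / 2) {ζ η : ℂ}
    (hζ : w ζ.im < ζ.re) (hη : ‖η - ζ - 1‖ < 1 / 2) : w η.im < η.re := by
  have h1 := (abs_lt.1 ((Complex.abs_re_le_norm _).trans_lt hη)).1
  have h2 := (Complex.abs_im_le_norm _).trans_lt hη
  simp only [Complex.sub_re, Complex.sub_im, Complex.one_re, Complex.one_im, sub_zero] at h1 h2
  linarith [hw η.im ζ.im]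

theorem exists_exhaustion {W : Set ℂ} (hW : IsOpen W) {Q : Set ℂ → Set ℂ → Prop}
    (hQ : ∀ C, IsCompact C → C ⊆ W → ∃ T, IsCompact T ∧ T ⊆ W ∧ Q C T)
    (hmono : ∀ C T T', T ⊆ T' → Q C T → Q C T') :
    ∃ X : ℕ → Set ℂ, X 0 = ∅ ∧ (∀ n, IsCompact (X n)) ∧ (∀ n, X n ⊆ interior (X (n + 1))) ∧
      (∀ n, X n ⊆ W) ∧ (∀ z ∈ W, ∃ n, z ∈ X n) ∧ ∀ n, Q (X n) (X (n + 1)) := by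
  obtain ⟨F, hFc, hFW, hFU, hFm⟩ := hW.exists_iUnion_isClosed
  have step : ∀ (n : ℕ) (C : {C : Set ℂ // IsCompact C ∧ C ⊆ W}), ∃ L : {C : Set ℂ // IsCompact C ∧ C ⊆ W},
      (C : Set ℂ) ⊆ interior L ∧ F n ∩ closedBall 0 n ⊆ L ∧ Q C L := by
    rintro n ⟨C, hC, hCW⟩
    obtain ⟨T, hT, hTW, hCT⟩ := hQ C hC hCW
    obtain ⟨L, hL, hDL, hLW⟩ := exists_compact_between
      (K := C ∪ T ∪ F n ∩ closedBall 0 n) ((hC.union hT).union ((isCompact_closedBall _ _).inter_left (hFc n))) hW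
      (union_subset (union_subset hCW hTW) (inter_subset_left.trans (hFW n)))
    exact ⟨⟨L, hL, hLW⟩, fun z hz => hDL (Or.inl (Or.inl hz)), fun z hz => interior_subset (hDL (Or.inr hz)),
      hmono _ _ _ (fun z hz => interior_subset (hDL (Or.inl (Or.inr hz)))) hCT⟩
  choose L hL1 hL2 hL3 using step
  let X : ℕ → {C : Set ℂ // IsCompact C ∧ C ⊆ W} := fun n =>
    Nat.rec ⟨∅, isCompact_empty, empty_subset _⟩ L n
  refine ⟨fun n => (X n).val, rfl, fun n => (X n).property.1, fun n => hL1 n (X n), fun n => (X n).property.2,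
    fun z hz => ?_, fun n => hL3 n (X n)⟩
  rw [← hFU] at hz
  obtain ⟨i, hi⟩ := mem_iUnion.1 hz
  obtain ⟨j, hj⟩ := exists_nat_ge ‖z‖
  refine ⟨max i j + 1, hL2 (max i j) (X (max i j)) ⟨hFm (le_max_left i j) hi, ?_⟩⟩
  rw [mem_closedBall_zero_iff]
  exact hj.trans (by exact_mod_cast le_max_right i j)

theorem IsTube.exists_norm_le_of_mem {W U : Set ℂ} {τ : ℂ → ℝ} {γ : ℝ → ℂ} {r : ℝ → ℝ} {m : ℕ → ℝ}
    {φ ψ : ℂ → ℂ} (h : IsTube U τ γ r m) (H : IsUniformization φ ψ U)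
    (hub : ∀ R : ℝ, ∃ u, 0 ≤ u ∧ R ≤ ‖ψ (γ u)‖) (hW : IsOpen W)
    (hproper : ∀ C, IsCompact C → C ⊆ W → ∃ T : ℝ, ∀ t, T ≤ t → γ t ∉ C) (hr : Tendsto r atTop (𝓝 0))
    {C : Set ℂ} (hC : IsCompact C) (hCW : C ⊆ W) :
    ∃ ρ : ℝ, ∀ ζ : ℂ, 0 < ζ.re → φ ζ ∈ C → ‖ζ‖ ≤ ρ := by
  obtain ⟨δ, hδ, hδW⟩ := hC.exists_cthickening_subset_open hW hCW
  obtain ⟨T, hT⟩ := hproper _ hC.cthickening hδW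
  obtain ⟨T', hT'⟩ := eventually_atTop.1 (hr.eventually_lt_const hδ)
  obtain ⟨k, hk⟩ := exists_nat_ge (max T T')
  obtain ⟨R, hR⟩ := h.exists_lt_parameter H hub k
  refine ⟨R, fun ζ hζ hζC => ?_⟩
  by_contra! hlt
  have h1 := hk.trans_lt (hR ζ hζ hlt.le)
  refine hT (τ (φ ζ)) ((le_max_left _ _).trans h1.le) ?_
  refine mem_cthickening_of_dist_le _ (φ ζ) δ C hζC ?_
  rw [dist_comm]
  exact ((h.dist_lt _ (H.mapsTo hζ)).trans (hT' _ ((le_max_right _ _).trans h1.le))).le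

namespace IsUniformization

variable {W U : Set ℂ} {φ ψ : ℂ → ℂ} {w : ℝ → ℝ}

theorem inter_closure_image_subset (H : IsUniformization φ ψ U) (hW : IsOpen W)
    (hp : ∀ C, IsCompact C → C ⊆ W → ∃ ρ : ℝ, ∀ ζ : ℂ, 0 < ζ.re → φ ζ ∈ C → ‖ζ‖ ≤ ρ)
    (hw0 : ∀ y, 0 < w y) (hw : Continuous w) :
    W ∩ closure (φ '' {ζ | w ζ.im ≤ ζ.re}) ⊆ φ '' {ζ | w ζ.im ≤ ζ.re} := by
  rintro z ⟨hzW, hz⟩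
  obtain ⟨δ, hδ, hδW⟩ := (Metric.nhds_basis_closedBall.mem_iff).1 (hW.mem_nhds hzW)
  obtain ⟨ρ, hρ⟩ := hp _ (isCompact_closedBall z δ) hδW
  have hc : IsCompact (φ '' ({ζ | w ζ.im ≤ ζ.re} ∩ closedBall 0 ρ)) := by
    refine IsCompact.image_of_continuousOn ((isCompact_closedBall _ _).inter_left
      (isClosed_le (hw.comp Complex.continuous_im) Complex.continuous_re)) ?_
    exact H.differentiableOn.continuousOn.mono fun ζ hζ => (hw0 _).trans_le hζ.1
  have h1 : z ∈ closure (φ '' {ζ | w ζ.im ≤ ζ.re} ∩ ball z δ) := by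
    rw [mem_closure_iff_nhds] at hz ⊢
    intro t ht
    obtain ⟨x, hx, hx'⟩ := hz _ (inter_mem ht (ball_mem_nhds z hδ))
    exact ⟨x, hx.1, hx', hx.2⟩
  have h2 := closure_minimal (t := φ '' ({ζ | w ζ.im ≤ ζ.re} ∩ closedBall 0 ρ)) (by
    rintro _ ⟨⟨ζ, hζ, rfl⟩, hb⟩
    refine ⟨ζ, ⟨hζ, ?_⟩, rfl⟩
    rw [mem_closedBall_zero_iff]
    exact hρ ζ ((hw0 _).trans_le hζ) (ball_subset_closedBall hb)) hc.isClosed h1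
  exact image_mono inter_subset_left h2

theorem exists_isCompact_strip (H : IsUniformization φ ψ U) (hw0 : ∀ y, 0 < w y) (hw : Continuous w) (ρ : ℝ) :
    ∃ T, IsCompact T ∧ T ⊆ U ∧ ∀ ζ : ℂ, w ζ.im / 2 ≤ ζ.re → ζ.re ≤ w ζ.im → |ζ.im| ≤ ρ → φ ζ ∈ T := by
  let q : ℝ × ℝ → ℂ := fun x => (x.1 * w x.2 : ℝ) + x.2 * Complex.I
  have hq : Continuous q := by
    refine (Complex.continuous_ofReal.comp (continuous_fst.mul (hw.comp continuous_snd))).add ?_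
    exact (Complex.continuous_ofReal.comp continuous_snd).mul continuous_const
  have hre : ∀ x ∈ Icc (1 / 2 : ℝ) 1 ×ˢ Icc (-ρ) ρ, 0 < (q x).re := by
    rintro x ⟨h1, -⟩
    have : 0 < x.1 := by linarith [h1.1]
    have := mul_pos this (hw0 x.2)
    simpa [q] using this
  refine ⟨(fun x => φ (q x)) '' (Icc (1 / 2 : ℝ) 1 ×ˢ Icc (-ρ) ρ),
    (isCompact_Icc.prod isCompact_Icc).image_of_continuousOn
      (H.differentiableOn.continuousOn.comp hq.continuousOn hre), ?_, fun ζ h1 h2 h3 => ?_⟩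
  · rintro _ ⟨x, hx, rfl⟩
    exact H.mapsTo (hre x hx)
  · have h4 := hw0 ζ.im
    refine ⟨(ζ.re / w ζ.im, ζ.im), ⟨⟨?_, ?_⟩, abs_le.1 h3⟩, ?_⟩
    · rw [le_div_iff₀ h4]
      linarith
    · rw [div_le_one h4]
      exact h2
    · have : q (ζ.re / w ζ.im, ζ.im) = ζ := by
        simp only [q]
        rw [div_mul_cancel₀ _ h4.ne', Complex.re_add_im]
      simp only [this]

theorem escapes (H : IsUniformization φ ψ U) (hUW : U ⊆ W) (hw0 : ∀ y, 0 < w y) (hw : Continuous w)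
    (hp : ∀ C, IsCompact C → C ⊆ W → ∃ ρ : ℝ, ∀ ζ : ℂ, 0 < ζ.re → φ ζ ∈ C → ‖ζ‖ ≤ ρ)
    (hcl : W ∩ closure (φ '' {ζ | w ζ.im ≤ ζ.re}) ⊆ φ '' {ζ | w ζ.im ≤ ζ.re})
    {X : ℕ → Set ℂ} (hX : ∀ n, IsCompact (X n)) (hXW : ∀ n, X n ⊆ W) {T : Set ℂ} (hT : IsClosed T) {ζ₀ : ℂ}
    (h1 : w ζ₀.im / 2 < ζ₀.re) (h2 : ζ₀.re < w ζ₀.im) {ρ : ℝ} (hρ : ρ < |ζ₀.im|)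
    (hTρ : ∀ ζ : ℂ, w ζ.im / 2 ≤ ζ.re → ζ.re ≤ w ζ.im → φ ζ ∈ T → |ζ.im| ≤ ρ) :
    Escapes X (φ '' {ζ | w ζ.im ≤ ζ.re} ∪ T) (φ ζ₀) := by
  obtain ⟨s, hs, hs0⟩ : ∃ s : ℝ, |s| = 1 ∧ s * |ζ₀.im| = ζ₀.im := by
    rcases le_total 0 ζ₀.im with h | h
    · exact ⟨1, abs_one, by rw [abs_of_nonneg h, one_mul]⟩
    · exact ⟨-1, by simp, by rw [abs_of_nonpos h]; ring⟩
  have hw₀ := hw0 ζ₀.im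
  let θ : ℝ := ζ₀.re / w ζ₀.im
  have hθ1 : 1 / 2 < θ := by rw [lt_div_iff₀ hw₀]; linarith
  have hθ2 : θ < 1 := by rwa [div_lt_one hw₀]
  let q : ℝ → ℂ := fun t => (θ * w (s * t) : ℝ) + (s * t : ℝ) * Complex.I
  have hq : Continuous q := by
    refine (Complex.continuous_ofReal.comp (continuous_const.mul (hw.comp (by fun_prop)))).add ?_
    fun_prop
  have hqre : ∀ t, (q t).re = θ * w (q t).im := fun t => by simp [q]
  have hqim : ∀ t, 0 ≤ t → |(q t).im| = t := fun t ht => by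
    have : (q t).im = s * t := by simp [q]
    rw [this, abs_mul, hs, one_mul, abs_of_nonneg ht]
  have hqpos : ∀ t, 0 < (q t).re := fun t => by
    rw [hqre]
    exact mul_pos (by linarith) (hw0 _)
  have hq0 : q |ζ₀.im| = ζ₀ := by
    simp only [q, hs0, θ]
    rw [div_mul_cancel₀ _ hw₀.ne', Complex.re_add_im]
  refine ⟨fun i => φ (q (|ζ₀.im| + i)), fun i => (fun t => φ (q t)) '' Icc (|ζ₀.im| + i) (|ζ₀.im| + i + 1),
    by simp [hq0], fun i => ⟨?_, ?_, ?_, ?_⟩, fun k => ?_⟩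
  · exact isPreconnected_Icc.image _
      (H.differentiableOn.continuousOn.comp hq.continuousOn fun t _ => hqpos t)
  · exact ⟨_, left_mem_Icc.2 (by linarith), rfl⟩
  · refine ⟨_, right_mem_Icc.2 (by linarith), ?_⟩
    push_cast
    rw [add_assoc]
  · rw [disjoint_left]
    rintro _ ⟨t, ht, rfl⟩ hmem
    have ht0 : |ζ₀.im| ≤ t := by linarith [ht.1, (Nat.cast_nonneg i : (0 : ℝ) ≤ i)]
    have hwt := hw0 (q t).im
    rw [closure_union, hT.closure_eq] at hmem
    rcases hmem with hmem | hmem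
    · obtain ⟨η, hη, he⟩ := hcl ⟨hUW (H.mapsTo (hqpos t)), hmem⟩
      have := H.injOn (show 0 < η.re from (hw0 _).trans_le hη) (hqpos t) he
      subst this
      rw [mem_ofPred_eq, hqre] at hη
      nlinarith
    · have := hTρ (q t) (by rw [hqre]; nlinarith) (by rw [hqre]; nlinarith) hmem
      rw [hqim t ((abs_nonneg _).trans ht0)] at this
      linarith
  · obtain ⟨M, hM⟩ := hp _ (hX k) (hXW k)
    obtain ⟨j, hj⟩ := exists_nat_gt M
    filter_upwards [eventually_ge_atTop j] with i hi
    rw [disjoint_left]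
    rintro _ ⟨t, ht, rfl⟩ hmem
    have h3 := hM _ (hqpos t) hmem
    have h4 := Complex.abs_im_le_norm (q t)
    have h5 : (j : ℝ) ≤ i := by exact_mod_cast hi
    have h6 := abs_nonneg ζ₀.im
    rw [hqim t (by linarith [ht.1, (Nat.cast_nonneg i : (0 : ℝ) ≤ i)])] at h4
    linarith [ht.1]

theorem exists_differentiableOn_approx (H : IsUniformization φ ψ U) (hU : IsOpen U) (hW : IsOpen W)
    (hUW : U ⊆ W) (hw0 : ∀ y, 0 < w y) (hw : Continuous w)
    (hp : ∀ C, IsCompact C → C ⊆ W → ∃ ρ : ℝ, ∀ ζ : ℂ, 0 < ζ.re → φ ζ ∈ C → ‖ζ‖ ≤ ρ) {f : ℂ → ℂ}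
    (hf : DifferentiableOn ℂ f U) {ε : ℝ} (hε : 0 < ε) :
    ∃ g, DifferentiableOn ℂ g W ∧ ∀ ζ : ℂ, w ζ.im ≤ ζ.re → ‖g (φ ζ) - f (φ ζ)‖ ≤ ε := by
  have hcl := H.inter_closure_image_subset hW hp hw0 hw
  obtain ⟨X, hX0, hXc, hXs, hXW, hXu, hXQ⟩ := exists_exhaustion hW
    (Q := fun C T => ∃ ρ : ℝ, (∀ ζ : ℂ, 0 < ζ.re → φ ζ ∈ C → |ζ.im| ≤ ρ) ∧
      ∀ ζ : ℂ, w ζ.im / 2 ≤ ζ.re → ζ.re ≤ w ζ.im → |ζ.im| ≤ ρ → φ ζ ∈ T)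
    (fun C hC hCW => by
      obtain ⟨ρ, hρ⟩ := hp C hC hCW
      obtain ⟨T, hT, hTU, hTm⟩ := H.exists_isCompact_strip hw0 hw ρ
      exact ⟨T, hT, hTU.trans hUW, ρ, fun ζ h1 h2 => (Complex.abs_im_le_norm ζ).trans (hρ ζ h1 h2), hTm⟩)
    (fun C T T' hTT' ⟨ρ, h1, h2⟩ => ⟨ρ, h1, fun ζ a b c => hTT' (h2 ζ a b c)⟩)
  have hpos : ∀ ζ : ℂ, w ζ.im / 2 < ζ.re → 0 < ζ.re := fun ζ hζ => by linarith [hw0 ζ.im]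
  have hOU : φ '' {ζ | w ζ.im / 2 < ζ.re} ⊆ U := by
    rintro _ ⟨ζ, hζ, rfl⟩
    exact H.mapsTo (hpos ζ hζ)
  obtain ⟨g, hg, hgf⟩ := _root_.exists_differentiableOn_approx hW hX0 hXc hXs hXW hXu hcl
    (O := φ '' {ζ | w ζ.im / 2 < ζ.re}) (image_mono fun ζ (hζ : w ζ.im ≤ ζ.re) => by
      rw [mem_ofPred_eq]
      linarith [hw0 ζ.im])
    (H.isOpen_image hU (fun y => (half_pos (hw0 y)).le) (hw.div_const 2)) (hOU.trans hUW) (hf.mono hOU)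
    (fun n a ha han => by
      obtain ⟨⟨ζ, hζ, rfl⟩, hE⟩ := ha
      have hζ2 : ζ.re < w ζ.im := by
        by_contra! hle
        exact hE ⟨ζ, hle, rfl⟩
      obtain ⟨ρ, hρ, hρ'⟩ : ∃ ρ : ℝ, ρ < |ζ.im| ∧ ∀ η : ℂ, w η.im / 2 ≤ η.re → η.re ≤ w η.im →
          φ η ∈ X (n - 1) → |η.im| ≤ ρ := by
        rcases n with _ | n
        · exact ⟨|ζ.im| - 1, by linarith, fun η _ _ hη => by simp [hX0] at hη⟩
        · obtain ⟨ρ, h1, h2⟩ := hXQ n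
          refine ⟨ρ, ?_, fun η hη _ hηX => h1 η (by linarith [hw0 η.im]) hηX⟩
          by_contra! hle
          exact han (h2 ζ (le_of_lt hζ) hζ2.le hle)
      exact H.escapes hUW hw0 hw hp hcl hXc hXW (hXc _).isClosed hζ hζ2 hρ hρ') hε
  exact ⟨g, hg, fun ζ hζ => hgf _ ⟨ζ, hζ, rfl⟩⟩

end IsUniformization

theorem norm_sub_le_of_mapsTo_re_pos {f : ℂ → ℂ} {z₀ z : ℂ} {R t : ℝ}
    (hf : DifferentiableOn ℂ f (ball z₀ R)) (hre : ∀ z ∈ ball z₀ R, 0 < (f z).re) (ht : t ≤ 1 / 2)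
    (hR : 0 < R) (hz : dist z z₀ ≤ t * R) : ‖f z - f z₀‖ ≤ 4 * t * (f z₀).re := by
  have hz₀ : z₀ ∈ ball z₀ R := mem_ball_self hR
  have hzR : z ∈ ball z₀ R := by
    rw [mem_ball]
    nlinarith
  have hne : ∀ x ∈ ball z₀ R, f x + starRingEnd ℂ (f z₀) ≠ 0 := fun x hx h0 => by
    have := congrArg Complex.re h0
    simp only [Complex.add_re, Complex.conj_re, Complex.zero_re] at this
    linarith [hre x hx, hre z₀ hz₀]
  let k : ℂ → ℂ := fun x => (f x - f z₀) / (f x + starRingEnd ℂ (f z₀))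
  have hk : DifferentiableOn ℂ k (ball z₀ R) :=
    (hf.sub_const _).div (hf.add_const _) hne
  have hk0 : k z₀ = 0 := by simp [k]
  have hkb : MapsTo k (ball z₀ R) (closedBall (k z₀) 1) := fun x hx => by
    rw [hk0, mem_closedBall_zero_iff, norm_div, div_le_one (norm_pos_iff.2 (hne x hx)),
      ← sq_le_sq₀ (norm_nonneg _) (norm_nonneg _), Complex.sq_norm, Complex.sq_norm, Complex.normSq_apply,
      Complex.normSq_apply]
    simp only [Complex.sub_re, Complex.sub_im, Complex.add_re, Complex.add_im, Complex.conj_re, Complex.conj_im]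
    nlinarith [mul_pos (hre x hx) (hre z₀ hz₀)]
  have h1 := Complex.dist_le_div_mul_dist_of_mapsTo_ball hk hkb hzR
  rw [hk0, dist_zero_right, one_div, inv_mul_eq_div] at h1
  have h2 : ‖k z‖ ≤ t := h1.trans ((div_le_iff₀ hR).2 hz)
  have h3 : f z - f z₀ = k z * ((f z - f z₀) + (2 * (f z₀).re : ℝ)) := by
    have h4 : (f z - f z₀) + (2 * (f z₀).re : ℝ) = f z + starRingEnd ℂ (f z₀) := by
      apply Complex.ext <;> simp <;> ring
    rw [h4, div_mul_cancel₀ _ (hne z hzR)]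
  have h4 := hre z₀ hz₀
  have h5 : ‖f z - f z₀‖ ≤ t * (‖f z - f z₀‖ + 2 * (f z₀).re) := by
    calc ‖f z - f z₀‖ = ‖k z‖ * ‖(f z - f z₀) + (2 * (f z₀).re : ℝ)‖ := by rw [← norm_mul, ← h3]
      _ ≤ t * (‖f z - f z₀‖ + 2 * (f z₀).re) := by
        have h6 : ‖((2 * (f z₀).re : ℝ) : ℂ)‖ = 2 * (f z₀).re := by
          rw [Complex.norm_real, Real.norm_of_nonneg (by linarith)]
        have h7 := norm_add_le (f z - f z₀) ((2 * (f z₀).re : ℝ) : ℂ)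
        rw [h6] at h7
        exact mul_le_mul h2 h7 (norm_nonneg _) ((norm_nonneg _).trans h2)
  nlinarith [norm_nonneg (f z - f z₀)]

theorem IsTube.exists_step {W U : Set ℂ} {τ : ℂ → ℝ} {γ : ℝ → ℂ} {r : ℝ → ℝ} {m : ℕ → ℝ}
    {φ ψ : ℂ → ℂ} {w : ℝ → ℝ} (h : IsTube U τ γ r m) (H : IsUniformization φ ψ U) (hW : IsOpen W) (hUW : U ⊆ W)
    (hw0 : ∀ y, 0 < w y) (hw : Continuous w)
    (hp : ∀ C, IsCompact C → C ⊆ W → ∃ ρ : ℝ, ∀ ζ : ℂ, 0 < ζ.re → φ ζ ∈ C → ‖ζ‖ ≤ ρ) :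
    ∃ g, DifferentiableOn ℂ g W ∧
      ∀ ζ : ℂ, w ζ.im ≤ ζ.re → g (φ ζ) ∈ U ∧ ‖ψ (g (φ ζ)) - ζ - 1‖ < 1 / 2 := by
  obtain ⟨c, hc, hcU⟩ := h.exists_ball_subset H
  let Q : ℂ → ℂ := fun z => 1346 * Complex.log (ψ z + 2) + (1 - Real.log (c / 32) : ℝ)
  have hslit : ∀ z ∈ U, ψ z + 2 ∈ Complex.slitPlane := fun z hz => by
    have := H.mapsTo_inv hz
    refine Or.inl ?_
    simp only [mem_ofPred_eq] at this
    simp only [Complex.add_re, Complex.re_ofNat]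
    linarith
  have hQ : DifferentiableOn ℂ Q U :=
    (((H.differentiableOn_inv.add_const 2).clog hslit).const_mul _).add_const _
  obtain ⟨q, hq, hqQ⟩ := H.exists_differentiableOn_approx h.isOpen hW hUW hw0 hw hp hQ.neg one_pos
  have hshift : MapsTo (fun z => ψ z + 1) U {z | 0 < z.re} := fun z hz => by
    have := H.mapsTo_inv hz
    simp only [mem_ofPred_eq, Complex.add_re, Complex.one_re] at this ⊢
    linarith
  have hf : DifferentiableOn ℂ (fun z => φ (ψ z + 1) / Complex.exp (q z)) U :=
    (H.differentiableOn.comp (H.differentiableOn_inv.add_const 1) hshift).div (hq.mono hUW).cexp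
      fun z _ => Complex.exp_ne_zero _
  obtain ⟨g, hg, hgf⟩ := H.exists_differentiableOn_approx h.isOpen hW hUW hw0 hw hp hf one_pos
  refine ⟨fun z => Complex.exp (q z) * g z, hq.cexp.mul hg, fun ζ hζ => ?_⟩
  have hζ0 : 0 < ζ.re := (hw0 _).trans_le hζ
  have h1 : ‖Complex.exp (q (φ ζ)) * g (φ ζ) - φ (ζ + 1)‖ ≤
      c / 32 * Real.exp (-(1346 * Real.log ‖ζ + 2‖)) := by
    have e : Complex.exp (q (φ ζ)) * g (φ ζ) - φ (ζ + 1) = Complex.exp (q (φ ζ)) *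
        (g (φ ζ) - φ (ψ (φ ζ) + 1) / Complex.exp (q (φ ζ))) := by
      rw [mul_sub, mul_div_cancel₀ _ (Complex.exp_ne_zero _), H.left_inv ζ hζ0]
    rw [e, norm_mul, Complex.norm_exp]
    refine (mul_le_of_le_one_right (Real.exp_pos _).le (hgf ζ hζ)).trans ?_
    have h2 := (Complex.re_le_norm _).trans (hqQ ζ hζ)
    have h3 : (Q (φ ζ)).re = 1346 * Real.log ‖ζ + 2‖ + (1 - Real.log (c / 32)) := by
      simp only [Q, H.left_inv ζ hζ0, Complex.add_re, Complex.ofReal_re, Complex.mul_re, Complex.log_re,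
        Complex.re_ofNat, Complex.im_ofNat, zero_mul, sub_zero]
    rw [Complex.sub_re, Pi.neg_apply, Complex.neg_re, h3] at h2
    calc Real.exp (q (φ ζ)).re ≤ Real.exp (Real.log (c / 32) + -(1346 * Real.log ‖ζ + 2‖)) :=
          Real.exp_le_exp.2 (by linarith)
      _ = _ := by rw [Real.exp_add, Real.exp_log (by positivity)]
  set s : ℝ := ‖ζ + 2‖ with hs
  have hs2 : 2 ≤ s := by
    have := Complex.re_le_norm (ζ + 2)
    simp only [Complex.add_re, Complex.re_ofNat] at this
    linarith
  have hlog : Real.log (‖ζ + 1‖ + 1) ≤ 2 * Real.log s := by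
    have h2 : ‖ζ + 1‖ ≤ s + 1 := by
      have := norm_sub_le (ζ + 2) 1
      rw [norm_one] at this
      have e : ζ + 2 - 1 = ζ + 1 := by ring
      rwa [e] at this
    have h3 : ‖ζ + 1‖ + 1 ≤ s ^ 2 := by nlinarith
    have := Real.log_le_log (by positivity) h3
    rwa [Real.log_pow, Nat.cast_ofNat] at this
  have hζ1 : 0 < (ζ + 1).re := by
    simp only [Complex.add_re, Complex.one_re]
    linarith
  set R : ℝ := c * Real.exp (-(672 * Real.log (‖ζ + 1‖ + 1))) with hRdef
  have hR : 0 < R := by positivity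
  have hRU : ball (φ (ζ + 1)) R ⊆ U := hcU (ζ + 1) (by
    simp only [Complex.add_re, Complex.one_re]
    linarith)
  have hs0 : 0 < s := by linarith
  have hsexp : Real.exp (-(2 * Real.log s)) = 1 / s ^ 2 := by
    rw [Real.exp_neg, two_mul, Real.exp_add, Real.exp_log hs0, one_div, sq]
  have ht : 1 / (32 * s ^ 2) ≤ 1 / 2 := by
    rw [div_le_div_iff₀ (by positivity) two_pos]
    nlinarith
  have hd : dist (Complex.exp (q (φ ζ)) * g (φ ζ)) (φ (ζ + 1)) ≤ 1 / (32 * s ^ 2) * R := by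
    rw [dist_eq_norm]
    refine h1.trans ?_
    have e : Real.exp (-(1346 * Real.log s)) = 1 / s ^ 2 * Real.exp (-(1344 * Real.log s)) := by
      rw [← hsexp, ← Real.exp_add]
      congr 1
      ring
    have h3 : Real.exp (-(1344 * Real.log s)) ≤ Real.exp (-(672 * Real.log (‖ζ + 1‖ + 1))) :=
      Real.exp_le_exp.2 (by linarith)
    calc c / 32 * Real.exp (-(1346 * Real.log s))
        = c * (1 / (32 * s ^ 2)) * Real.exp (-(1344 * Real.log s)) := by rw [e]; field_simp
      _ ≤ c * (1 / (32 * s ^ 2)) * Real.exp (-(672 * Real.log (‖ζ + 1‖ + 1))) := by gcongr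
      _ = 1 / (32 * s ^ 2) * R := by rw [hRdef]; ring
  have h5 := norm_sub_le_of_mapsTo_re_pos (f := ψ) (H.differentiableOn_inv.mono hRU)
    (fun z hz => H.mapsTo_inv (hRU hz)) ht hR hd
  rw [H.left_inv _ hζ1, ← sub_sub] at h5
  refine ⟨hRU ?_, h5.trans_lt ?_⟩
  · rw [mem_ball]
    nlinarith
  · have h6 : (ζ + 1).re ≤ s := by
      have := Complex.re_le_norm (ζ + 2)
      simp only [Complex.add_re, Complex.re_ofNat, Complex.one_re] at this ⊢
      linarith
    calc 4 * (1 / (32 * s ^ 2)) * (ζ + 1).re ≤ 4 * (1 / (32 * s ^ 2)) * s := by gcongr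
      _ = 1 / (8 * s) := by field_simp; norm_num
      _ < 1 / 2 := by
        rw [div_lt_div_iff₀ (by positivity) two_pos]
        linarith

theorem exists_forall_le_half_infDist {W : Set ℂ} (hW : IsOpen W) (hWf : (frontier W).Nonempty) {γ : ℝ → ℂ}
    (hγ : Continuous γ) (hγW : ∀ t, 0 ≤ t → γ t ∈ W) {ε : ℕ → ℝ} (hε : Tendsto ε atTop (𝓝 0)) (k : ℕ) :
    ∃ N : ℕ, ∀ n, N ≤ n → ∀ u ∈ Icc (0 : ℝ) (k + 1), ε n ≤ infDist (γ u) (frontier W) / 2 := by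
  obtain ⟨c, hc, hcu⟩ := (isCompact_Icc (a := (0 : ℝ)) (b := k + 1)).exists_forall_le'
    (f := fun u => infDist (γ u) (frontier W)) (a := 0)
    ((continuous_infDist_pt _).comp hγ).continuousOn fun u hu => by
      refine (isClosed_frontier.notMem_iff_infDist_pos hWf).1 ?_
      rw [hW.frontier_eq]
      exact fun h => h.2 (hγW u hu.1)
  obtain ⟨N, hN⟩ := eventually_atTop.1 (hε.eventually_lt_const (half_pos hc))
  exact ⟨N, fun n hn u hu => by linarith [hN n hn, hcu u hu]⟩

theorem exists_slow_escape_of_continuous {W : Set ℂ} (hW : IsOpen W) (hWb : Bornology.IsBounded W)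
    (hWf : (frontier W).Nonempty) {γ : ℝ → ℂ} (hγ : Continuous γ) (hγW : ∀ t, 0 ≤ t → γ t ∈ W)
    (hinj : InjOn γ (Ici 0))
    (hproper : ∀ C, IsCompact C → C ⊆ W → ∃ T : ℝ, ∀ t, T ≤ t → γ t ∉ C)
    {ε : ℕ → ℝ} (hε : Tendsto ε atTop (𝓝 0)) :
    ∃ (g : ℂ → ℂ) (V : Set ℂ), DifferentiableOn ℂ g W ∧ IsOpen V ∧ IsConnected V ∧
      SimplyConnectedSpace V ∧ (∀ t, 0 ≤ t → γ t ∈ V) ∧ V ⊆ W ∧ MapsTo g V V ∧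
      ∀ z ∈ V, {w : ℂ | ∃ k : ℕ → ℕ, StrictMono k ∧ Tendsto (fun j => g^[k j] z) atTop (𝓝 w)} =
          {w : ℂ | ∃ t : ℕ → ℝ, (∀ n, 0 ≤ t n) ∧ Tendsto t atTop atTop ∧
            Tendsto (fun n => γ (t n)) atTop (𝓝 w)} ∧
        ∃ n₀ : ℕ, ∀ n : ℕ, n₀ ≤ n → ε n ≤ infDist (g^[n] z) (frontier W) := by
  choose N hN using exists_forall_le_half_infDist hW hWf hγ hγW hε
  let δ : ℕ → ℝ := fun k =>
    dist (γ (k + 1)) (γ k) / 4 * Real.exp (-(672 * Real.log (N (k + 1) + 1)) - k)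
  have hδ : ∀ k, 0 < δ k := fun k => by
    have : 0 < dist (γ (k + 1)) (γ k) := dist_pos.2 fun h => by
      have := hinj (show (0 : ℝ) ≤ k + 1 by positivity) (show (0 : ℝ) ≤ k by positivity) h
      linarith
    positivity
  obtain ⟨U, τ, r, a, h, hUW, ha, haγ, hrδ, hrW, hr⟩ := exists_isTube hW hWb hWf hγ hγW hinj hproper hδ
  obtain ⟨φ, ψ, H, hub⟩ := h.exists_isUniformization
  obtain ⟨w, hw0, hwl, hwγ⟩ := h.exists_barrier H hub
  have hw := continuous_of_le_add_abs hwl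
  obtain ⟨g, hg, hgs⟩ := h.exists_step H hW hUW hw0 hw
    fun C hC hCW => h.exists_norm_le_of_mem H hub hW hproper hr hC hCW
  have hpos : ∀ ζ : ℂ, w ζ.im < ζ.re → 0 < ζ.re := fun ζ hζ => (hw0 _).trans hζ
  have hsc := H.simplyConnectedSpace_image (fun y => (hw0 y).le) hw
  have hmaps : MapsTo g (φ '' {ζ | w ζ.im < ζ.re}) (φ '' {ζ | w ζ.im < ζ.re}) := by
    rintro _ ⟨ζ, hζ, rfl⟩
    obtain ⟨h1, h2⟩ := hgs ζ (le_of_lt hζ)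
    exact ⟨ψ (g (φ ζ)), lt_re_of_norm_sub_lt hwl hζ h2, H.right_inv _ h1⟩
  refine ⟨g, φ '' {ζ | w ζ.im < ζ.re}, hg, H.isOpen_image h.isOpen (fun y => (hw0 y).le) hw,
    isConnected_iff_connectedSpace.2 inferInstance, hsc,
    fun t ht => ⟨ψ (γ t), hwγ t ht, H.right_inv _ (h.curve_mem t ht)⟩, ?_, hmaps, fun z hz => ?_⟩
  · rintro _ ⟨ζ, hζ, rfl⟩
    exact hUW (H.mapsTo (hpos ζ hζ))
  have hmem : ∀ n, ∃ ζ : ℂ, w ζ.im < ζ.re ∧ φ ζ = g^[n] z := fun n => by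
    obtain ⟨ζ, h1, h2⟩ := hmaps.iterate n hz
    exact ⟨ζ, h1, h2⟩
  choose ζ hζw hζφ using hmem
  have hstep : ∀ n, ‖ζ (n + 1) - ζ n - 1‖ ≤ 1 / 2 := fun n => by
    have h1 := (hgs (ζ n) (hζw n).le).2
    rw [hζφ n, ← Function.iterate_succ_apply' g, ← hζφ (n + 1), H.left_inv _ (hpos _ (hζw _))] at h1
    exact h1.le
  have h0 := hpos _ (hζw 0)
  constructor
  · rw [← h.setOf_accumulation_eq H hub hr h0 hstep]
    simp only [hζφ]
  · obtain ⟨n₀, hn₀⟩ := eventually_atTop.1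
      (h.eventually_le_of_step H ha haγ hrδ (fun k => le_rfl) h0 hstep)
    refine ⟨n₀, fun n hn => ?_⟩
    have hnn := h.nonneg (φ (ζ n))
    have h1 := hN _ n (hn₀ n hn) (τ (φ (ζ n))) ⟨hnn, (Nat.lt_floor_add_one _).le⟩
    have h2 := hrW _ hnn
    have h3 := h.dist_lt _ (H.mapsTo (hpos _ (hζw n)))
    have h4 := infDist_le_infDist_add_dist (s := frontier W) (x := γ (τ (φ (ζ n)))) (y := φ (ζ n))
    rw [dist_comm] at h4
    rw [← hζφ]
    linarith

/-- **Arbitrarily slow escape in Baker domains, planar bounded case.**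
Let `W ⊊ ℂ` be a bounded domain, `γ : [0,∞) → W` an injective continuous curve
tending to the boundary of `W` with accumulation set `K ⊆ ∂W`, and let `(ε n)` be
positive reals with `ε n → 0`.  Then there exist a holomorphic `g : W → ℂ` and an
open, connected, simply connected set `V` with `γ ⊆ V ⊆ W`, `g(V) ⊆ V`, such that for
every `z ∈ V` the set of accumulation points of the orbit `(g^[n] z)` equals `K` and
eventually `dist (g^[n] z) (∂W) ≥ ε n`. -/
theorem baker_domain_arbitrarily_slow_escape
    (W : Set ℂ) (hWopen : IsOpen W) (hWconn : IsConnected W)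
    (hWbdd : Bornology.IsBounded W) (hWne : W ≠ Set.univ)
    (γ : ℝ → ℂ) (hγW : ∀ t : ℝ, 0 ≤ t → γ t ∈ W)
    (hγcont : ContinuousOn γ (Set.Ici 0)) (hγinj : Set.InjOn γ (Set.Ici 0))
    (hγbdry : ∀ C : Set ℂ, IsCompact C → C ⊆ W → ∃ T : ℝ, ∀ t : ℝ, T ≤ t → γ t ∉ C)
    (K : Set ℂ)
    (hK : K = {w : ℂ | ∃ t : ℕ → ℝ, (∀ n, 0 ≤ t n) ∧
        Filter.Tendsto t Filter.atTop Filter.atTop ∧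
        Filter.Tendsto (fun n => γ (t n)) Filter.atTop (nhds w)})
    (ε : ℕ → ℝ) (hεpos : ∀ n, 0 < ε n)
    (hεlim : Filter.Tendsto ε Filter.atTop (nhds 0)) :
    ∃ (g : ℂ → ℂ) (V : Set ℂ),
      DifferentiableOn ℂ g W ∧
      IsOpen V ∧ IsConnected V ∧ SimplyConnectedSpace ↥V ∧
      (∀ t : ℝ, 0 ≤ t → γ t ∈ V) ∧ V ⊆ W ∧ Set.MapsTo g V V ∧
      ∀ z ∈ V,
        {w : ℂ | ∃ k : ℕ → ℕ, StrictMono k ∧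
            Filter.Tendsto (fun j => g^[k j] z) Filter.atTop (nhds w)} = K ∧
        ∃ n₀ : ℕ, ∀ n : ℕ, n₀ ≤ n → ε n ≤ Metric.infDist (g^[n] z) (frontier W) := by
  have hWf : (frontier W).Nonempty := nonempty_frontier_iff.2 ⟨hWconn.nonempty, hWne⟩
  have heq : ∀ t : ℝ, 0 ≤ t → γ (max t 0) = γ t := fun t ht => by rw [max_eq_left ht]
  obtain ⟨g, V, hg, hVo, hVc, hVs, hγV, hVW, hmaps, hz⟩ := exists_slow_escape_of_continuous hWopen hWbdd hWf
    (γ := fun t => γ (max t 0))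
    (hγcont.comp_continuous (by fun_prop) fun t => le_max_right t 0)
    (fun t _ => hγW _ (le_max_right t 0))
    (fun s hs t ht hst => hγinj hs ht (by simpa only [heq s hs, heq t ht] using hst))
    (fun C hC hCW => by
      obtain ⟨T, hT⟩ := hγbdry C hC hCW
      exact ⟨T, fun t ht => hT _ (ht.trans (le_max_left t 0))⟩) hεlim
  refine ⟨g, V, hg, hVo, hVc, hVs, fun t ht => heq t ht ▸ hγV t ht, hVW, hmaps, fun z hzV => ⟨?_, (hz z hzV).2⟩⟩
  rw [(hz z hzV).1, hK]
  ext w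
  refine exists_congr fun t => and_congr_right fun ht => and_congr_right fun _ => ?_
  simp only [fun n => heq (t n) (ht n)]
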